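/- arXiv:2406.01019 — 3 statements merged into one kernel-verified Lean document; each statement's English description precedes it below -/
import Mathlib

section
/- Let $k$ be a field of characteristic zero, let $s, t \geq 1$ and $u \geq 0$ be integers, and let $c_1, c_2 \in k \setminus \{0\}$. Then the $k$-derivation $d = \partial_x + x^u(c_1 x^t y^s + c_2)\partial_y$ of $k[x,y]$ (i.e., the derivation with $d(x) = 1$ and $d(y) = x^u(c_1 x^t y^s + c_2)$) is simple. -/
open MvPolynomial

/-- A `k`-derivation `d` of `k[x,y]` is *simple* if the only `d`-differential ideals
(ideals `I` with `d(I) ⊆ I`) are `(0)` and the whole ring. Here `k[x,y]` is modelled as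
`MvPolynomial (Fin 2) k`, with `x = X 0` and `y = X 1`. -/
def IsSimpleDerivation {k : Type*} [CommRing k]
    (d : Derivation k (MvPolynomial (Fin 2) k) (MvPolynomial (Fin 2) k)) : Prop :=
  ∀ I : Ideal (MvPolynomial (Fin 2) k), (∀ f ∈ I, d f ∈ I) → I = ⊥ ∨ I = ⊤


namespace SimpDer

/-- The coefficient recursion on integer-indexed arrays. -/
def Rec {K : Type*} [Field K] (s t u : ℕ) (c₁ c₂ l : K) (c : ℤ → ℤ → K) : Prop :=
  ∀ p q : ℤ, ((p : K) + 1) * c (p + 1) q + ((q : K) + 1) * c₂ * c (p - u) (q + 1)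
    + ((q : K) - s + 1) * c₁ * c (p - t - u) (q - s + 1) = l * c (p - t - u) (q - s + 1)

section core
variable {K : Type*} [Field K] [CharZero K] {s t u : ℕ} {c₁ c₂ l : K} {c : ℤ → ℤ → K}

lemma core1 (hs : 1 ≤ s) (hc₂ : c₂ ≠ 0)
    (hR : Rec s t u c₁ c₂ l c) (hpos : ∀ p q, c p q ≠ 0 → 0 ≤ p ∧ 0 ≤ q)
    {B : ℤ} (hB : ∀ p q, c p q ≠ 0 → p ≤ B ∧ q ≤ B) (hne : ∃ p q, c p q ≠ 0) :
    ∃ a : ℕ, c a 0 ≠ 0 ∧ ∀ p q, c p q ≠ 0 → s * p - t * q ≤ s * a := by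
  -- maximal weight
  obtain ⟨M, ⟨p0, q0, h0, hM0⟩, hM⟩ : ∃ M : ℤ, (∃ p q, c p q ≠ 0 ∧ s * p - t * q = M) ∧
      ∀ z, (∃ p q, c p q ≠ 0 ∧ s * p - t * q = z) → z ≤ M := by
    apply Int.exists_greatest_of_bdd
    · refine ⟨s * B, ?_⟩
      rintro z ⟨p, q, h, rfl⟩
      have h1 := hpos p q h
      have h2 := hB p q h
      have : (s : ℤ) * p ≤ s * B := by gcongr; exact h2.1
      have : 0 ≤ (t : ℤ) * q := by have := h1.2; positivity
      linarith
    · obtain ⟨p, q, h⟩ := hne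
      exact ⟨_, p, q, h, rfl⟩
  obtain ⟨q, ⟨p, h, hpq⟩, hq⟩ : ∃ q : ℤ, (∃ p, c p q ≠ 0 ∧ s * p - t * q = M) ∧
      ∀ z, (∃ p, c p z ≠ 0 ∧ s * p - t * z = M) → q ≤ z := by
    apply Int.exists_least_of_bdd
    · refine ⟨0, ?_⟩
      rintro z ⟨p, h, _⟩
      exact (hpos p z h).2
    · exact ⟨q0, p0, h0, hM0⟩
  have hw : ∀ p q, c p q ≠ 0 → s * p - t * q ≤ M := fun p q h => hM _ ⟨p, q, h, rfl⟩
  have hz : q = 0 := by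
    by_contra hq0
    have e := hR (p + u) (q - 1)
    have e1 : c (p + u + 1) (q - 1) = 0 := by
      by_contra hh
      have := hw _ _ hh
      have hs' : (1:ℤ) ≤ s := by exact_mod_cast hs
      have : 0 ≤ (s : ℤ) * u := by positivity
      have : 0 ≤ (t : ℤ) := by positivity
      nlinarith
    have e2 : c (p + u - t - u) (q - 1 - s + 1) = 0 := by
      by_contra hh
      have := hq _ ⟨_, hh, by rw [← hpq]; ring⟩
      omega
    rw [e1, e2] at e
    simp only [add_sub_cancel_right, sub_add_cancel, mul_zero, add_zero, zero_add] at e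
    push_cast at e
    have : (q : K) ≠ 0 := by exact_mod_cast hq0
    simp [this, hc₂, h] at e
  subst hz
  lift p to ℕ using (hpos p 0 h).1
  refine ⟨p, h, fun p' q' h' => ?_⟩
  have := hw _ _ h'
  linarith

lemma core2 (hs : 1 ≤ s) (ht : 1 ≤ t) (hc₁ : c₁ ≠ 0) (hc₂ : c₂ ≠ 0)
    (hR : Rec s t u c₁ c₂ l c) (hpos : ∀ p q, c p q ≠ 0 → 0 ≤ p ∧ 0 ≤ q)
    {B : ℤ} (hB : ∀ p q, c p q ≠ 0 → p ≤ B ∧ q ≤ B) (a : ℕ) (ha : c a 0 ≠ 0)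
    (hw : ∀ p q, c p q ≠ 0 → s * p - t * q ≤ s * a) : l = 0 ∧ a = 0 := by
  have hs' : (1:ℤ) ≤ s := by exact_mod_cast hs
  have hsK : (s : K) ≠ 0 := by exact_mod_cast (by omega : s ≠ 0)
  set b : ℕ → K := fun i => c (a + t * i) (s * i) with hb
  set h : ℕ → K := fun i => c (a + t * i - 1 - u) (s * i + 1) with hh
  have hb0 : b 0 ≠ 0 := by simpa [hb] using ha
  have eqb : ∀ i : ℕ, (s * (i + 1) : K) * c₂ * b (i + 1) = (l - s * i * c₁) * b i := by
    intro i
    have e := hR (a + t * i + t + u) (s * i + s - 1)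
    have e1 : c (a + t * i + t + u + 1) (s * i + s - 1) = 0 := by
      by_contra hne
      have := hw _ _ hne
      have : 0 ≤ (s : ℤ) * u := by positivity
      have : 0 ≤ (t : ℤ) := by positivity
      nlinarith
    rw [e1] at e
    have e2 : c (a + t * i + t + u - u) (s * i + s - 1 + 1) = b (i + 1) := by
      simp only [hb]; congr 1 <;> push_cast <;> ring
    have e3 : c (a + t * i + t + u - t - u) (s * i + s - 1 - s + 1) = b i := by
      simp only [hb]; congr 1 <;> ring
    rw [e2, e3] at e
    push_cast at e
    linear_combination e
  have eqh : ∀ i : ℕ, ((a : K) + t * (i + 1)) * b (i + 1) + (s * (i + 1) + 1) * c₂ * h (i + 1)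
      = (l - (s * i + 1) * c₁) * h i := by
    intro i
    have e := hR (a + t * (i + 1 : ℕ) - 1) (s * (i + 1 : ℕ))
    have e1 : c (a + t * (i + 1 : ℕ) - 1 + 1) (s * (i + 1 : ℕ)) = b (i + 1) := by
      simp only [hb]; congr 1; ring
    have e3 : c (a + t * (i + 1 : ℕ) - 1 - t - u) (s * (i + 1 : ℕ) - s + 1) = h i := by
      simp only [hh]; congr 1 <;> push_cast <;> ring
    rw [e1, e3] at e
    change _ + _ * h (i + 1) + _ = _ at e
    push_cast at e
    linear_combination e
  have eqh0 : (a : K) * b 0 + c₂ * h 0 = (l + (s - 1) * c₁) * c (a - 1 - t - u) (1 - s) := by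
    have e := hR (a - 1) 0
    have e3 : c (a - 1 - t - u) (0 - s + 1) = c (a - 1 - t - u) (1 - s) := by
      congr 1; ring
    have e1 : c (a - 1 + 1) 0 = b 0 := by simp [hb]
    have e2 : c (a - 1 - u) (0 + 1) = h 0 := by simp [hh]
    rw [e1, e2, e3] at e
    push_cast at e
    linear_combination e
  have hex : ∃ i, b (i + 1) = 0 := by
    refine ⟨B.toNat, ?_⟩
    by_contra hne
    have := (hB _ _ hne).2
    have h3 := Int.self_le_toNat B
    have : (B.toNat : ℤ) + 1 ≤ s * ((B.toNat : ℤ) + 1) := by nlinarith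
    push_cast at *
    linarith
  classical
  obtain ⟨m, hm, hmin⟩ : ∃ m, b (m + 1) = 0 ∧ ∀ i, i ≤ m → b i ≠ 0 := by
    refine ⟨Nat.find hex, Nat.find_spec hex, ?_⟩
    intro i hi
    cases i with
    | zero => exact hb0
    | succ i => exact Nat.find_min hex (by omega)
  have hl : l = s * m * c₁ := by
    have e := eqb m
    rw [hm, mul_zero] at e
    rcases mul_eq_zero.1 e.symm with e | e
    · exact sub_eq_zero.1 e
    · exact absurd e (hmin m le_rfl)
  have hbz : ∀ i, m < i → b i = 0 := by
    intro i hi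
    induction i, hi using Nat.le_induction with
    | base => exact hm
    | succ i hi ih =>
      have e := eqb i
      rw [ih, mul_zero] at e
      have h1 : ((i : K) + 1) ≠ 0 := by exact_mod_cast Nat.succ_ne_zero i
      simpa [hsK, h1, hc₂] using e
  have key : ∃ r : ℚ, 0 ≤ r ∧ (0 < a + t * m → 0 < r) ∧ c₂ * h m = - (r : K) * b m := by
    rcases Nat.lt_or_ge s 2 with hs2 | hs2
    · have hs1 : s = 1 := by omega
      refine ⟨(a + t * m) / (m + 1), by positivity, ?_, ?_⟩
      · intro h0
        have : (0 : ℚ) < a + t * m := by exact_mod_cast h0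
        positivity
      · have hm1 : ((m : K) + 1) ≠ 0 := by exact_mod_cast Nat.succ_ne_zero m
        push_cast
        cases m with
        | zero =>
          rw [hl, hs1] at eqh0
          simp at eqh0 ⊢
          linear_combination eqh0
        | succ j =>
          have e := eqh j
          rw [hl, hs1] at e
          push_cast at e hm1 ⊢
          field_simp
          linear_combination e
    · have gen : ∀ i, i ≤ m → ∃ r : ℚ, 0 ≤ r ∧ (0 < a + t * i → 0 < r) ∧
          c₂ * h i = - (r : K) * b i := by
        intro i
        induction i with
        | zero =>
          intro _
          refine ⟨a, by positivity, by simp, ?_⟩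
          have : c (a - 1 - t - u) (1 - s) = 0 := by
            by_contra hne
            have := (hpos _ _ hne).2
            omega
          rw [this] at eqh0
          push_cast
          linear_combination eqh0
        | succ i ih =>
          intro hi
          obtain ⟨r, hr, -, er⟩ := ih (by omega)
          obtain ⟨j, rfl⟩ : ∃ j, m = i + 1 + j := ⟨m - (i + 1), by omega⟩
          have h1 : (0 : ℚ) ≤ s * (j + 1) - 1 := by
            have : (2 : ℚ) ≤ s := by exact_mod_cast hs2
            have : (0 : ℚ) ≤ j := by positivity
            nlinarith
          refine ⟨((a + t * (i + 1)) + (s * (j + 1) - 1) * r * (i + 1) / (j + 1)) / (s * (i + 1) + 1),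
            by positivity, ?_, ?_⟩
          · intro h0
            have : (0 : ℚ) < a + t * (i + 1) := by exact_mod_cast h0
            positivity
          · have e1 := eqb i
            have e2 := eqh i
            rw [hl] at e1 e2
            have n1 : ((j : K) + 1) ≠ 0 := by exact_mod_cast Nat.succ_ne_zero j
            have n2 : ((s : K) * (i + 1) + 1) ≠ 0 := by exact_mod_cast Nat.succ_ne_zero (s * (i + 1))
            have e1' : ((i : K) + 1) * c₂ * b (i + 1) = (j + 1) * c₁ * b i := by
              apply mul_left_cancel₀ hsK
              push_cast at e1
              linear_combination e1
            have e3 : c₁ * h i * (j + 1) = - (r : K) * ((i + 1) * b (i + 1)) := by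
              apply mul_left_cancel₀ hc₂
              linear_combination (c₁ * (j + 1)) * er + (r : K) * e1'
            push_cast at e2 ⊢
            rw [neg_mul, div_mul_eq_mul_div, ← neg_div, eq_div_iff n2]
            field_simp
            linear_combination ((j : K) + 1) * e2 + ((s : K) * (j + 1) - 1) * e3
      exact gen m le_rfl
  obtain ⟨r, hr, hr0, er⟩ := key
  by_cases h0 : a + t * m = 0
  · have h1 : a = 0 := by omega
    have h2 : t * m = 0 := by omega
    have h3 : m = 0 := by
      rcases Nat.mul_eq_zero.1 h2 with h | h
      · omega
      · exact h
    exact ⟨by rw [hl, h3]; simp, h1⟩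
  exfalso
  have hrK : (r : K) ≠ 0 := by exact_mod_cast (hr0 (by omega)).ne'
  have hne : ∀ i, m ≤ i → h i ≠ 0 := by
    intro i hi
    induction i, hi using Nat.le_induction with
    | base =>
      intro hz
      rw [hz, mul_zero] at er
      have := hmin m le_rfl
      simp [hrK, this] at er
    | succ i hi ih =>
      intro hz
      have e := eqh i
      rw [hz, hbz (i + 1) (by omega), hl] at e
      obtain ⟨j, rfl⟩ : ∃ j, i = m + j := ⟨i - m, by omega⟩
      have n2 : ((s : K) * j + 1) ≠ 0 := by exact_mod_cast Nat.succ_ne_zero (s * j)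
      have : ((s : K) * j + 1) * c₁ * h (m + j) = 0 := by
        push_cast at e
        linear_combination e
      simp [n2, hc₁, ih] at this
  have h1 := (hB _ _ (hne (m + B.toNat) (by omega))).2
  have h3 := Int.self_le_toNat B
  push_cast at h1
  have : ((m : ℤ) + B.toNat) ≤ s * ((m : ℤ) + B.toNat) := by nlinarith
  linarith

lemma core (hs : 1 ≤ s) (ht : 1 ≤ t) (hc₁ : c₁ ≠ 0) (hc₂ : c₂ ≠ 0)
    (hR : Rec s t u c₁ c₂ l c) (hpos : ∀ p q, c p q ≠ 0 → 0 ≤ p ∧ 0 ≤ q)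
    {B : ℤ} (hB : ∀ p q, c p q ≠ 0 → p ≤ B ∧ q ≤ B) :
    ∀ p q, c p q ≠ 0 → p = 0 ∧ q = 0 := by
  by_contra! hcon
  obtain ⟨p, q, hpq, hne⟩ := hcon
  obtain ⟨a, ha, hw⟩ := core1 hs hc₂ hR hpos hB ⟨p, q, hpq⟩
  obtain ⟨hl, -⟩ := core2 hs ht hc₁ hc₂ hR hpos hB a ha hw
  subst hl
  set c' : ℤ → ℤ → K := fun p q => if p = 0 ∧ q = 0 then 0 else c p q with hc'
  have hle : ∀ p q, c' p q ≠ 0 → c p q ≠ 0 := by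
    intro p q h
    simp only [hc'] at h
    split_ifs at h with h1
    · exact absurd rfl h
    · exact h
  have hm : ∀ (x : K) (p q : ℤ), (p = 0 → q = 0 → x = 0) → x * c' p q = x * c p q := by
    intro x p q h
    simp only [hc']
    split_ifs with h1
    · simp [h h1.1 h1.2]
    · rfl
  have hR' : Rec s t u c₁ c₂ 0 c' := by
    intro p q
    have e := hR p q
    rw [zero_mul] at e ⊢
    rw [← e, hm, hm, hm]
    · intro _ h
      have : (q : K) - s + 1 = 0 := by exact_mod_cast h
      simp [this]
    · intro _ h
      have : (q : K) + 1 = 0 := by exact_mod_cast h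
      simp [this]
    · intro h _
      exact_mod_cast h
  have hpos' : ∀ p q, c' p q ≠ 0 → 0 ≤ p ∧ 0 ≤ q := fun p q h => hpos p q (hle p q h)
  have hB' : ∀ p q, c' p q ≠ 0 → p ≤ B ∧ q ≤ B := fun p q h => hB p q (hle p q h)
  have hne' : c' p q ≠ 0 := by
    simp only [hc']
    rw [if_neg]
    · exact hpq
    · rintro ⟨h1, h2⟩; exact hne h1 h2
  obtain ⟨a, ha, hw⟩ := core1 hs hc₂ hR' hpos' hB' ⟨p, q, hne'⟩
  obtain ⟨-, h0⟩ := core2 hs ht hc₁ hc₂ hR' hpos' hB' a ha hw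
  subst h0
  simp [hc'] at ha

end core
end SimpDer

namespace SimpDer

/-- The ring `K[x][y]`. -/
abbrev A (K : Type*) [Field K] := Polynomial (Polynomial K)

section biv
variable {K : Type*} [Field K]

/-- Integer-indexed coefficients. -/
noncomputable def cf (f : A K) (p q : ℤ) : K :=
  if 0 ≤ p ∧ 0 ≤ q then (f.coeff q.toNat).coeff p.toNat else 0

lemma cf_nat (f : A K) (p q : ℕ) : cf f p q = (f.coeff q).coeff p := by
  simp [cf]

lemma cf_pos {f : A K} {p q : ℤ} (h : cf f p q ≠ 0) : 0 ≤ p ∧ 0 ≤ q := by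
  by_contra hh
  exact h (by simp only [cf, if_neg hh])

lemma cf_neg (f : A K) {p q : ℤ} (h : p < 0 ∨ q < 0) : cf f p q = 0 := by
  simp only [cf]
  rw [if_neg]
  omega

lemma cf_ext {f g : A K} (h : ∀ p q, cf f p q = cf g p q) : f = g := by
  ext q p
  have := h p q
  rwa [cf_nat, cf_nat] at this

lemma cf_zero (p q : ℤ) : cf (0 : A K) p q = 0 := by simp [cf]

lemma cf_add (f g : A K) (p q : ℤ) : cf (f + g) p q = cf f p q + cf g p q := by
  simp only [cf]; split_ifs <;> simp

lemma cf_sum {ι : Type*} (S : Finset ι) (f : ι → A K) (p q : ℤ) :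
    cf (∑ i ∈ S, f i) p q = ∑ i ∈ S, cf (f i) p q := by
  classical
  induction S using Finset.induction_on with
  | empty => simp [cf_zero]
  | insert a S ha ih => rw [Finset.sum_insert ha, Finset.sum_insert ha, cf_add, ih]

lemma cf_CC (a : K) (f : A K) (p q : ℤ) :
    cf (Polynomial.C (Polynomial.C a) * f) p q = a * cf f p q := by
  simp only [cf]; split_ifs <;> simp

lemma cf_Xpow (j : ℕ) (f : A K) (p q : ℤ) :
    cf (Polynomial.X ^ j * f) p q = cf f p (q - j) := by
  by_cases h : 0 ≤ p ∧ 0 ≤ q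
  · obtain ⟨h1, h2⟩ := h
    lift p to ℕ using h1
    lift q to ℕ using h2
    rw [cf_nat, Polynomial.coeff_X_pow_mul']
    split_ifs with h
    · rw [← Nat.cast_sub h, cf_nat]
    · rw [cf_neg _ (by omega), Polynomial.coeff_zero]
  · rw [cf_neg, cf_neg] <;> omega

lemma cf_CXpow (j : ℕ) (f : A K) (p q : ℤ) :
    cf (Polynomial.C (Polynomial.X ^ j) * f) p q = cf f (p - j) q := by
  by_cases h : 0 ≤ p ∧ 0 ≤ q
  · obtain ⟨h1, h2⟩ := h
    lift p to ℕ using h1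
    lift q to ℕ using h2
    rw [cf_nat, Polynomial.coeff_C_mul, Polynomial.coeff_X_pow_mul']
    split_ifs with h
    · rw [← Nat.cast_sub h, cf_nat]
    · rw [cf_neg _ (by omega)]
  · rw [cf_neg, cf_neg] <;> omega

lemma cf_derivative (f : A K) (p q : ℤ) :
    cf (Polynomial.derivative f) p q = (q + 1) * cf f p (q + 1) := by
  by_cases h : 0 ≤ p ∧ 0 ≤ q
  · obtain ⟨h1, h2⟩ := h
    lift p to ℕ using h1
    lift q to ℕ using h2
    have : cf f p ((q : ℤ) + 1) = (f.coeff (q + 1)).coeff p := by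
      rw [← cf_nat]; push_cast; rfl
    rw [cf_nat, Polynomial.coeff_derivative, this]
    have : ((q : Polynomial K) + 1) = Polynomial.C ((q : K) + 1) := by simp
    rw [this, Polynomial.coeff_mul_C]
    push_cast
    ring
  · rw [cf_neg _ (by omega)]
    rcases eq_or_ne q (-1) with rfl | hq
    · simp
    · rw [cf_neg _ (by omega)]; simp

/-- Partial derivative in `x`. -/
noncomputable def dX : Derivation K (A K) (A K) :=
  PolynomialModule.equivPolynomialSelf.compDer (Polynomial.derivative' (R := K)).mapCoeffs

lemma coeff_dX (f : A K) (i : ℕ) : (dX f).coeff i = Polynomial.derivative (f.coeff i) := rfl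

lemma cf_dX (f : A K) (p q : ℤ) : cf (dX f) p q = (p + 1) * cf f (p + 1) q := by
  by_cases h : 0 ≤ p ∧ 0 ≤ q
  · obtain ⟨h1, h2⟩ := h
    lift p to ℕ using h1
    lift q to ℕ using h2
    have : cf f ((p : ℤ) + 1) q = (f.coeff q).coeff (p + 1) := by
      rw [← cf_nat]; push_cast; rfl
    rw [cf_nat, coeff_dX, Polynomial.coeff_derivative, this]
    push_cast
    ring
  · rw [cf_neg _ (by omega)]
    rcases eq_or_ne p (-1) with rfl | hq
    · simp
    · rw [cf_neg _ (by omega)]; simp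

/-- The polynomial `x^u (c₁ x^t y^s + c₂)`. -/
noncomputable def Q (s t u : ℕ) (c₁ c₂ : K) : A K :=
  Polynomial.C (Polynomial.X ^ u) * (Polynomial.C (Polynomial.C c₁) *
    Polynomial.C (Polynomial.X ^ t) * Polynomial.X ^ s + Polynomial.C (Polynomial.C c₂))

/-- The derivation as a map on `K[x][y]`. -/
noncomputable def D (s t u : ℕ) (c₁ c₂ : K) (f : A K) : A K :=
  dX f + Q s t u c₁ c₂ * Polynomial.derivative f

variable {s t u : ℕ} {c₁ c₂ : K}

lemma D_mul (f g : A K) :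
    D s t u c₁ c₂ (f * g) = f * D s t u c₁ c₂ g + g * D s t u c₁ c₂ f := by
  simp only [D, Derivation.leibniz, Polynomial.derivative_mul, smul_eq_mul]
  ring

lemma cf_D (f : A K) (p q : ℤ) :
    cf (D s t u c₁ c₂ f) p q = ((p : K) + 1) * cf f (p + 1) q
      + ((q : K) + 1) * c₂ * cf f (p - u) (q + 1)
      + ((q : K) - s + 1) * c₁ * cf f (p - t - u) (q - s + 1) := by
  have : D s t u c₁ c₂ f = dX f +
    (Polynomial.C (Polynomial.C c₁) * (Polynomial.C (Polynomial.X ^ u) *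
      (Polynomial.C (Polynomial.X ^ t) * (Polynomial.X ^ s * Polynomial.derivative f)))
      + Polynomial.C (Polynomial.C c₂) * (Polynomial.C (Polynomial.X ^ u) *
        Polynomial.derivative f)) := by
    simp only [D, Q]; ring
  rw [this, cf_add, cf_add, cf_dX, cf_CC, cf_CC, cf_CXpow, cf_CXpow, cf_Xpow, cf_derivative,
    cf_CXpow, cf_derivative]
  rw [show p - u - t = p - t - u by ring]
  push_cast
  ring

lemma cf_bdd (f : A K) : ∃ B : ℤ, ∀ p q, cf f p q ≠ 0 → p ≤ B ∧ q ≤ B := by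
  refine ⟨f.natDegree + ∑ i ∈ Finset.range (f.natDegree + 1), ((f.coeff i).natDegree : ℤ), ?_⟩
  intro p q h
  obtain ⟨h1, h2⟩ := cf_pos h
  lift p to ℕ using h1
  lift q to ℕ using h2
  rw [cf_nat] at h
  have hq : q ≤ f.natDegree := by
    apply Polynomial.le_natDegree_of_ne_zero
    intro h0
    simp [h0] at h
  have hp := Polynomial.le_natDegree_of_ne_zero h
  have := Finset.single_le_sum (f := fun i => (f.coeff i).natDegree) (fun i _ => Nat.zero_le _)
    (show q ∈ Finset.range (f.natDegree + 1) from Finset.mem_range.2 (Nat.lt_succ_of_le hq))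
  norm_cast
  constructor <;> omega

lemma exists_cf_ne {f : A K} (h : f ≠ 0) : ∃ p q, cf f p q ≠ 0 := by
  by_contra! hh
  exact h (cf_ext fun p q => by rw [hh, cf_zero])

lemma lexmax (α β : ℤ) {f : A K} (hf : f ≠ 0) : ∃ p q : ℕ, cf f p q ≠ 0 ∧
    ∀ p' q' : ℤ, cf f p' q' ≠ 0 → α * p' + β * q' ≤ α * p + β * q ∧
      (α * p' + β * q' = α * p + β * q → q' ≤ q) := by
  obtain ⟨B, hB⟩ := cf_bdd f
  obtain ⟨M, ⟨p0, q0, h0, hM0⟩, hM⟩ : ∃ M : ℤ, (∃ p q, cf f p q ≠ 0 ∧ α * p + β * q = M) ∧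
      ∀ z, (∃ p q, cf f p q ≠ 0 ∧ α * p + β * q = z) → z ≤ M := by
    apply Int.exists_greatest_of_bdd
    · refine ⟨|α| * B + |β| * B, ?_⟩
      rintro z ⟨p, q, h, rfl⟩
      have h1 := cf_pos h
      have h2 := hB p q h
      have e1 : α * p ≤ |α| * B := (mul_le_mul_of_nonneg_right (le_abs_self α) h1.1).trans
        (mul_le_mul_of_nonneg_left h2.1 (abs_nonneg α))
      have e2 : β * q ≤ |β| * B := (mul_le_mul_of_nonneg_right (le_abs_self β) h1.2).trans
        (mul_le_mul_of_nonneg_left h2.2 (abs_nonneg β))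
      linarith
    · obtain ⟨p, q, h⟩ := exists_cf_ne hf
      exact ⟨_, p, q, h, rfl⟩
  obtain ⟨q, ⟨p, h, hpq⟩, hq⟩ : ∃ q : ℤ, (∃ p, cf f p q ≠ 0 ∧ α * p + β * q = M) ∧
      ∀ z, (∃ p, cf f p z ≠ 0 ∧ α * p + β * z = M) → z ≤ q := by
    apply Int.exists_greatest_of_bdd
    · refine ⟨B, ?_⟩
      rintro z ⟨p, h, _⟩
      exact (hB p z h).2
    · exact ⟨q0, p0, h0, hM0⟩
  obtain ⟨h1, h2⟩ := cf_pos h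
  lift p to ℕ using h1
  lift q to ℕ using h2
  refine ⟨p, q, h, fun p' q' h' => ⟨?_, fun e => ?_⟩⟩
  · rw [hpq]; exact hM _ ⟨p', q', h', rfl⟩
  · exact hq _ ⟨p', h', e.trans hpq⟩

lemma wt_bound {α β W : ℤ} (hα : 0 < α) (h1 : -α ≤ W) (h2 : α * u - β ≤ W)
    (h3 : α * (t + u) + β * (s - 1) ≤ W) {f g : A K} (hf : f ≠ 0)
    (hfg : D s t u c₁ c₂ f = g * f) {p q : ℤ} (hpq : cf g p q ≠ 0) : α * p + β * q ≤ W := by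
  have hg : g ≠ 0 := by
    rintro rfl
    exact hpq (cf_zero p q)
  obtain ⟨pf, qf, hf0, hfm⟩ := lexmax α β hf
  obtain ⟨pg, qg, hg0, hgm⟩ := lexmax α β hg
  have hmul : cf (g * f) ((pg + pf : ℕ) : ℤ) ((qg + qf : ℕ) : ℤ) = cf g pg qg * cf f pf qf := by
    have aux : ∀ p1 q1 p2 q2 : ℕ, cf g p1 q1 ≠ 0 → cf f p2 q2 ≠ 0 → p1 + p2 = pg + pf →
        q1 + q2 = qg + qf → p1 = pg ∧ q1 = qg := by
      intro p1 q1 p2 q2 n1 n2 ep eq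
      obtain ⟨a1, b1⟩ := hgm _ _ n1
      obtain ⟨a2, b2⟩ := hfm _ _ n2
      have ep' : (p1 : ℤ) + p2 = pg + pf := by exact_mod_cast ep
      have eq' : (q1 : ℤ) + q2 = qg + qf := by exact_mod_cast eq
      have tot : (α * p1 + β * q1) + (α * p2 + β * q2) =
        (α * pg + β * qg) + (α * pf + β * qf) := by linear_combination α * ep' + β * eq'
      have b1' := b1 (by linarith)
      have b2' := b2 (by linarith)
      have hq : (q1 : ℤ) = qg := by linarith
      have hp : α * (p1 : ℤ) = α * pg := by rw [hq] at a1 tot; nlinarith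
      have hp' := mul_left_cancel₀ hα.ne' hp
      exact ⟨by exact_mod_cast hp', by exact_mod_cast hq⟩
    rw [cf_nat, cf_nat, cf_nat, Polynomial.coeff_mul, Polynomial.finsetSum_coeff]
    rw [Finset.sum_eq_single (qg, qf)]
    · rw [Polynomial.coeff_mul, Finset.sum_eq_single (pg, pf)]
      · rintro ⟨p1, p2⟩ hm hne
        rw [Finset.HasAntidiagonal.mem_antidiagonal] at hm
        by_contra hh
        obtain ⟨n1, n2⟩ := mul_ne_zero_iff.1 hh
        have := aux p1 qg p2 qf (by rwa [cf_nat]) (by rwa [cf_nat]) hm rfl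
        apply hne
        ext <;> simp <;> omega
      · intro h; simp at h
    · rintro ⟨q1, q2⟩ hm hne
      rw [Finset.HasAntidiagonal.mem_antidiagonal] at hm
      rw [Polynomial.coeff_mul]
      apply Finset.sum_eq_zero
      rintro ⟨p1, p2⟩ hm'
      rw [Finset.HasAntidiagonal.mem_antidiagonal] at hm'
      by_contra hh
      obtain ⟨n1, n2⟩ := mul_ne_zero_iff.1 hh
      have := aux p1 q1 p2 q2 (by rwa [cf_nat]) (by rwa [cf_nat]) hm' hm
      apply hne
      ext <;> simp <;> omega
    · intro h; simp at h
  have hne : cf (D s t u c₁ c₂ f) ((pg + pf : ℕ) : ℤ) ((qg + qf : ℕ) : ℤ) ≠ 0 := by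
    rw [hfg, hmul]; exact mul_ne_zero hg0 hf0
  refine (hgm p q hpq).1.trans ?_
  by_contra hcon
  rw [cf_D] at hne
  push_cast at hne
  apply hne
  rw [show cf f ((pg : ℤ) + pf + 1) (qg + qf) = 0 from ?_,
    show cf f ((pg : ℤ) + pf - u) (qg + qf + 1) = 0 from ?_,
    show cf f ((pg : ℤ) + pf - t - u) (qg + qf - s + 1) = 0 from ?_]
  · simp
  all_goals
    by_contra hh
    have := (hfm _ _ hh).1
    nlinarith

end biv
end SimpDer

namespace SimpDer

section symm
variable {K : Type*} [Field K] {s t u : ℕ} {c₁ c₂ : K}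

/-- The substitution `x ↦ η x`, `y ↦ η^(u+1) y`. -/
noncomputable def sg (u : ℕ) (η : K) : A K →+* A K :=
  Polynomial.eval₂RingHom
    (Polynomial.C.comp (Polynomial.eval₂RingHom Polynomial.C (Polynomial.C η * Polynomial.X)))
    (Polynomial.C (Polynomial.C (η ^ (u + 1))) * Polynomial.X)

lemma sg_monomial (u : ℕ) (η : K) (q p : ℕ) (a : K) :
    sg u η (Polynomial.monomial q (Polynomial.monomial p a)) =
      Polynomial.monomial q (Polynomial.monomial p (η ^ (p + (u + 1) * q) * a)) := by
  simp only [← Polynomial.C_mul_X_pow_eq_monomial, sg, Polynomial.coe_eval₂RingHom,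
    Polynomial.eval₂_mul, Polynomial.eval₂_C, Polynomial.eval₂_X, RingHom.comp_apply,
    map_mul, map_pow, mul_pow, pow_add, pow_mul]
  ring

lemma sg_coeff (u : ℕ) (η : K) (f : A K) (p q : ℕ) :
    ((sg u η f).coeff q).coeff p = η ^ (p + (u + 1) * q) * (f.coeff q).coeff p := by
  induction f using Polynomial.induction_on' with
  | add f g hf hg => simp only [map_add, Polynomial.coeff_add, hf, hg, mul_add]
  | monomial n r =>
    induction r using Polynomial.induction_on' with
    | add f g hf hg => simp only [map_add, Polynomial.coeff_add, hf, hg, mul_add]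
    | monomial m a =>
      rw [sg_monomial, Polynomial.coeff_monomial, Polynomial.coeff_monomial]
      split_ifs with h
      · rw [Polynomial.coeff_monomial, Polynomial.coeff_monomial]
        split_ifs with h'
        · rw [h, h']
        · simp
      · simp

lemma cf_sg (u : ℕ) {η : K} (f : A K) (p q : ℤ) :
    cf (sg u η f) p q = η ^ (p + (u + 1) * q) * cf f p q := by
  by_cases h : 0 ≤ p ∧ 0 ≤ q
  · obtain ⟨h1, h2⟩ := h
    lift p to ℕ using h1
    lift q to ℕ using h2
    rw [cf_nat, cf_nat, sg_coeff]
    norm_cast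
  · rw [cf_neg _ (by omega), cf_neg _ (by omega), mul_zero]

lemma D_sg {η : K} (h0 : η ≠ 0) (hη : η ^ (t + s * (u + 1)) = 1) (f : A K) :
    D s t u c₁ c₂ (sg u η f) = Polynomial.C (Polynomial.C η) * sg u η (D s t u c₁ c₂ f) := by
  apply cf_ext
  intro p q
  rw [cf_D, cf_CC, cf_sg, cf_sg, cf_sg, cf_sg, cf_D]
  have hz : η ^ ((t : ℤ) + s * (u + 1)) = 1 := by exact_mod_cast hη
  have e1 : η ^ (p + 1 + (u + 1) * q) = η * η ^ (p + (u + 1) * q) := by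
    rw [← zpow_one_add₀ h0]; congr 1; ring
  have e2 : η ^ (p - u + (u + 1) * (q + 1)) = η * η ^ (p + (u + 1) * q) := by
    rw [← zpow_one_add₀ h0]; congr 1; ring
  have e3 : η ^ (p - t - u + (u + 1) * (q - s + 1)) = η * η ^ (p + (u + 1) * q) := by
    rw [← zpow_one_add₀ h0, ← mul_one (η ^ (p - t - u + (u + 1) * (q - s + 1))), ← hz,
      ← zpow_add₀ h0]
    congr 1; ring
  rw [e1, e2, e3]
  ring

lemma D_one : D s t u c₁ c₂ (1 : A K) = 0 := by simp [D]

lemma D_prod {ι : Type*} (S : Finset ι) (f g : ι → A K)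
    (h : ∀ i ∈ S, D s t u c₁ c₂ (f i) = g i * f i) :
    D s t u c₁ c₂ (∏ i ∈ S, f i) = (∑ i ∈ S, g i) * ∏ i ∈ S, f i := by
  classical
  induction S using Finset.induction_on with
  | empty => simp [D_one]
  | insert a S ha ih =>
    rw [Finset.prod_insert ha, Finset.sum_insert ha, D_mul,
      ih fun i hi => h i (Finset.mem_insert_of_mem hi), h a (Finset.mem_insert_self a S)]
    ring

/-- No nontrivial Darboux polynomial, over a field with enough roots of unity. -/
lemma darboux_unit [CharZero K] (hs : 1 ≤ s) (ht : 1 ≤ t) (hc₁ : c₁ ≠ 0) (hc₂ : c₂ ≠ 0)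
    {ζ : K} (hζ : IsPrimitiveRoot ζ (t + s * (u + 1))) {f g : A K} (hf : f ≠ 0)
    (hfg : D s t u c₁ c₂ f = g * f) : IsUnit f := by
  set N := t + s * (u + 1) with hN
  have hN0 : N ≠ 0 := by omega
  have hζ0 : ζ ≠ 0 := hζ.ne_zero hN0
  set F : A K := ∏ i ∈ Finset.range N, sg u (ζ ^ i) f with hF
  set G : A K := ∑ i ∈ Finset.range N, Polynomial.C (Polynomial.C (ζ ^ i)) * sg u (ζ ^ i) g with hG
  have hFG : D s t u c₁ c₂ F = G * F := by
    apply D_prod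
    intro i _
    rw [D_sg (pow_ne_zero i hζ0), hfg, map_mul, mul_assoc]
    rw [← hN, ← pow_mul, mul_comm, pow_mul, hζ.pow_eq_one, one_pow]
  have hF0 : F ≠ 0 := by
    rw [hF, Finset.prod_ne_zero_iff]
    intro i _ h0
    obtain ⟨p, q, hpq⟩ := exists_cf_ne hf
    have := cf_sg u (η := ζ ^ i) f p q
    rw [h0, cf_zero] at this
    exact mul_ne_zero (zpow_ne_zero _ (pow_ne_zero i hζ0)) hpq this.symm
  have hGc : ∀ p q, cf G p q ≠ 0 → (N : ℤ) ∣ 1 + p + (u + 1) * q := by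
    intro p q h
    rw [hG, cf_sum] at h
    simp only [cf_CC, cf_sg] at h
    by_contra hnd
    apply h
    have hx : ζ ^ (1 + p + (u + 1) * q) ≠ 1 := by
      rwa [Ne, hζ.zpow_eq_one_iff_dvd]
    have hxN : (ζ ^ (1 + p + (u + 1) * q)) ^ N = 1 := by
      rw [← zpow_natCast, ← zpow_mul, mul_comm, zpow_mul, zpow_natCast, hζ.pow_eq_one, one_zpow]
    have hsum : ∑ i ∈ Finset.range N, (ζ ^ (1 + p + (u + 1) * q)) ^ i = 0 := by
      have := geom_sum_mul (ζ ^ (1 + p + (u + 1) * q)) N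
      rw [hxN, sub_self] at this
      exact (mul_eq_zero.1 this).resolve_right (sub_ne_zero.2 hx)
    calc _ = (∑ i ∈ Finset.range N, (ζ ^ (1 + p + (u + 1) * q)) ^ i) * cf g p q := by
          rw [Finset.sum_mul]
          apply Finset.sum_congr rfl
          intro i _
          rw [← mul_assoc, ← zpow_one_add₀ (pow_ne_zero i hζ0), ← zpow_natCast, ← zpow_mul,
            ← zpow_natCast, ← zpow_mul]
          congr 2
          ring
      _ = 0 := by rw [hsum, zero_mul]
  have hsZ : (1 : ℤ) ≤ s := by exact_mod_cast hs
  have htZ : (1 : ℤ) ≤ t := by exact_mod_cast ht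
  have huZ : (0 : ℤ) ≤ u := by positivity
  have hGs : ∀ p q, cf G p q ≠ 0 → p = t + u ∧ q = s - 1 := by
    intro p q h
    obtain ⟨hp, hq⟩ := cf_pos h
    obtain ⟨m, hm⟩ := hGc p q h
    have w1 : (s : ℤ) * p + (-t : ℤ) * q ≤ s * u + t :=
      wt_bound (by linarith) (by nlinarith) (by linarith) (by nlinarith) hF0 hFG h
    have w2 : (1 : ℤ) * p + (t + u + 1 : ℤ) * q ≤ (t + u + 1) * s - 1 :=
      wt_bound (by norm_num) (by nlinarith) (by nlinarith) (by nlinarith) hF0 hFG h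
    have hq1 : q + 1 ≤ s := by
      by_contra hlt
      have : (s : ℤ) ≤ q := by omega
      nlinarith
    rw [hN] at hm
    push_cast at hm
    have hNpos : (0 : ℤ) < t + s * (u + 1) := by positivity
    have hm1 : 1 ≤ m := by
      by_contra hlt
      have h1 : m ≤ 0 := by omega
      have h2 : ((t : ℤ) + s * (u + 1)) * m ≤ 0 := mul_nonpos_of_nonneg_of_nonpos hNpos.le h1
      have h3 : 0 ≤ ((u : ℤ) + 1) * q := by positivity
      linarith
    have hsm : (s : ℤ) * m ≤ q + 1 := by
      have : ((t : ℤ) + s * (u + 1)) * (s * m) ≤ ((t : ℤ) + s * (u + 1)) * (q + 1) := by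
        have : ((t : ℤ) + s * (u + 1)) * (s * m) = s * (1 + p + (u + 1) * q) := by rw [hm]; ring
        rw [this]
        linarith
      exact le_of_mul_le_mul_left this hNpos
    have hmm : m = 1 := by nlinarith
    subst hmm
    have hq2 : q = s - 1 := by linarith
    subst hq2
    exact ⟨by linarith, rfl⟩
  set l : K := cf G (t + u) (s - 1) with hl
  have hGe : ∀ p q, cf G p q = if p = t + u ∧ q = s - 1 then l else 0 := by
    intro p q
    split_ifs with h
    · rw [h.1, h.2]
    · by_contra hh
      exact h (hGs p q hh)
  have hGF : G * F = Polynomial.C (Polynomial.C l) * (Polynomial.C (Polynomial.X ^ (t + u)) *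
      (Polynomial.X ^ (s - 1) * F)) := by
    have : G = Polynomial.C (Polynomial.C l) * (Polynomial.C (Polynomial.X ^ (t + u)) *
      (Polynomial.X ^ (s - 1) * 1)) := by
      apply cf_ext
      intro p q
      rw [hGe, cf_CC, cf_CXpow, cf_Xpow]
      have h1 : ∀ a b : ℤ, cf (1 : A K) a b = if a = 0 ∧ b = 0 then 1 else 0 := by
        intro a b
        by_cases hab : 0 ≤ a ∧ 0 ≤ b
        · obtain ⟨ha, hb⟩ := hab
          lift a to ℕ using ha
          lift b to ℕ using hb
          rw [cf_nat, Polynomial.coeff_one]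
          by_cases hb : b = 0 <;> by_cases ha : a = 0 <;> simp [ha, hb, Polynomial.coeff_one]
        · rw [cf_neg _ (by omega), if_neg (by omega)]
      rw [h1]
      push_cast [Nat.cast_sub hs]
      by_cases h : p = t + u ∧ q = s - 1
      · rw [if_pos h, if_pos (by omega), mul_one]
      · rw [if_neg h, if_neg (by omega), mul_zero]
    rw [this]
    ring
  obtain ⟨B, hB⟩ := cf_bdd F
  have hR : Rec s t u c₁ c₂ l (cf F) := by
    intro p q
    rw [← cf_D, hFG, hGF, cf_CC, cf_CXpow, cf_Xpow]
    push_cast [Nat.cast_sub hs]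
    congr 2 <;> ring
  have hcore := core hs ht hc₁ hc₂ hR (fun p q h => cf_pos h) hB
  have hFc : F = Polynomial.C (Polynomial.C (cf F 0 0)) := by
    ext q p
    have h1 := hcore p q
    rw [cf_nat] at h1
    have h2 : cf F 0 0 = (F.coeff 0).coeff 0 := cf_nat F 0 0
    rw [h2]
    by_cases h : (F.coeff q).coeff p = 0
    · rw [h, Polynomial.coeff_C]
      split_ifs with hq
      · rw [Polynomial.coeff_C]
        split_ifs with hp
        · rw [← h, hq, hp]
        · rfl
      · simp
    · obtain ⟨hp, hq⟩ := h1 h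
      have hp' : p = 0 := by exact_mod_cast hp
      have hq' : q = 0 := by exact_mod_cast hq
      subst hp' hq'
      simp
  have hFu : IsUnit F := by
    rw [hFc]
    apply Polynomial.isUnit_C.2
    apply Polynomial.isUnit_C.2
    apply IsUnit.mk0
    intro h0
    rw [h0] at hFc
    simp at hFc
    exact hF0 hFc
  refine isUnit_of_dvd_unit ?_ hFu
  have h0 : sg u (ζ ^ 0) f = f := by
    apply cf_ext
    intro p q
    rw [cf_sg]
    simp
  have := Finset.dvd_prod_of_mem (fun i => sg u (ζ ^ i) f)
    (Finset.mem_range.2 (Nat.pos_of_ne_zero hN0))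
  simpa only [h0] using this

end symm

section descent
variable {k : Type*} [Field k] [CharZero k] {s t u : ℕ} {c₁ c₂ : k}

lemma darboux_natDegree (hs : 1 ≤ s) (ht : 1 ≤ t) (hc₁ : c₁ ≠ 0) (hc₂ : c₂ ≠ 0)
    {f g : A k} (hf : f ≠ 0) (hfg : D s t u c₁ c₂ f = g * f) : f.natDegree = 0 := by
  let K := AlgebraicClosure k
  haveI : CharZero K := charZero_of_injective_algebraMap (algebraMap k K).injective
  let φ : k →+* K := algebraMap k K
  let ψ : A k →+* A K := Polynomial.mapRingHom (Polynomial.mapRingHom φ)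
  have hinj : Function.Injective (Polynomial.mapRingHom φ) :=
    Polynomial.map_injective φ φ.injective
  have hcf : ∀ (f : A k) (p q : ℤ), cf (ψ f) p q = φ (cf f p q) := by
    intro f p q
    simp only [cf, ψ]
    split_ifs <;> simp [Polynomial.coeff_map]
  have hD : D s t u (φ c₁) (φ c₂) (ψ f) = ψ g * ψ f := by
    rw [← map_mul, ← hfg]
    apply cf_ext
    intro p q
    rw [cf_D, hcf, hcf, hcf, hcf, cf_D]
    simp
  have hN : NeZero ((t + s * (u + 1) : ℕ) : K) := ⟨by exact_mod_cast (by omega)⟩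
  obtain ⟨ζ, hζ⟩ := HasEnoughRootsOfUnity.exists_primitiveRoot K (t + s * (u + 1))
  have hψf : ψ f ≠ 0 := by
    intro h0
    apply hf
    exact Polynomial.map_injective _ hinj (by simpa [ψ] using h0)
  have hu := darboux_unit hs ht (by simpa using hc₁) (by simpa using hc₂) hζ hψf hD
  have := Polynomial.natDegree_eq_zero_of_isUnit hu
  rwa [show ψ f = Polynomial.map (Polynomial.mapRingHom φ) f from rfl,
    Polynomial.natDegree_map_eq_of_injective hinj] at this

lemma D_C (r : Polynomial k) :
    D s t u c₁ c₂ (Polynomial.C r) = Polynomial.C (Polynomial.derivative r) := by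
  simp only [D, Polynomial.derivative_C, mul_zero, add_zero]
  ext1 q
  rw [coeff_dX, Polynomial.coeff_C, Polynomial.coeff_C]
  split_ifs <;> simp

lemma top_of_C {I : Ideal (A k)} (hI : ∀ f ∈ I, D s t u c₁ c₂ f ∈ I) :
    ∀ (n : ℕ) (r : Polynomial k), r.natDegree ≤ n → r ≠ 0 → Polynomial.C r ∈ I → I = ⊤ := by
  have base : ∀ r : Polynomial k, r.natDegree = 0 → r ≠ 0 → Polynomial.C r ∈ I → I = ⊤ := by
    intro r hd h0 hr
    apply Ideal.eq_top_of_isUnit_mem _ hr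
    apply Polynomial.isUnit_C.2
    rw [Polynomial.isUnit_iff_degree_eq_zero, Polynomial.degree_eq_natDegree h0, hd]
    rfl
  intro n
  induction n with
  | zero => intro r hd; exact base r (by omega)
  | succ n ih =>
    intro r hd h0 hr
    by_cases hz : r.natDegree = 0
    · exact base r hz h0 hr
    · refine ih (Polynomial.derivative r) ?_ ?_ ?_
      · rw [Polynomial.natDegree_derivative]; omega
      · intro h
        exact hz (Polynomial.natDegree_eq_zero_of_derivative_eq_zero h)
      · rw [← D_C (s := s) (t := t) (u := u) (c₁ := c₁) (c₂ := c₂)]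
        exact hI _ hr

lemma simple_A (hs : 1 ≤ s) (ht : 1 ≤ t) (hc₁ : c₁ ≠ 0) (hc₂ : c₂ ≠ 0)
    {I : Ideal (A k)} (hI : ∀ f ∈ I, D s t u c₁ c₂ f ∈ I) (hne : I ≠ ⊥) : I = ⊤ := by
  classical
  by_contra htop
  have hC : ∀ r : Polynomial k, Polynomial.C r ∈ I → r = 0 := by
    intro r hr
    by_contra h0
    exact htop (top_of_C hI r.natDegree r le_rfl h0 hr)
  have hex : ∃ n, ∃ h ∈ I, h ≠ 0 ∧ h.natDegree = n := by
    obtain ⟨h, hh, h0⟩ := Submodule.exists_mem_ne_zero_of_ne_bot hne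
    exact ⟨_, h, hh, h0, rfl⟩
  obtain ⟨h, hhI, hh0, hhn⟩ := Nat.find_spec hex
  have hmin : ∀ f ∈ I, f ≠ 0 → h.natDegree ≤ f.natDegree := by
    intro f hf hf0
    rw [hhn]
    exact Nat.find_min' hex ⟨f, hf, hf0, rfl⟩
  let L := FractionRing (Polynomial k)
  let ι : Polynomial k →+* L := algebraMap (Polynomial k) L
  have hι : Function.Injective ι := IsFractionRing.injective (Polynomial k) L
  have hlc : ι h.leadingCoeff ≠ 0 := by
    rw [Ne, map_eq_zero_iff ι hι]
    exact Polynomial.leadingCoeff_ne_zero.2 hh0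
  have hcancel : ∀ (r : Polynomial k) (a b : Polynomial L), ι r ≠ 0 →
      a ∣ Polynomial.C (ι r) * b → a ∣ b := by
    intro r a b hr hab
    have hu : IsUnit (Polynomial.C (ι r)) := Polynomial.isUnit_C.2 (IsUnit.mk0 _ hr)
    exact (hu.dvd_mul_left).1 hab
  have hdvd : ∀ (n : ℕ), ∀ f ∈ I, f.natDegree ≤ n → h.map ι ∣ f.map ι := by
    intro n
    induction n using Nat.strong_induction_on with
    | _ n ih =>
      intro f hf hfn
      by_cases hf0 : f = 0
      · simp [hf0]
      have hle := hmin f hf hf0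
      set f2 : A k := Polynomial.C h.leadingCoeff * f -
        Polynomial.C f.leadingCoeff * Polynomial.X ^ (f.natDegree - h.natDegree) * h with hf2
      have hf2I : f2 ∈ I := I.sub_mem (I.mul_mem_left _ hf) (I.mul_mem_left _ hhI)
      have hf2d : h.map ι ∣ f2.map ι := by
        by_cases hf20 : f2 = 0
        · simp [hf20]
        have hlt : f2.natDegree < f.natDegree := by
          have hle2 : f2.natDegree ≤ f.natDegree := by
            apply (Polynomial.natDegree_sub_le _ _).trans
            apply max_le
            · exact Polynomial.natDegree_C_mul_le _ _
            · rw [mul_assoc]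
              apply (Polynomial.natDegree_C_mul_le _ _).trans
              apply (Polynomial.natDegree_mul_le).trans
              rw [Polynomial.natDegree_X_pow]
              omega
          refine lt_of_le_of_ne hle2 fun heq => ?_
          apply hf20
          rw [← Polynomial.leadingCoeff_eq_zero, Polynomial.leadingCoeff, heq, hf2,
            Polynomial.coeff_sub, Polynomial.coeff_C_mul, mul_assoc, Polynomial.coeff_C_mul,
            Polynomial.coeff_X_pow_mul', if_pos (Nat.sub_le _ _), Nat.sub_sub_self hle]
          change h.leadingCoeff * f.leadingCoeff - f.leadingCoeff * h.leadingCoeff = 0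
          ring
        exact ih f2.natDegree (by omega) f2 hf2I le_rfl
      apply hcancel h.leadingCoeff _ _ hlc
      have : Polynomial.C (ι h.leadingCoeff) * f.map ι = f2.map ι +
          (Polynomial.C f.leadingCoeff * Polynomial.X ^ (f.natDegree - h.natDegree)).map ι
            * h.map ι := by
        rw [← Polynomial.map_C, ← Polynomial.map_mul, ← Polynomial.map_mul, ← Polynomial.map_add,
          hf2]
        congr 1
        ring
      rw [this]
      exact dvd_add hf2d (Dvd.intro_left _ rfl)
  letI : NormalizedGCDMonoid (Polynomial k) :=
    Classical.choice (inferInstance : Nonempty (NormalizedGCDMonoid (Polynomial k)))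
  have hcp := h.eq_C_content_mul_primPart
  have hc0 : h.content ≠ 0 := by rwa [Ne, Polynomial.content_eq_zero_iff]
  have hιc : ι h.content ≠ 0 := by rwa [Ne, map_eq_zero_iff ι hι]
  have hpd : h.primPart ∣ D s t u c₁ c₂ h.primPart := by
    apply (Polynomial.isPrimitive_primPart h).dvd_of_fraction_map_dvd_fraction_map (K := L)
    apply hcancel h.content _ _ hιc
    have h1 := hdvd _ _ (hI h hhI) le_rfl
    have h2 : h.primPart.map ι ∣ (D s t u c₁ c₂ h).map ι :=
      (Polynomial.map_dvd ι h.primPart_dvd).trans h1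
    have h3 : D s t u c₁ c₂ h = Polynomial.C h.content * D s t u c₁ c₂ h.primPart +
        h.primPart * D s t u c₁ c₂ (Polynomial.C h.content) := by
      rw [← D_mul, ← hcp]
    rw [h3, Polynomial.map_add, Polynomial.map_mul, Polynomial.map_mul, Polynomial.map_C] at h2
    exact (dvd_add_left (Dvd.intro _ rfl)).1 h2
  obtain ⟨g, hg⟩ := hpd
  have hdeg := darboux_natDegree hs ht hc₁ hc₂ (Polynomial.primPart_ne_zero h)
    (hg.trans (mul_comm _ _))
  rw [Polynomial.natDegree_primPart] at hdeg
  have := Polynomial.eq_C_of_natDegree_eq_zero hdeg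
  rw [this] at hhI hh0
  exact hh0 (by rw [hC _ hhI, map_zero])

end descent
end SimpDer

theorem simple_derivation_dx_xu_c1xtys_c2
    (k : Type*) [Field k] [CharZero k]
    (s t u : ℕ) (hs : 1 ≤ s) (ht : 1 ≤ t)
    (c₁ c₂ : k) (hc₁ : c₁ ≠ 0) (hc₂ : c₂ ≠ 0) :
    IsSimpleDerivation
      (MvPolynomial.mkDerivation k
        ![1, X 0 ^ u * (C c₁ * X 0 ^ t * X 1 ^ s + C c₂)]) := by
  intro I hI
  by_cases hbot : I = ⊥
  · exact Or.inl hbot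
  right
  let e := Polynomial.Bivariate.equivMvPolynomial k
  set d : Derivation k (MvPolynomial (Fin 2) k) (MvPolynomial (Fin 2) k) :=
      MvPolynomial.mkDerivation k
        ![1, X 0 ^ u * (C c₁ * X 0 ^ t * X 1 ^ s + C c₂)] with hd
  have hdd : ∀ f, d f = pderiv 0 f + (X 0 ^ u * (C c₁ * X 0 ^ t * X 1 ^ s + C c₂)) * pderiv 1 f := by
    have : d = pderiv 0 + (X 0 ^ u * (C c₁ * X 0 ^ t * X 1 ^ s + C c₂) :
        MvPolynomial (Fin 2) k) • pderiv 1 := by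
      apply MvPolynomial.derivation_ext
      intro i
      fin_cases i <;> simp [hd, mkDerivation_X, pderiv_X]
    intro f
    rw [this]
    rfl
  have hde : ∀ f, e (SimpDer.D s t u c₁ c₂ f) = d (e f) := by
    intro f
    rw [hdd, Polynomial.Bivariate.pderiv_zero_equivMvPolynomial,
      Polynomial.Bivariate.pderiv_one_equivMvPolynomial]
    simp only [SimpDer.D, map_add, map_mul]
    congr 2
    simp [SimpDer.Q, e]
  let J : Ideal (SimpDer.A k) := I.comap (e : SimpDer.A k →+* MvPolynomial (Fin 2) k)
  have hmem : ∀ f, f ∈ J ↔ e f ∈ I := fun f => Iff.rfl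
  have hJ : ∀ f ∈ J, SimpDer.D s t u c₁ c₂ f ∈ J := by
    intro f hf
    rw [hmem, hde]
    exact hI _ hf
  have hJne : J ≠ ⊥ := by
    obtain ⟨f, hf, hf0⟩ := Submodule.exists_mem_ne_zero_of_ne_bot hbot
    intro h
    have : e.symm f ∈ J := by rw [hmem, e.apply_symm_apply]; exact hf
    rw [h, Ideal.mem_bot] at this
    exact hf0 (by simpa using this)
  have hJt := SimpDer.simple_A hs ht hc₁ hc₂ hJ hJne
  rw [Ideal.eq_top_iff_one] at hJt ⊢
  rwa [hmem, map_one] at hJt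
end

section
/- Let $k$ be a field of characteristic zero, let $s \geq 2$, $t \geq 1$ and $u \geq 0$ be integers, and let $c_1, c_2 \in k \setminus \{0\}$. Then the $k$-derivation $d = \partial_x + x^u(c_1 x^t + c_2 y^s)\partial_y$ of $k[x,y]$ (i.e., the derivation with $d(x) = 1$ and $d(y) = x^u(c_1 x^t + c_2 y^s)$) is simple. -/
open MvPolynomial

namespace Polynomial

lemma sd_X_der {K : Type*} [Field K] (b : ℕ) (q : K[X]) :
    X * derivative (X ^ b * q) = X ^ b * (C (b : K) * q + X * derivative q) := by
  rcases b with _ | b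
  · simp
  · rw [derivative_mul, derivative_X_pow]
    simp only [Nat.add_sub_cancel]
    ring

lemma sd_split {K : Type*} [Field K] (T : K[X]) (hT : T ≠ 0) :
    ∃ b q, T = X ^ b * q ∧ q.eval 0 ≠ 0 := by
  obtain ⟨q, hq, hq'⟩ := exists_eq_pow_rootMultiplicity_mul_and_not_dvd T hT 0
  refine ⟨_, q, by simpa using hq, ?_⟩
  rw [dvd_iff_isRoot] at hq'
  exact hq'

lemma sd_order {K : Type*} [Field K] [CharZero K] (g κ T ρ : K[X]) (a j : ℕ)
    (hg : g.eval 0 ≠ 0) (hκ : κ.eval 0 = j * g.eval 0) (haj : a ≤ j)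
    (h : X * g * derivative T = κ * T + X ^ a * ρ) : X ^ a ∣ T := by
  by_cases hT : T = 0
  · simp [hT]
  obtain ⟨b, q, rfl, hq⟩ := sd_split T hT
  by_cases hab : a ≤ b
  · exact (pow_dvd_pow X hab).mul_right q
  push Not at hab
  obtain ⟨r, rfl⟩ := Nat.exists_eq_add_of_lt hab
  have h2 : X ^ b * (g * (C (b : K) * q + X * derivative q)) =
      X ^ b * (κ * q + X ^ (r + 1) * ρ) := by
    have := sd_X_der b q
    linear_combination h - g * this
  have h3 := mul_left_cancel₀ (pow_ne_zero b X_ne_zero) h2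
  have h4 := congrArg (eval 0) h3
  simp [hκ] at h4
  have h5 : ((b : K) - j) * (eval 0 g * eval 0 q) = 0 := by linear_combination h4
  rcases mul_eq_zero.1 h5 with h6 | h6
  · have : (b : K) = j := by linear_combination h6
    have := Nat.cast_injective this
    omega
  · exact absurd h6 (mul_ne_zero hg hq)

lemma sd_A0 {K : Type*} [Field K] [CharZero K] (g l P Q μ : K[X])
    (hg : g.eval 0 ≠ 0) (hP : P ≠ 0) (h1 : X * g * derivative P = l * P)
    (h2 : X * g * derivative Q = l * Q + μ * P) : μ.eval 0 = 0 := by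
  obtain ⟨a, p, rfl, hp⟩ := sd_split P hP
  have e1 : g * (C (a : K) * p + X * derivative p) = l * p := by
    apply mul_left_cancel₀ (pow_ne_zero a (X_ne_zero (R := K)))
    linear_combination h1 - g * sd_X_der a p
  have e2 := congrArg (eval 0) e1
  simp at e2
  have e3 : l.eval 0 = a * g.eval 0 := by
    apply mul_right_cancel₀ hp
    linear_combination -e2
  obtain ⟨q, rfl⟩ := sd_order g l Q (μ * p) a a hg e3 le_rfl (by rw [h2]; ring)
  have e4 : g * (C (a : K) * q + X * derivative q) = l * q + μ * p := by
    apply mul_left_cancel₀ (pow_ne_zero a (X_ne_zero (R := K)))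
    linear_combination h2 - g * sd_X_der a q
  have e5 := congrArg (eval 0) e4
  simp [e3] at e5
  have e6 : eval 0 μ * eval 0 p = 0 := by linear_combination -e5
  exact (mul_eq_zero.1 e6).resolve_right hp

lemma sd_B0 {K : Type*} [Field K] [CharZero K] (g l P Q : K[X]) (m s t c : K)
    (hg : g.eval 0 ≠ 0) (hs : s ≠ 0) (hP : P ≠ 0) (h1 : X * g * derivative P = l * P)
    (h2 : C s * (l * Q - X * g * derivative Q) = C m * P - C t * (X + C c) * derivative P) :
    m * g.eval 0 ^ 2 = t * l.eval 0 * g.eval 0 + t * c * ((derivative l).eval 0 * g.eval 0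
      - l.eval 0 * (2 * (derivative g).eval 0)) := by
  obtain ⟨a, p, rfl, hp⟩ := sd_split P hP
  have e1 : g * (C (a : K) * p + X * derivative p) = l * p := by
    apply mul_left_cancel₀ (pow_ne_zero a (X_ne_zero (R := K)))
    linear_combination h1 - g * sd_X_der a p
  have e2 := congrArg (eval 0) e1
  simp at e2
  have e3 : l.eval 0 = a * g.eval 0 := by
    apply mul_right_cancel₀ hp
    linear_combination -e2
  have e1' := congrArg (fun p => eval 0 (derivative p)) e1
  simp [e3] at e1'
  have hsC : (C s⁻¹ : K[X]) * C s = 1 := by rw [← C_mul, inv_mul_cancel₀ hs, C_1]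
  have h3 : X * g * derivative (X * Q) = (g + l) * (X * Q) +
      X ^ a * (- C s⁻¹ * (C m * X * p - C t * (X + C c) * (C (a : K) * p + X * derivative p))) := by
    rw [derivative_mul, derivative_X]
    linear_combination (- C s⁻¹ * X) * h2 + C s⁻¹ * C t * (X + C c) * sd_X_der a p +
      (X * (l * Q - X * g * derivative Q)) * hsC
  obtain ⟨q, hq⟩ := sd_order g (g + l) (X * Q) _ a (a + 1) hg
    (by simp [e3]; ring) (by omega) h3
  rw [hq] at h3
  have e4 : g * (C (a : K) * q + X * derivative q) = (g + l) * q +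
      (- C s⁻¹ * (C m * X * p - C t * (X + C c) * (C (a : K) * p + X * derivative p))) := by
    apply mul_left_cancel₀ (pow_ne_zero a (X_ne_zero (R := K)))
    linear_combination h3 - g * sd_X_der a q
  have e5 : C s * g * (C (a : K) * q + X * derivative q) = C s * (g + l) * q -
      (C m * X * p - C t * (X + C c) * (C (a : K) * p + X * derivative p)) := by
    linear_combination C s * e4 - 
      (C m * X * p - C t * (X + C c) * (C (a : K) * p + X * derivative p)) * hsC
  have e6 := congrArg (eval 0) e5
  have e7 := congrArg (fun p => eval 0 (derivative p)) e5
  simp [e3] at e6 e7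
  apply mul_right_cancel₀ hp
  rw [e3]
  generalize eval 0 p = p0 at *
  generalize eval 0 g = g0 at *
  generalize eval 0 q = q0 at *
  generalize eval 0 (derivative p) = p1 at *
  generalize eval 0 (derivative g) = g1 at *
  generalize eval 0 (derivative q) = q1 at *
  generalize eval 0 (derivative l) = l1 at *
  linear_combination g0 ^ 2 * e7 + g0 * (a * g1 - g1 - l1) * e6 + t * c * (a + 1) * g0 * e1'

lemma sd_A {K : Type*} [Field K] [CharZero K] (h l P Q μ : K[X]) (c : K)
    (hc : h.eval c = 0) (hg : (derivative h).eval c ≠ 0) (hP : P ≠ 0)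
    (h1 : h * derivative P = l * P)
    (h2 : h * derivative Q = l * Q + μ * P) : μ.eval c = 0 := by
  obtain ⟨g, hgg⟩ : X ∣ h.comp (X + C c) := by
    rw [X_dvd_iff, coeff_zero_eq_eval_zero]; simp [hc]
  have k1 := congrArg (fun p => eval 0 (derivative p)) hgg
  simp [derivative_comp] at k1
  have := sd_A0 g (l.comp (X + C c)) (P.comp (X + C c)) (Q.comp (X + C c)) (μ.comp (X + C c))
    (by rwa [← k1]) (by rw [Ne, comp_X_add_C_eq_zero_iff]; exact hP)
    (by
      have := congrArg (fun p => p.comp (X + C c)) h1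
      simp only [mul_comp, hgg] at this
      rw [derivative_comp]; simpa using this)
    (by
      have := congrArg (fun p => p.comp (X + C c)) h2
      simp only [mul_comp, hgg, add_comp] at this
      rw [derivative_comp]; simpa using this)
  simpa using this

lemma sd_B {K : Type*} [Field K] [CharZero K] (h l P Q : K[X]) (m s t c : K)
    (hc : h.eval c = 0) (hg : (derivative h).eval c ≠ 0) (hs : s ≠ 0) (hP : P ≠ 0)
    (h1 : h * derivative P = l * P)
    (h2 : C s * (l * Q - h * derivative Q) = C m * P - C t * X * derivative P) :
    m * (derivative h).eval c ^ 2 = t * l.eval c * (derivative h).eval c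
      + t * c * ((derivative l).eval c * (derivative h).eval c
      - l.eval c * (derivative (derivative h)).eval c) := by
  obtain ⟨g, hgg⟩ : X ∣ h.comp (X + C c) := by
    rw [X_dvd_iff, coeff_zero_eq_eval_zero]; simp [hc]
  have k1 := congrArg (fun p => eval 0 (derivative p)) hgg
  have k2 := congrArg (fun p => eval 0 (derivative (derivative p))) hgg
  simp [derivative_comp] at k1 k2
  have := sd_B0 g (l.comp (X + C c)) (P.comp (X + C c)) (Q.comp (X + C c)) m s t c
    (by rwa [← k1]) hs (by rw [Ne, comp_X_add_C_eq_zero_iff]; exact hP)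
    (by
      have := congrArg (fun p => p.comp (X + C c)) h1
      simp only [mul_comp, hgg] at this
      rw [derivative_comp]; simpa using this)
    (by
      have := congrArg (fun p => p.comp (X + C c)) h2
      simp only [mul_comp, hgg, sub_comp] at this
      rw [derivative_comp, derivative_comp]; simpa using this)
  simp [derivative_comp] at this
  rw [k1, k2, this]
  ring

end Polynomial
namespace Polynomial

lemma sd_vanish {K : Type*} [Field K] [CharZero K] [IsAlgClosed K] (s : ℕ) (hs : 2 ≤ s)
    (c₁ c₂ : K) (hc₁ : c₁ ≠ 0) (hc₂ : c₂ ≠ 0) (μ : K[X]) (hμ : μ.natDegree < s)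
    (h : ∀ c : K, (C c₁ + C c₂ * X ^ s).eval c = 0 → c ≠ 0 → μ.eval c = 0) : μ = 0 := by
  have hs0 : (s : K) ≠ 0 := by exact_mod_cast (by omega : s ≠ 0)
  set H : K[X] := C c₁ + C c₂ * X ^ s with hH
  have hdeg : H.natDegree = s := by
    rw [hH, add_comm]; exact natDegree_add_C.trans (natDegree_C_mul_X_pow s c₂ hc₂)
  have hsep : H.Separable := by
    refine ⟨C (1 / c₁), - C (1 / (s * c₁)) * X, ?_⟩
    have e1 : X * derivative H = C (s : K) * (C c₂ * X ^ s) := by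
      obtain ⟨r, rfl⟩ := Nat.exists_eq_add_of_le hs
      simp only [hH, derivative_add, derivative_C, derivative_C_mul, derivative_X_pow]
      rw [show 2 + r - 1 = r + 1 by omega]
      ring
    have e2 : (C (1 / (s * c₁)) : K[X]) * C (s : K) = C (1 / c₁) := by
      rw [← C_mul]; congr 1; field_simp
    have e3 : (C (1 / c₁) : K[X]) * C c₁ = 1 := by
      rw [← C_mul, ← C_1]; congr 1; field_simp
    rw [hH] at e1 ⊢
    linear_combination (- C (1 / (s * c₁))) * e1 - (C c₂ * X ^ s) * e2 + e3
  have hnd := nodup_roots hsep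
  have hcard : H.roots.card = s := by
    rw [← hdeg]; exact splits_iff_card_roots.1 (IsAlgClosed.splits H)
  classical
  apply eq_zero_of_natDegree_lt_card_of_eval_eq_zero' μ H.roots.toFinset
  · intro c hc
    rw [Multiset.mem_toFinset] at hc
    have hr := (mem_roots'.1 hc).2
    refine h c hr ?_
    rintro rfl
    have : s ≠ 0 := by omega
    simp [hH, IsRoot, this] at hr
    exact hc₁ hr
  · rw [Multiset.toFinset_card_of_nodup hnd, hcard]; exact hμ

lemma sd_der_H {K : Type*} [Field K] [CharZero K] (s : ℕ) (_hs : 2 ≤ s)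
    (c₁ c₂ : K) : derivative (C c₁ + C c₂ * X ^ s) = C (s * c₂) * X ^ (s - 1) := by
  simp only [derivative_add, derivative_C, derivative_C_mul, derivative_X_pow, C_mul]
  ring

lemma sd_A_alg {K : Type*} [Field K] [CharZero K] [IsAlgClosed K] (s : ℕ) (hs : 2 ≤ s)
    (c₁ c₂ : K) (hc₁ : c₁ ≠ 0) (hc₂ : c₂ ≠ 0) (l P Q μ : K[X]) (hμ : μ.natDegree < s)
    (hP : P ≠ 0) (h1 : (C c₁ + C c₂ * X ^ s) * derivative P = l * P)
    (h2 : (C c₁ + C c₂ * X ^ s) * derivative Q = l * Q + μ * P) : μ = 0 := by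
  have hs0 : (s : K) ≠ 0 := by exact_mod_cast (by omega : s ≠ 0)
  refine sd_vanish s hs c₁ c₂ hc₁ hc₂ μ hμ fun c hc hc0 => ?_
  refine sd_A _ l P Q μ c hc ?_ hP h1 h2
  rw [sd_der_H s hs]
  simp [hs0, hc₂, hc0]

lemma sd_B_alg {K : Type*} [Field K] [CharZero K] [IsAlgClosed K] (s : ℕ) (hs : 2 ≤ s)
    (c₁ c₂ : K) (hc₁ : c₁ ≠ 0) (hc₂ : c₂ ≠ 0) (l P Q : K[X]) (m t : ℕ) (hl : l.natDegree < s)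
    (hP : P ≠ 0) (h1 : (C c₁ + C c₂ * X ^ s) * derivative P = l * P)
    (h2 : C (s : K) * (l * Q - (C c₁ + C c₂ * X ^ s) * derivative Q)
      = C (m : K) * P - C (t : K) * X * derivative P) : m * s = t * P.natDegree := by
  have hs0 : (s : K) ≠ 0 := by exact_mod_cast (by omega : s ≠ 0)
  have key : C (m : K) * (C (s * c₂) * X ^ (s - 1))
      - C (t : K) * (X * derivative l - C ((s : K) - 2) * l) = 0 := by
    refine sd_vanish s hs c₁ c₂ hc₁ hc₂ _ ?_ fun c hc hc0 => ?_
    · apply lt_of_le_of_lt (b := s - 1) _ (by omega)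
      have hd : (X * derivative l).natDegree ≤ s - 1 := by
        rcases Nat.eq_zero_or_pos l.natDegree with h0 | h0
        · rw [eq_C_of_natDegree_eq_zero h0]; simp
        refine natDegree_mul_le.trans ?_
        have := natDegree_derivative_le l
        rw [natDegree_X]; omega
      have hl' : l.natDegree ≤ s - 1 := by omega
      generalize X * derivative l = Z at hd ⊢
      compute_degree!
    · have hne : eval c (derivative (C c₁ + C c₂ * X ^ s)) ≠ 0 := by
        rw [sd_der_H s hs]
        simp [hs0, hc₂, hc0]
      have hB := sd_B _ l P Q m s t c hc hne hs0 hP h1 h2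
      have e : c * eval c (derivative (derivative (C c₁ + C c₂ * X ^ s)))
          = (s - 1) * eval c (derivative (C c₁ + C c₂ * X ^ s)) := by
        rw [sd_der_H s hs]
        obtain ⟨r, rfl⟩ := Nat.exists_eq_add_of_le hs
        rw [show 2 + r - 1 = r + 1 by omega]
        simp [derivative_X_pow]
        ring
      have hh : eval c (derivative (C c₁ + C c₂ * X ^ s)) = s * c₂ * c ^ (s - 1) := by
        rw [sd_der_H s hs]; simp
      rw [hh] at hB hne e
      simp only [eval_sub, eval_mul, eval_C, eval_pow, eval_X]
      apply mul_right_cancel₀ hne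
      linear_combination hB - t * eval c l * e
  have k1 := congrArg (fun p => coeff p (s - 1)) key
  obtain ⟨r, rfl⟩ := Nat.exists_eq_add_of_le hs
  rw [show 2 + r - 1 = r + 1 by omega] at k1
  simp only [coeff_sub, coeff_C_mul, coeff_X_mul, coeff_derivative, coeff_X_pow] at k1
  push_cast at k1
  simp at k1
  have k2 : (m : K) * ((2 + r) * c₂) = t * l.coeff (r + 1) := by linear_combination k1
  have k3 := congrArg (fun p => coeff (X * p) (2 + r + P.natDegree)) h1
  have h3 : ((C c₁ + C c₂ * X ^ (2 + r)) * (X * derivative P)).coeff (2 + r + P.natDegree)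
     = c₂ * (P.natDegree * P.leadingCoeff) := by
    rw [coeff_mul_add_eq_of_natDegree_le]
    · have hx : (X * derivative P).coeff P.natDegree = P.natDegree * P.leadingCoeff := by
        rcases Nat.eq_zero_or_pos P.natDegree with h0 | h0
        · simp [h0]
        · obtain ⟨n, hn⟩ := Nat.exists_eq_add_of_le h0
          rw [leadingCoeff, hn, add_comm 1 n, coeff_X_mul, coeff_derivative]; push_cast; ring
      rw [hx]
      simp [coeff_C]
    · compute_degree
    · rcases Nat.eq_zero_or_pos P.natDegree with h0 | h0
      · rw [eq_C_of_natDegree_eq_zero h0]; simp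
      refine natDegree_mul_le.trans ?_
      have := natDegree_derivative_le P
      rw [natDegree_X]; omega
  have h4 : ((X * l) * P).coeff (2 + r + P.natDegree) = l.coeff (r + 1) * P.leadingCoeff := by
    rw [coeff_mul_add_eq_of_natDegree_le _ le_rfl, show 2 + r = (r + 1) + 1 by ring, coeff_X_mul]; rfl
    refine natDegree_mul_le.trans ?_
    rw [natDegree_X]; omega
  have k4 : c₂ * (P.natDegree * P.leadingCoeff) = l.coeff (r + 1) * P.leadingCoeff := by
    rw [← h3, ← h4]
    convert k3 using 2 <;> ring
  have hlead : P.leadingCoeff ≠ 0 := leadingCoeff_ne_zero.2 hP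
  have k5 : c₂ * P.natDegree = l.coeff (r + 1) := by
    apply mul_right_cancel₀ hlead; linear_combination k4
  have : ((m * (2 + r) : ℕ) : K) = ((t * P.natDegree : ℕ) : K) := by
    push_cast
    apply mul_right_cancel₀ hc₂
    rw [← k5] at k2
    linear_combination k2
  exact_mod_cast this

lemma sd_A_fin {k : Type*} [Field k] [CharZero k] (s : ℕ) (hs : 2 ≤ s)
    (c₁ c₂ : k) (hc₁ : c₁ ≠ 0) (hc₂ : c₂ ≠ 0) (l P Q μ : k[X]) (hμ : μ.natDegree < s)
    (hP : P ≠ 0) (h1 : (C c₁ + C c₂ * X ^ s) * derivative P = l * P)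
    (h2 : (C c₁ + C c₂ * X ^ s) * derivative Q = l * Q + μ * P) : μ = 0 := by
  let φ := algebraMap k (AlgebraicClosure k)
  have hφ : Function.Injective φ := φ.injective
  have : CharZero (AlgebraicClosure k) := charZero_of_injective_algebraMap hφ
  rw [← Polynomial.map_eq_zero φ]
  refine sd_A_alg s hs (φ c₁) (φ c₂) (by simpa using hc₁) (by simpa using hc₂) (l.map φ) (P.map φ)
    (Q.map φ) _ (by simpa using hμ) (by simpa using hP) ?_ ?_
  · simpa [derivative_map] using congrArg (Polynomial.map φ) h1
  · simpa [derivative_map] using congrArg (Polynomial.map φ) h2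

lemma sd_B_fin {k : Type*} [Field k] [CharZero k] (s : ℕ) (hs : 2 ≤ s)
    (c₁ c₂ : k) (hc₁ : c₁ ≠ 0) (hc₂ : c₂ ≠ 0) (l P Q : k[X]) (m t : ℕ) (hl : l.natDegree < s)
    (hP : P ≠ 0) (h1 : (C c₁ + C c₂ * X ^ s) * derivative P = l * P)
    (h2 : C (s : k) * (l * Q - (C c₁ + C c₂ * X ^ s) * derivative Q)
      = C (m : k) * P - C (t : k) * X * derivative P) : m * s = t * P.natDegree := by
  let φ := algebraMap k (AlgebraicClosure k)
  have hφ : Function.Injective φ := φ.injective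
  have : CharZero (AlgebraicClosure k) := charZero_of_injective_algebraMap hφ
  rw [← natDegree_map φ]
  refine sd_B_alg s hs (φ c₁) (φ c₂) (by simpa using hc₁) (by simpa using hc₂) (l.map φ) (P.map φ)
    (Q.map φ) m t (by simpa using hl) (by simpa using hP) ?_ ?_
  · simpa [derivative_map] using congrArg (Polynomial.map φ) h1
  · simpa [derivative_map] using congrArg (Polynomial.map φ) h2

end Polynomial
namespace Polynomial

/-- The derivation with respect to the inner variable. -/
noncomputable def sdV {k : Type*} [Field k] (p : k[X][X]) : k[X][X] :=
  Bivariate.swap (R := k) (derivative (Bivariate.swap (R := k) p))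

lemma sdV_add {k : Type*} [Field k] (p q : k[X][X]) : sdV (p + q) = sdV p + sdV q := by
  simp only [sdV, map_add]

lemma sdV_mul {k : Type*} [Field k] (p q : k[X][X]) :
    sdV (p * q) = sdV p * q + p * sdV q := by
  simp only [sdV, map_mul, derivative_mul, map_add, Bivariate.swap_swap_apply]

lemma sdV_coeff {k : Type*} [Field k] (p : k[X][X]) (n : ℕ) :
    (sdV p).coeff n = derivative (p.coeff n) := by
  induction p using Polynomial.induction_on' with
  | add p q hp hq => simp [sdV_add, hp, hq]
  | monomial j f =>
    induction f using Polynomial.induction_on' with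
    | add p q hp hq => rw [map_add, sdV_add, coeff_add, hp, hq, coeff_add, derivative_add]
    | monomial i a =>
      unfold sdV
      rw [Bivariate.swap_monomial_monomial, derivative_monomial, ← C_eq_natCast,
        monomial_mul_C, Bivariate.swap_monomial_monomial, coeff_monomial, coeff_monomial]
      split_ifs
      · rw [derivative_monomial]
      · simp

/-- Weighted substitution. -/
noncomputable def sdPsi {k : Type*} [Field k] (s t : ℕ) : k[X][X] →ₐ[k] k[X][X] :=
  aevalAeval (X ^ s : k[X][X]) (C X * X ^ t)

lemma sdPsi_X {k : Type*} [Field k] (s t : ℕ) :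
    sdPsi s t (X : k[X][X]) = C X * X ^ t := by simp [sdPsi]

lemma sdPsi_CX {k : Type*} [Field k] (s t : ℕ) :
    sdPsi s t (C X : k[X][X]) = X ^ s := by simp [sdPsi]

lemma sdPsi_CC {k : Type*} [Field k] (s t : ℕ) (a : k) :
    sdPsi s t (C (C a) : k[X][X]) = C (C a) := by
  simp [sdPsi]

lemma sdPsi_C {k : Type*} [Field k] (s t : ℕ) (f : k[X]) :
    sdPsi s t (C f : k[X][X]) = expand k[X] s (f.map C) := by
  induction f using Polynomial.induction_on with
  | C a => simp [sdPsi_CC]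
  | add p q hp hq => simp only [map_add, hp, hq, Polynomial.map_add]
  | monomial n a h => simp [sdPsi_CC, sdPsi_CX]

lemma sdPsi_swap {k : Type*} [Field k] (s t : ℕ) (F : k[X][X]) (j : ℕ) :
    (Bivariate.swap (R := k) (sdPsi s t F)).coeff j = expand k s (F.coeff j) * X ^ (t * j) := by
  induction F using Polynomial.induction_on' with
  | add p q hp hq => simp [hp, hq, add_mul]
  | monomial n f =>
    have h1 : Bivariate.swap (R := k) (sdPsi s t (C f : k[X][X])) = C (expand k s f) := by
      induction f using Polynomial.induction_on with
      | C a => simp [sdPsi_CC, Bivariate.swap_C_C]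
      | add p q hp hq => simp only [map_add, hp, hq]
      | monomial n a h => simp [sdPsi_CC, sdPsi_CX, Bivariate.swap_X, Bivariate.swap_Y, Bivariate.swap_C_C]
    have h2 : Bivariate.swap (R := k) (sdPsi s t (X : k[X][X])) = X * C (X ^ t) := by
      simp [sdPsi_X, Bivariate.swap_X, Bivariate.swap_Y, Bivariate.swap_C_C]
    rw [← C_mul_X_pow_eq_monomial, map_mul, map_mul, map_pow, map_pow, h1, h2, mul_pow,
      ← C_pow, ← mul_assoc, mul_right_comm, ← C_mul, coeff_C_mul_X_pow, coeff_C_mul_X_pow]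
    split_ifs with h
    · rw [h, pow_mul]
    · simp

lemma sdPsi_inj {k : Type*} [Field k] (s t : ℕ) (hs : 0 < s) :
    Function.Injective (sdPsi (k := k) s t) := by
  intro F G h
  ext1 j
  have h1 := sdPsi_swap s t F j
  rw [h, sdPsi_swap s t G j] at h1
  exact (expand_injective hs (mul_right_cancel₀ (pow_ne_zero _ X_ne_zero) h1)).symm

lemma sdPsi_deg {k : Type*} [Field k] (s t : ℕ) (hs : 0 < s) (F : k[X][X]) (n B : ℕ)
    (hB : ∀ b, b ≤ F.natDegree → t * b ≤ n → b ≤ B) :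
    ((sdPsi s t F).coeff n).natDegree ≤ B := by
  rw [F.as_sum_range_C_mul_X_pow, map_sum, finsetSum_coeff]
  apply natDegree_sum_le_of_forall_le
  intro b hb
  have hb' : b ≤ F.natDegree := by simpa [Nat.lt_succ_iff] using hb
  rw [map_mul, map_pow, sdPsi_C, sdPsi_X, mul_pow, ← pow_mul, ← C_pow, ← mul_assoc,
    coeff_mul_X_pow']
  split_ifs with h
  · rw [coeff_mul_C, coeff_expand hs]
    split_ifs
    · rw [coeff_map]
      refine (natDegree_C_mul_X_pow_le _ _).trans (hB b hb' h)
    · simp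
  · simp

lemma sd_natDegree_d {k : Type*} [Field k] (d : Derivation k k[X][X] k[X][X]) (s : ℕ)
    (hs : 2 ≤ s) (h1 : d (C X) = 1) (h2 : (d X).natDegree ≤ s) (F : k[X][X]) :
    (d F).natDegree ≤ F.natDegree + (s - 1) := by
  have hC : ∀ f : k[X], d (C f) = C (derivative f) := by
    intro f
    induction f using Polynomial.induction_on with
    | C a => 
      have : (C (C a) : k[X][X]) = algebraMap k k[X][X] a := rfl
      rw [this, d.map_algebraMap]; simp
    | add p q hp hq => simp only [map_add, hp, hq]
    | monomial n a h => 
      rw [pow_succ, ← mul_assoc, C_mul, d.leibniz, h, h1, derivative_mul (f := C a * X ^ n),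
        derivative_X, smul_eq_mul, smul_eq_mul, mul_one, mul_one, C_add, C_mul, C_mul]
      ring
  conv_lhs => rw [F.as_sum_range_C_mul_X_pow, map_sum]
  apply natDegree_sum_le_of_forall_le
  intro b hb
  have hb' : b ≤ F.natDegree := by simpa [Nat.lt_succ_iff] using hb
  rw [d.leibniz, hC, d.leibniz_pow]
  simp only [smul_eq_mul, nsmul_eq_mul]
  rcases b with _ | b
  · simp
  · simp only [Nat.add_sub_cancel]
    have : (X ^ b * d X).natDegree ≤ F.natDegree + (s - 1) := by
      refine natDegree_mul_le.trans ?_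
      rw [natDegree_X_pow]; omega
    refine natDegree_add_le_of_degree_le ?_ ?_
    · refine natDegree_mul_le.trans ?_
      refine (add_le_add le_rfl (natDegree_mul_le)).trans ?_
      rw [natDegree_C, natDegree_natCast]; omega
    · refine natDegree_mul_le.trans ?_
      rw [natDegree_X_pow, natDegree_C]; omega

lemma sd_ident {k : Type*} [Field k] (d : Derivation k k[X][X] k[X][X]) (s t u : ℕ)
    (hs : 2 ≤ s) (c₁ c₂ : k) (h1 : d (C X) = 1)
    (h2 : d X = C X ^ u * (C (C c₁) * C X ^ t + C (C c₂) * X ^ s)) (F : k[X][X]) :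
    (s : k[X][X]) * X ^ s * sdPsi s t (d F) = X * derivative (sdPsi s t F)
      - (t : k[X][X]) * C X * sdV (sdPsi s t F)
      + (s : k[X][X]) * X ^ (s * (u + 1) + (s - 1) * t) * C (C c₁ + C c₂ * X ^ s)
        * sdV (sdPsi s t F) := by
  set P : k[X][X] → Prop := fun F =>
    (s : k[X][X]) * X ^ s * sdPsi s t (d F) = X * derivative (sdPsi s t F)
      - (t : k[X][X]) * C X * sdV (sdPsi s t F)
      + (s : k[X][X]) * X ^ (s * (u + 1) + (s - 1) * t) * C (C c₁ + C c₂ * X ^ s)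
        * sdV (sdPsi s t F) with hP
  have hmul : ∀ F G, P F → P G → P (F * G) := by
    intro F G hF hG
    simp only [hP] at hF hG ⊢
    rw [d.leibniz, smul_eq_mul, smul_eq_mul, map_add, map_mul, map_mul, map_mul, derivative_mul,
      sdV_mul]
    linear_combination (sdPsi s t G) * hF + (sdPsi s t F) * hG
  have hadd : ∀ F G, P F → P G → P (F + G) := by
    intro F G hF hG
    simp only [hP] at hF hG ⊢
    rw [map_add d, map_add (sdPsi s t), map_add (sdPsi s t), sdV_add, derivative_add]
    linear_combination hF + hG
  have hCC : ∀ a, P (C (C a)) := by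
    intro a
    simp only [hP]
    have : d (C (C a) : k[X][X]) = 0 := by
      have : (C (C a) : k[X][X]) = algebraMap k k[X][X] a := rfl
      rw [this, d.map_algebraMap]
    simp [this, sdPsi_CC, sdV, Bivariate.swap_X, Bivariate.swap_Y, Bivariate.swap_C_C]
  have hCX : P (C X) := by
    simp only [hP]
    obtain ⟨r, rfl⟩ := Nat.exists_eq_add_of_le hs
    have : sdV ((X : k[X][X]) ^ (2 + r)) = 0 := by
      simp [sdV, Bivariate.swap_X, Bivariate.swap_Y, Bivariate.swap_C_C, derivative_pow]
    rw [h1, sdPsi_CX, this, derivative_X_pow, show 2 + r - 1 = 1 + r by omega]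
    rw [map_natCast, map_one]
    ring
  have hX : P X := by
    simp only [hP]
    have : sdV (C X * (X : k[X][X]) ^ t) = X ^ t := by
      simp [sdV, Bivariate.swap_X, Bivariate.swap_Y, Bivariate.swap_C_C, derivative_pow]
    have h3 : X * derivative (C X * (X : k[X][X]) ^ t) = (t : k[X][X]) * C X * X ^ t := by
      rw [derivative_C_mul, derivative_X_pow]
      rcases t with _ | t
      · simp
      · simp; ring
    rw [h2, sdPsi_X, h3, this]
    simp only [map_mul, map_add, map_pow, sdPsi_CC, sdPsi_CX, sdPsi_X]
    obtain ⟨r, rfl⟩ := Nat.exists_eq_add_of_le hs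
    rw [show 2 + r - 1 = 1 + r by omega]
    ring
  have hpow : ∀ G, P G → ∀ F, P F → ∀ n, P (F * G ^ n) := by
    intro G hG F hF n
    induction n with
    | zero => simpa using hF
    | succ n ih => rw [pow_succ, ← mul_assoc]; exact hmul _ _ ih hG
  change P F
  induction F using Polynomial.induction_on' with
  | add p q hp hq => exact hadd _ _ hp hq
  | monomial n f =>
    rw [← C_mul_X_pow_eq_monomial]
    refine hpow _ hX _ ?_ n
    induction f using Polynomial.induction_on' with
    | add p q hp hq => rw [C_add]; exact hadd _ _ hp hq
    | monomial n a =>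
      rw [← C_mul_X_pow_eq_monomial, C_mul, C_pow]
      exact hpow _ hCX _ (hCC a) n

end Polynomial
namespace Polynomial

lemma sd_coeff_X_der {R : Type*} [CommRing R] (f : R[X]) (n : ℕ) :
    (X * derivative f).coeff n = n * f.coeff n := by
  rcases n with _ | n
  · simp
  · rw [coeff_X_mul, coeff_derivative]; push_cast; ring

lemma sd_darboux {k : Type*} [Field k] [CharZero k] (d : Derivation k k[X][X] k[X][X])
    (s t u : ℕ) (hs : 2 ≤ s) (ht : 1 ≤ t) (c₁ c₂ : k) (hc₁ : c₁ ≠ 0) (hc₂ : c₂ ≠ 0)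
    (h1 : d (C X) = 1)
    (h2 : d X = C X ^ u * (C (C c₁) * C X ^ t + C (C c₂) * X ^ s)) (F L₀ : k[X][X])
    (hF : F ≠ 0) (hd : d F = L₀ * F) : IsUnit F := by
  have hinj := sdPsi_inj (k := k) s t (by omega)
  have hL₀ : L₀.natDegree < s := by
    have hdx : (d X).natDegree ≤ s := by
      rw [h2, ← C_pow, ← C_pow, ← C_mul]
      refine (natDegree_C_mul_le _ _).trans ?_
      refine natDegree_add_le_of_degree_le ?_ ?_
      · rw [natDegree_C]; omega
      · exact natDegree_C_mul_X_pow_le _ _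
    have := sd_natDegree_d d s hs h1 hdx F
    rw [hd] at this
    by_cases h0 : L₀ = 0
    · rw [h0, natDegree_zero]; omega
    rw [natDegree_mul h0 hF] at this
    omega
  have hid := sd_ident d s t u hs c₁ c₂ h1 h2 F
  rw [hd, map_mul] at hid
  have hf0 : sdPsi s t F ≠ 0 := fun h => hF (hinj (by rw [h, map_zero]))
  have hLdeg : ∀ n, ((sdPsi s t L₀).coeff n).natDegree < s := fun n =>
    (sdPsi_deg s t (by omega) L₀ n L₀.natDegree (fun b hb _ => hb)).trans_lt hL₀
  have hfdeg : ∀ n, t * ((sdPsi s t F).coeff n).natDegree ≤ n := fun n => by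
    have := sdPsi_deg s t (by omega) F n (n / t)
      (fun b _ hb => (Nat.le_div_iff_mul_le (by omega)).2 (by rwa [mul_comm]))
    rw [Nat.le_div_iff_mul_le (by omega)] at this
    rwa [mul_comm]
  have hfin : (sdPsi s t F).natDegree = 0 → IsUnit F := by
    intro hm
    have e1 := eq_C_of_natDegree_eq_zero hm
    have e2 := hfdeg 0
    have e3 : ((sdPsi s t F).coeff 0).natDegree = 0 := by
      rcases Nat.mul_eq_zero.1 (Nat.le_zero.1 e2) with h | h
      · omega
      · exact h
    rw [eq_C_of_natDegree_eq_zero e3, ← sdPsi_CC s t] at e1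
    have e4 := hinj e1
    rw [e4] at hF ⊢
    rw [isUnit_C, isUnit_C, isUnit_iff_ne_zero]
    rintro h
    simp [h] at hF
  apply hfin
  clear hfin hd
  generalize sdPsi s t F = f at *
  generalize sdPsi s t L₀ = L at *
  set H : k[X] := C c₁ + C c₂ * X ^ s with hH
  obtain ⟨e, he⟩ : ∃ e, e = s * u + (s - 1) * t := ⟨_, rfl⟩
  have hN : s * (u + 1) + (s - 1) * t = e + s := by rw [he]; ring
  rw [hN] at hid
  have hs0 : (s : k[X]) ≠ 0 := by exact_mod_cast (by omega : s ≠ 0)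
  have hco : ∀ n : ℕ, (s : k[X]) * (X ^ s * (L * f)).coeff n = (n : k[X]) * f.coeff n
      - (t : k[X]) * X * derivative (f.coeff n) + (s : k[X]) * H * (X ^ (e + s) * sdV f).coeff n := by
    intro n
    have := congrArg (fun p => coeff p n) hid
    simp only [coeff_add, coeff_sub, sd_coeff_X_der] at this
    rw [← C_eq_natCast s, ← C_eq_natCast t, mul_assoc, mul_assoc (C (t : k[X])), coeff_C_mul,
      coeff_C_mul, coeff_C_mul, sdV_coeff, mul_assoc (C (s : k[X])), mul_assoc (C (s : k[X])),
      coeff_C_mul, mul_right_comm, mul_comm _ (C H), coeff_C_mul] at this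
    rw [this]; ring
  have hbig : ∀ n, f.natDegree < n → f.coeff n = 0 := fun n hn => coeff_eq_zero_of_natDegree_lt hn
  set m := f.natDegree with hm
  have hP : f.coeff m ≠ 0 := by
    rw [hm]; exact leadingCoeff_ne_zero.2 hf0
  have hLe : L.natDegree ≤ e := by
    by_contra hlt
    push Not at hlt
    have := hco (L.natDegree + m + s)
    rw [coeff_X_pow_mul, coeff_mul_add_eq_of_natDegree_le le_rfl le_rfl,
      hbig (L.natDegree + m + s) (by omega), coeff_X_pow_mul', sdV_coeff, hbig (L.natDegree + m + s - (e + s)) (by omega)] at this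
    simp only [derivative_zero, ite_self, mul_zero, sub_zero, add_zero] at this
    have hLne : L ≠ 0 := by
      intro h
      rw [h, natDegree_zero] at hlt
      omega
    exact mul_ne_zero hs0 (mul_ne_zero (leadingCoeff_ne_zero.2 hLne) hP) this
  have hl : H * derivative (f.coeff m) = L.coeff e * f.coeff m := by
    have := hco (e + m + s)
    rw [coeff_X_pow_mul, coeff_mul_add_eq_of_natDegree_le hLe le_rfl, hbig (e + m + s) (by omega),
      show e + m + s = m + (e + s) by ring, coeff_X_pow_mul, sdV_coeff] at this
    apply mul_left_cancel₀ hs0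
    rw [derivative_zero] at this
    linear_combination -this
  have hL' : L = C (L.coeff e) * X ^ e := by
    by_contra hne
    have hne' := sub_ne_zero.2 hne
    obtain ⟨L', hL'⟩ : ∃ L', L' = L - C (L.coeff e) * X ^ e := ⟨_, rfl⟩
    rw [← hL'] at hne'
    have hd1 : L'.natDegree ≤ e := hL' ▸
      (natDegree_sub_le_of_le hLe (natDegree_C_mul_X_pow_le _ e)).trans (max_self e).le
    have hd2 : L'.natDegree < e := by
      refine lt_of_le_of_ne hd1 fun h => ?_
      apply leadingCoeff_ne_zero.2 hne'
      rw [leadingCoeff, h, hL']; simp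
    have hlc : L'.coeff L'.natDegree = L.coeff L'.natDegree := by
      have : ∀ j, j < e → L'.coeff j = L.coeff j := by
        intro j hj
        rw [hL', coeff_sub, coeff_C_mul_X_pow, if_neg (by omega), sub_zero]
      exact this _ hd2
    have := hco (L'.natDegree + m + s)
    have hLf : L * f = C (L.coeff e) * (X ^ e * f) + L' * f := by rw [hL']; ring
    rw [coeff_X_pow_mul, hLf, coeff_add, coeff_mul_add_eq_of_natDegree_le le_rfl le_rfl,
      coeff_C_mul, hbig (L'.natDegree + m + s) (by omega), coeff_X_pow_mul', coeff_X_pow_mul', sdV_coeff,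
      show L'.natDegree + m + s - (e + s) = L'.natDegree + m - e by omega] at this
    have hz : L'.coeff L'.natDegree = 0 := by
      refine sd_A_fin s hs c₁ c₂ hc₁ hc₂ (L.coeff e) (f.coeff m)
        (if e ≤ L'.natDegree + m then f.coeff (L'.natDegree + m - e) else 0) _ ?_ hP hl ?_
      · rw [hlc]; exact hLdeg _
      · apply mul_left_cancel₀ hs0
        by_cases hc : e ≤ L'.natDegree + m
        · rw [if_pos hc, if_pos (by omega)] at this
          rw [if_pos hc, ← hH]
          rw [derivative_zero] at this
          linear_combination -this
        · rw [if_neg hc, if_neg (by omega)] at this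
          rw [if_neg hc, ← hH]
          rw [derivative_zero] at this ⊢
          linear_combination -this
    exact leadingCoeff_ne_zero.2 hne' hz
  have hB : m * s = t * (f.coeff m).natDegree := by
    refine sd_B_fin s hs c₁ c₂ hc₁ hc₂ (L.coeff e) (f.coeff m)
      (if e + s ≤ m then f.coeff (m - (e + s)) else 0) m t (hLdeg _) hP hl ?_
    have := hco m
    have hLf : X ^ s * (L * f) = X ^ (e + s) * (C (L.coeff e) * f) := by
      conv_lhs => rw [hL']
      ring
    rw [hLf, coeff_X_pow_mul', coeff_X_pow_mul', sdV_coeff, coeff_C_mul] at this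
    rw [C_eq_natCast, C_eq_natCast, C_eq_natCast, ← hH]
    split_ifs at this ⊢
    · linear_combination this
    · simp at this ⊢
      linear_combination this
  have h3 := hfdeg m
  rw [← hB] at h3
  nlinarith

end Polynomial
namespace Polynomial

lemma sd_pseudo {R : Type*} [CommRing R] [IsDomain R] (I : Ideal R[X]) (f : R[X])
    (hf : f ≠ 0) (hfI : f ∈ I) (hmin : ∀ h ∈ I, h ≠ 0 → f.natDegree ≤ h.natDegree) :
    ∀ n : ℕ, ∀ h ∈ I, h.natDegree ≤ n → ∃ c : R, c ≠ 0 ∧ f ∣ C c * h := by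
  intro n
  induction n using Nat.strong_induction_on with
  | _ n ih =>
    intro h hI hn
    by_cases h0 : h = 0
    · exact ⟨1, one_ne_zero, by simp [h0]⟩
    have hle := hmin h hI h0
    have hlf : f.leadingCoeff ≠ 0 := leadingCoeff_ne_zero.2 hf
    have hlh : h.leadingCoeff ≠ 0 := leadingCoeff_ne_zero.2 h0
    obtain ⟨h', hh'⟩ : ∃ h', h' = C f.leadingCoeff * h
      - C h.leadingCoeff * X ^ (h.natDegree - f.natDegree) * f := ⟨_, rfl⟩
    have hI' : h' ∈ I := by
      rw [hh']; exact I.sub_mem (I.mul_mem_left _ hI) (I.mul_mem_left _ hfI)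
    have hA : (C f.leadingCoeff * h) ≠ 0 := mul_ne_zero (C_ne_zero.2 hlf) h0
    have hB : (C h.leadingCoeff * X ^ (h.natDegree - f.natDegree) * f) ≠ 0 :=
      mul_ne_zero (mul_ne_zero (C_ne_zero.2 hlh) (pow_ne_zero _ X_ne_zero)) hf
    have hdA : (C f.leadingCoeff * h).natDegree = h.natDegree := natDegree_C_mul hlf
    have hdeg : h'.degree < (C f.leadingCoeff * h).degree := by
      rw [hh']
      apply degree_sub_lt_left _ hA
      · rw [leadingCoeff_mul, leadingCoeff_mul, leadingCoeff_mul, leadingCoeff_C, leadingCoeff_C,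
          leadingCoeff_X_pow, mul_one, mul_comm]
      · rw [degree_eq_natDegree hA, degree_eq_natDegree hB, hdA, mul_assoc, natDegree_C_mul hlh,
          natDegree_mul (pow_ne_zero _ X_ne_zero) hf, natDegree_X_pow]
        congr 1; omega
    have hex : ∃ c : R, c ≠ 0 ∧ f ∣ C c * h' := by
      by_cases hz : h' = 0
      · exact ⟨1, one_ne_zero, by simp [hz]⟩
      have := natDegree_lt_natDegree hz hdeg
      rw [hdA] at this
      exact ih h'.natDegree (by omega) h' hI' le_rfl
    obtain ⟨c, hc, q, hq⟩ := hex
    refine ⟨c * f.leadingCoeff, mul_ne_zero hc hlf,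
      q + C c * (C h.leadingCoeff * X ^ (h.natDegree - f.natDegree)), ?_⟩
    rw [C_mul]
    rw [hh'] at hq
    linear_combination hq

lemma sd_prim_dvd {R : Type*} [CommRing R] [IsDomain R] [NormalizedGCDMonoid R] (p q : R[X])
    (hp : p.IsPrimitive) (c : R) (hc : c ≠ 0) (h : p ∣ C c * q) : p ∣ q := by
  by_cases hq : q = 0
  · simp [hq]
  have h0 : C c * q ≠ 0 := mul_ne_zero (C_ne_zero.2 hc) hq
  rw [← hp.dvd_primPart_iff_dvd h0] at h
  rw [← hp.dvd_primPart_iff_dvd hq]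
  have h1 := h.trans (associated_primPart_mul h0).dvd
  exact (isUnit_primPart_C c).dvd_mul_left.1 h1

lemma sd_const {k : Type*} [Field k] [CharZero k] (d : Derivation k k[X][X] k[X][X])
    (h1 : ∀ p : k[X], d (C p) = C (derivative p)) (I : Ideal k[X][X]) (hI : ∀ f ∈ I, d f ∈ I) :
    ∀ n : ℕ, ∀ p : k[X], p ≠ 0 → p.natDegree = n → C p ∈ I → I = ⊤ := by
  intro n
  induction n with
  | zero =>
    intro p hp hn hpI
    apply Ideal.eq_top_of_isUnit_mem I hpI
    rw [isUnit_C, isUnit_iff_degree_eq_zero, degree_eq_natDegree hp, hn]; rfl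
  | succ n ih =>
    intro p hp hn hpI
    have hd : (derivative p).natDegree = n := by
      rw [natDegree_derivative, hn]; rfl
    refine ih (derivative p) ?_ hd (by rw [← h1]; exact hI _ hpI)
    intro h
    have := derivative_eq_zero.1 h
    omega

lemma sd_main {k : Type*} [Field k] [CharZero k] (d : Derivation k k[X][X] k[X][X])
    (s t u : ℕ) (hs : 2 ≤ s) (ht : 1 ≤ t) (c₁ c₂ : k) (hc₁ : c₁ ≠ 0) (hc₂ : c₂ ≠ 0)
    (h1 : d (C X) = 1)
    (h2 : d X = C X ^ u * (C (C c₁) * C X ^ t + C (C c₂) * X ^ s))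
    (I : Ideal k[X][X]) (hI : ∀ f ∈ I, d f ∈ I) : I = ⊥ ∨ I = ⊤ := by
  classical
  by_cases hbot : I = ⊥
  · exact Or.inl hbot
  right
  obtain ⟨x, hxI, hx0⟩ := Submodule.exists_mem_ne_zero_of_ne_bot hbot
  have hex : ∃ n, ∃ f ∈ I, f ≠ 0 ∧ f.natDegree = n := ⟨_, x, hxI, hx0, rfl⟩
  obtain ⟨f, hfI, hf0, hfn⟩ := Nat.find_spec hex
  have hmin : ∀ h ∈ I, h ≠ 0 → f.natDegree ≤ h.natDegree := by
    intro h hh h0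
    rw [hfn]; exact Nat.find_min' hex ⟨h, hh, h0, rfl⟩
  obtain ⟨c, hc, hdvd⟩ := sd_pseudo I f hf0 hfI hmin _ (d f) (hI f hfI) le_rfl
  have hprim := f.isPrimitive_primPart
  have hf := f.eq_C_content_mul_primPart
  have hcont : f.content ≠ 0 := by rwa [Ne, content_eq_zero_iff]
  have hdv : f.primPart ∣ d f.primPart := by
    refine sd_prim_dvd _ _ hprim (c * f.content) (mul_ne_zero hc hcont) ?_
    have e1 : d f = C f.content * d f.primPart + f.primPart * d (C f.content) := by
      conv_lhs => rw [hf]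
      rw [d.leibniz, smul_eq_mul, smul_eq_mul]
    have e2 : f.primPart ∣ C c * d f := (Dvd.intro_left _ hf.symm).trans hdvd
    rw [e1, mul_add] at e2
    have e3 := (dvd_add_left (Dvd.intro_left (C c * d (C f.content)) (by ring))).1 e2
    rwa [C_mul, mul_assoc]
  obtain ⟨L, hL⟩ := hdv
  have hu := sd_darboux d s t u hs ht c₁ c₂ hc₁ hc₂ h1 h2 f.primPart L hprim.ne_zero
    (by rw [hL, mul_comm])
  have hCI : C f.content ∈ I := by
    rw [hf] at hfI
    exact (Ideal.mul_unit_mem_iff_mem I hu).1 hfI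
  refine sd_const d ?_ I hI _ f.content hcont rfl hCI
  intro p
  induction p using Polynomial.induction_on with
  | C a =>
    have : (C (C a) : k[X][X]) = algebraMap k k[X][X] a := rfl
    rw [this, d.map_algebraMap]; simp
  | add p q hp hq => simp only [map_add, hp, hq]
  | monomial n a h =>
    rw [pow_succ, ← mul_assoc, C_mul, d.leibniz, h, h1, derivative_mul (f := C a * X ^ n),
      derivative_X, smul_eq_mul, smul_eq_mul, mul_one, mul_one, C_add, C_mul, C_mul]
    ring

end Polynomial

/-- Transport of a derivation along the equivalence with iterated polynomials. -/
noncomputable def sdTransport {k : Type*} [Field k]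
    (D : Derivation k (MvPolynomial (Fin 2) k) (MvPolynomial (Fin 2) k)) :
    Derivation k (Polynomial (Polynomial k)) (Polynomial (Polynomial k)) :=
  Derivation.mk' ((Polynomial.Bivariate.equivMvPolynomial k).symm.toLinearMap ∘ₗ D.toLinearMap ∘ₗ
    (Polynomial.Bivariate.equivMvPolynomial k).toLinearMap) (by
      intro a b
      simp [D.leibniz])

theorem simple_derivation_dx_xu_c1xt_c2ys
    (k : Type*) [Field k] [CharZero k]
    (s t u : ℕ) (hs : 2 ≤ s) (ht : 1 ≤ t)
    (c₁ c₂ : k) (hc₁ : c₁ ≠ 0) (hc₂ : c₂ ≠ 0) :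
    IsSimpleDerivation
      (MvPolynomial.mkDerivation k
        ![1, X 0 ^ u * (C c₁ * X 0 ^ t + C c₂ * X 1 ^ s)]) := by
  intro I hI
  let e := Polynomial.Bivariate.equivMvPolynomial k
  let D : Derivation k (MvPolynomial (Fin 2) k) (MvPolynomial (Fin 2) k) := MvPolynomial.mkDerivation k
        ![1, X 0 ^ u * (C c₁ * X 0 ^ t + C c₂ * X 1 ^ s)]
  have hD : ∀ p, sdTransport D p = e.symm (D (e p)) := fun p => rfl
  have hres := Polynomial.sd_main (sdTransport D) s t u hs ht c₁ c₂ hc₁ hc₂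
    (by rw [hD]; simp [e, D, MvPolynomial.mkDerivation_X])
    (by rw [hD]; simp [e, D, MvPolynomial.mkDerivation_X])
    (I.comap e) (by
      intro f hf
      rw [Ideal.mem_comap] at hf ⊢
      rw [hD, AlgEquiv.apply_symm_apply]
      exact hI _ hf)
  rcases hres with h | h
  · left
    rw [eq_bot_iff]
    intro x hx
    have hx' : e.symm x ∈ I.comap e := by
      rw [Ideal.mem_comap, AlgEquiv.apply_symm_apply]; exact hx
    rw [h, Ideal.mem_bot] at hx'
    simpa using hx'
  · right
    rw [Ideal.eq_top_iff_one]
    have : (1 : Polynomial (Polynomial k)) ∈ I.comap e := by rw [h]; trivial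
    rw [Ideal.mem_comap, map_one] at this
    exact this
end

section
/- Let $k$ be a field of characteristic zero, let $r \geq 0$ and $s, t \geq 1$ be integers, and let $c_1, c_2 \in k \setminus \{0\}$. Then the $k$-derivation $d = y^r\partial_x + (c_1 x^t y^s + c_2)\partial_y$ of $k[x,y]$ (i.e., the derivation with $d(x) = y^r$ and $d(y) = c_1 x^t y^s + c_2$) is simple. -/
open MvPolynomial

noncomputable section SecA
variable {K : Type*} [Field K]

/-- formal derivative of a rational function -/
def rdFun (f : RatFunc K) : RatFunc K :=
  (algebraMap (Polynomial K) (RatFunc K) (f.num.derivative * f.denom - f.num * f.denom.derivative)) /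
    (algebraMap (Polynomial K) (RatFunc K) f.denom) ^ 2

lemma rdFun_div (p q : Polynomial K) (hq : q ≠ 0) :
    rdFun (algebraMap (Polynomial K) (RatFunc K) p / algebraMap (Polynomial K) (RatFunc K) q) =
      (algebraMap (Polynomial K) (RatFunc K) (p.derivative * q - p * q.derivative)) /
    (algebraMap (Polynomial K) (RatFunc K) q) ^ 2 := by
  set f := algebraMap (Polynomial K) (RatFunc K) p / algebraMap (Polynomial K) (RatFunc K) q with hf
  have h1 : f.num * q = p * f.denom := (RatFunc.num_div_dvd' p hq) |> fun _ => by
    have := RatFunc.num_div_denom f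
    have hd : algebraMap (Polynomial K) (RatFunc K) f.denom ≠ 0 :=
      RatFunc.algebraMap_ne_zero f.denom_ne_zero
    have hq' : algebraMap (Polynomial K) (RatFunc K) q ≠ 0 := RatFunc.algebraMap_ne_zero hq
    rw [hf, div_eq_div_iff (by simpa [hf] using hd) hq'] at this
    apply RatFunc.algebraMap_injective K
    simpa [hf] using this
  have h2 := congrArg Polynomial.derivative h1
  simp only [Polynomial.derivative_mul] at h2
  have hd : algebraMap (Polynomial K) (RatFunc K) f.denom ≠ 0 :=
    RatFunc.algebraMap_ne_zero f.denom_ne_zero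
  have hq' : algebraMap (Polynomial K) (RatFunc K) q ≠ 0 := RatFunc.algebraMap_ne_zero hq
  rw [rdFun, div_eq_div_iff (pow_ne_zero 2 hd) (pow_ne_zero 2 hq')]
  rw [← map_pow, ← map_pow, ← map_mul, ← map_mul]
  congr 1
  generalize f.num = n at *
  generalize f.denom = m at *
  linear_combination (q * m) * h2 - (m * q.derivative + m.derivative * q) * h1

lemma rdFun_alg (p : Polynomial K) :
    rdFun (algebraMap (Polynomial K) (RatFunc K) p) =
      algebraMap (Polynomial K) (RatFunc K) p.derivative := by
  have := rdFun_div p 1 one_ne_zero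
  simpa using this

lemma exists_frac (f : RatFunc K) : ∃ p q : Polynomial K, q ≠ 0 ∧
    f = algebraMap (Polynomial K) (RatFunc K) p / algebraMap (Polynomial K) (RatFunc K) q :=
  ⟨f.num, f.denom, f.denom_ne_zero, (RatFunc.num_div_denom f).symm⟩

lemma rdFun_add (f g : RatFunc K) : rdFun (f + g) = rdFun f + rdFun g := by
  obtain ⟨p, q, hq, rfl⟩ := exists_frac f
  obtain ⟨a, b, hb, rfl⟩ := exists_frac g
  have hq' : algebraMap (Polynomial K) (RatFunc K) q ≠ 0 := RatFunc.algebraMap_ne_zero hq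
  have hb' : algebraMap (Polynomial K) (RatFunc K) b ≠ 0 := RatFunc.algebraMap_ne_zero hb
  rw [div_add_div _ _ hq' hb', ← map_mul, ← map_mul, ← map_mul, ← map_add,
    rdFun_div _ _ (mul_ne_zero hq hb), rdFun_div _ _ hq, rdFun_div _ _ hb]
  simp only [Polynomial.derivative_mul, Polynomial.derivative_add, map_add, map_sub, map_mul]
  field_simp
  ring

lemma rdFun_mul (f g : RatFunc K) : rdFun (f * g) = f * rdFun g + g * rdFun f := by
  obtain ⟨p, q, hq, rfl⟩ := exists_frac f
  obtain ⟨a, b, hb, rfl⟩ := exists_frac g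
  have hq' : algebraMap (Polynomial K) (RatFunc K) q ≠ 0 := RatFunc.algebraMap_ne_zero hq
  have hb' : algebraMap (Polynomial K) (RatFunc K) b ≠ 0 := RatFunc.algebraMap_ne_zero hb
  rw [div_mul_div_comm, ← map_mul, ← map_mul,
    rdFun_div _ _ (mul_ne_zero hq hb), rdFun_div _ _ hq, rdFun_div _ _ hb]
  simp only [Polynomial.derivative_mul, Polynomial.derivative_add, map_add, map_sub, map_mul]
  field_simp
  ring

lemma algC (c : K) : algebraMap K (RatFunc K) c =
    algebraMap (Polynomial K) (RatFunc K) (Polynomial.C c) := by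
  rw [IsScalarTower.algebraMap_apply K (Polynomial K) (RatFunc K)]; rfl

/-- derivative on rational functions as a derivation -/
def rd : Derivation K (RatFunc K) (RatFunc K) :=
  Derivation.mk' 
    { toFun := rdFun
      map_add' := rdFun_add
      map_smul' := fun c f => by
        rw [Algebra.smul_def, rdFun_mul, algC, rdFun_alg]
        simp [Algebra.smul_def, algC] }
    (fun f g => by simpa using rdFun_mul f g)

lemma rd_alg (p : Polynomial K) :
    rd (algebraMap (Polynomial K) (RatFunc K) p) =
      algebraMap (Polynomial K) (RatFunc K) p.derivative := rdFun_alg p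

/-- a rational function whose derivative has denominator `Θ²`, `Θ` squarefree -/
lemma rat_lemma [CharZero K] (Θ S : Polynomial K) (hΘ : Squarefree Θ) (w : RatFunc K)
    (h : (algebraMap (Polynomial K) (RatFunc K) Θ) ^ 2 * rd w =
      algebraMap (Polynomial K) (RatFunc K) S) :
    ∃ V : Polynomial K, algebraMap (Polynomial K) (RatFunc K) Θ * w =
      algebraMap (Polynomial K) (RatFunc K) V ∧
      V.derivative * Θ - V * Θ.derivative = S := by
  have hq := w.denom_ne_zero
  have hcop := RatFunc.isCoprime_num_denom w
  have hw := RatFunc.num_div_denom w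
  generalize w.num = p at *
  generalize w.denom = q at *
  have hq' : algebraMap (Polynomial K) (RatFunc K) q ≠ 0 := RatFunc.algebraMap_ne_zero hq
  have h1 : Θ ^ 2 * (p.derivative * q - p * q.derivative) = S * q ^ 2 := by
    apply RatFunc.algebraMap_injective K
    rw [← hw] at h
    change _ * rdFun _ = _ at h
    rw [rdFun_div _ _ hq] at h
    field_simp at h
    rw [mul_comm S]
    simpa using h
  -- q is squarefree
  have hdvd : q ∣ Θ ^ 2 * q.derivative := by
    have : q ∣ (Θ ^ 2 * q.derivative) * p :=
      ⟨Θ ^ 2 * p.derivative - S * q, by linear_combination -h1⟩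
    exact hcop.symm.dvd_of_dvd_mul_right this
  have key : ∀ (π : Polynomial K) (e : ℕ) (u : Polynomial K), Irreducible π → ¬ π ∣ u →
      q = π ^ (e + 1) * u → e = 0 := by
    intro π e u hπ hu hqe
    have hpp := hπ.prime
    have hpπ : ¬ π ∣ p := fun hd => hπ.not_isUnit
      (hcop.isUnit_of_dvd' hd (hqe ▸ (dvd_pow_self π (Nat.succ_ne_zero e)).mul_right u))
    have hder : ¬ π ∣ π.derivative := by
      intro hd
      have hlt := Polynomial.degree_derivative_lt hπ.ne_zero
      have := Polynomial.eq_zero_of_dvd_of_degree_lt hd hlt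
      have := Polynomial.derivative_eq_zero.1 this
      exact absurd this hπ.natDegree_pos.ne'
    have h2 : Θ ^ 2 * (p.derivative * π * u - p * (((e:Polynomial K) + 1) * π.derivative * u + π * u.derivative))
        = S * π ^ (e + 2) * u ^ 2 := by
      have hne : π ^ e ≠ 0 := pow_ne_zero _ hπ.ne_zero
      apply mul_left_cancel₀ hne
      rw [hqe] at h1
      simp only [Polynomial.derivative_mul, Polynomial.derivative_pow] at h1
      simp only [Nat.add_sub_cancel, Nat.cast_add, Nat.cast_one, map_add, map_natCast, map_one] at h1
      linear_combination h1
    have h3 : ¬ π ∣ (p.derivative * π * u - p * (((e:Polynomial K) + 1) * π.derivative * u + π * u.derivative)) := by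
      intro hd
      have : π ∣ p * (((e:Polynomial K) + 1) * π.derivative * u) := by
        have h4 : π ∣ π * (p.derivative * u - p * u.derivative) := dvd_mul_right _ _
        have := dvd_sub h4 hd
        convert this using 1; ring
      have hunit : IsUnit ((e:Polynomial K) + 1) := by
        have : ((e:Polynomial K) + 1) = Polynomial.C ((e:K)+1) := by simp
        rw [this, Polynomial.isUnit_C]
        exact (Nat.cast_add_one_ne_zero e).isUnit
      rcases hpp.dvd_or_dvd this with h | h
      · exact hpπ h
      rcases hpp.dvd_or_dvd h with h | h
      · rcases hpp.dvd_or_dvd h with h | h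
        · exact hπ.not_isUnit (isUnit_of_dvd_unit h hunit)
        · exact hder h
      · exact hu h
    have h5 : π ^ (e + 2) ∣ Θ ^ 2 := by
      refine hpp.pow_dvd_of_dvd_mul_right _ h3 ?_
      rw [h2]; exact ⟨S * u ^ 2, by ring⟩
    have h6 : π ∣ Θ := hpp.dvd_of_dvd_pow ((dvd_pow_self π (by omega)).trans h5)
    obtain ⟨Θ1, rfl⟩ := h6
    have h7 : ¬ π ∣ Θ1 := by
      intro hd
      exact hπ.not_isUnit (hΘ π (mul_dvd_mul_left π hd))
    by_contra he
    have h8 : π ^ 3 ∣ (π * Θ1) ^ 2 := (pow_dvd_pow π (by omega)).trans h5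
    have h9 : π ∣ Θ1 ^ 2 := by
      obtain ⟨z, hz⟩ := h8
      refine ⟨z, mul_left_cancel₀ (pow_ne_zero 2 hπ.ne_zero) ?_⟩
      linear_combination hz
    exact h7 (hpp.dvd_of_dvd_pow h9)
  have hsq : Squarefree q := by
    rw [squarefree_iff_no_irreducibles hq]
    intro π hπ hd
    have hfin : FiniteMultiplicity π q := FiniteMultiplicity.of_prime_left hπ.prime hq
    obtain ⟨u, hu, hnu⟩ := hfin.exists_eq_pow_mul_and_not_dvd
    have h2 : 2 ≤ multiplicity π q := hfin.le_multiplicity_of_pow_dvd (by rwa [pow_two])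
    have := key π (multiplicity π q - 1) u hπ hnu (by
      rw [Nat.sub_add_cancel (by omega)]; exact hu)
    omega
  have hsep : q.Separable := PerfectField.separable_iff_squarefree.2 hsq
  have hqΘ : q ∣ Θ := (hsq.dvd_pow_iff_dvd two_ne_zero).1 (hsep.dvd_of_dvd_mul_right hdvd)
  obtain ⟨g, rfl⟩ := hqΘ
  have e1 : algebraMap (Polynomial K) (RatFunc K) (q * g) * w =
      algebraMap (Polynomial K) (RatFunc K) (g * p) := by
    rw [← hw]; simp only [map_mul]; field_simp
  refine ⟨g * p, e1, ?_⟩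
  generalize g * p = V at *
  generalize q * g = T at *
  have := congrArg rd e1
  rw [Derivation.leibniz, rd_alg, rd_alg] at this
  apply RatFunc.algebraMap_injective K
  rw [← h, map_sub, map_mul (algebraMap (Polynomial K) (RatFunc K)),
    map_mul (algebraMap (Polynomial K) (RatFunc K)), ← this, ← e1]
  simp only [smul_eq_mul]
  ring
end SecA



section SecB
variable {K : Type*} [Field K] [CharZero K]

lemma num_lemma (r s : ℕ) (hs : 1 ≤ s) (c₁ c₂ : K) (hc₁ : c₁ ≠ 0) (hc₂ : c₂ ≠ 0)
    (V S : Polynomial K)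
    (h : V.derivative * (Polynomial.C c₁ * Polynomial.X ^ s + Polynomial.C c₂)
      - V * (Polynomial.C c₁ * Polynomial.X ^ s + Polynomial.C c₂).derivative = S)
    (hS : ∀ q, 2 ≤ q → S.coeff (r + q * s) = 0)
    (hSm : ∀ q j, 1 ≤ q → j + q * s = r → S.coeff j = 0) :
    c₁ * ((r : K) + 1 - s) * S.coeff r = c₂ * ((r : K) + 1) * S.coeff (r + s) := by
  obtain ⟨s, rfl⟩ : ∃ s', s = s' + 1 := ⟨s - 1, by omega⟩
  -- normalise `V 0 = 0`
  obtain ⟨V, h, hV0⟩ : ∃ V : Polynomial K,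
      V.derivative * (Polynomial.C c₁ * Polynomial.X ^ (s+1) + Polynomial.C c₂)
      - V * (Polynomial.C c₁ * Polynomial.X ^ (s+1) + Polynomial.C c₂).derivative = S ∧
      V.coeff 0 = 0 := by
    refine ⟨V - Polynomial.C (V.coeff 0 / c₂) *
      (Polynomial.C c₁ * Polynomial.X ^ (s+1) + Polynomial.C c₂), ?_, ?_⟩
    · rw [← h]
      generalize (Polynomial.C c₁ * Polynomial.X ^ (s+1) + Polynomial.C c₂) = T
      simp only [Polynomial.derivative_sub, Polynomial.derivative_mul, Polynomial.derivative_C]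
      ring
    · simp only [Polynomial.coeff_sub, Polynomial.coeff_C_mul, Polynomial.coeff_add,
        Polynomial.coeff_X_pow, Polynomial.coeff_C_zero]
      field_simp
      simp
  have h' : Polynomial.C c₂ * V.derivative + Polynomial.C c₁ * (V.derivative * Polynomial.X ^ (s+1))
      - Polynomial.C (c₁ * (s+1)) * (V * Polynomial.X ^ s) = S := by
    rw [← h]
    simp only [Polynomial.derivative_add, Polynomial.derivative_mul, Polynomial.derivative_C,
      Polynomial.derivative_X_pow, map_mul, map_add, map_natCast, map_one]
    push_cast
    simp
    ring
  have rec1 : ∀ j, S.coeff (j + (s+1)) = c₂ * (V.coeff (j + s + 1 + 1) * (j + s + 1 + 1))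
      + c₁ * ((j : K) - s) * V.coeff (j+1) := by
    intro j
    rw [← h']
    simp only [Polynomial.coeff_sub, Polynomial.coeff_add, Polynomial.coeff_C_mul,
      Polynomial.coeff_mul_X_pow, Polynomial.coeff_derivative]
    rw [show j + (s+1) = (j+1) + s by ring, Polynomial.coeff_mul_X_pow,
      show j + 1 + s + 1 = j + s + 1 + 1 by ring]
    push_cast
    ring
  have rec2 : ∀ n, n < s + 1 → S.coeff n = c₂ * (V.coeff (n + 1) * (n + 1)) := by
    intro n hn
    rw [← h']
    simp only [Polynomial.coeff_sub, Polynomial.coeff_add, Polynomial.coeff_C_mul,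
      Polynomial.coeff_mul_X_pow', Polynomial.coeff_derivative]
    rw [if_neg (by omega)]
    by_cases hns : s ≤ n
    · obtain rfl : n = s := by omega
      simp [hV0]
    · simp [hns]
  have up : ∀ k q, 1 ≤ q → V.natDegree < q + k → V.coeff (r + 1 + q * (s+1)) = 0 := by
    intro k
    induction k with
    | zero =>
      intro q hq hd
      apply Polynomial.coeff_eq_zero_of_natDegree_lt
      nlinarith
    | succ k ih =>
      intro q hq hd
      have h1 := ih (q+1) (by omega) (by omega)
      have h2 := rec1 (r + q * (s+1))
      rw [show r + q * (s+1) + (s+1) = r + (q+1) * (s+1) by ring, hS _ (by omega),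
        show r + q * (s+1) + s + 1 + 1 = r + 1 + (q+1) * (s+1) by ring, h1,
        show r + q * (s+1) + 1 = r + 1 + q * (s+1) by ring] at h2
      have h3 : ((r + q * (s+1) : ℕ) : K) - s ≠ 0 := by
        rw [sub_ne_zero]
        norm_cast
        nlinarith
      simp only [zero_mul, mul_zero, zero_add] at h2
      rcases mul_eq_zero.1 h2.symm with h | h
      · exact absurd h (mul_ne_zero hc₁ h3)
      · exact h
  have U1 : V.coeff (r + 1 + (s + 1)) = 0 := by
    have := up (V.natDegree + 1) 1 le_rfl (by omega)
    simpa using this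
  have E1 := rec1 r
  rw [show r + s + 1 + 1 = r + 1 + (s+1) by ring, U1] at E1
  have low : ∀ n, ∀ q, 1 ≤ q → n + q * (s+1) = r + 1 → V.coeff n = 0 := by
    intro n
    induction n using Nat.strong_induction_on with
    | _ n ih =>
      intro q hq hn
      rcases n with _ | n
      · exact hV0
      have hz := hSm q n hq (by omega)
      have hn0 : (n : K) + 1 ≠ 0 := Nat.cast_add_one_ne_zero n
      by_cases hns : n < s + 1
      · rw [rec2 n hns] at hz
        simpa [hc₂, hn0] using hz
      · obtain ⟨j, rfl⟩ : ∃ j, n = j + (s+1) := ⟨n - (s+1), by omega⟩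
        rw [rec1 j, ih (j+1) (by omega) (q+1) (by omega) (by linarith)] at hz
        have hn0' : (j : K) + s + 1 + 1 ≠ 0 := by
          push_cast at hn0
          rwa [← add_assoc] at hn0
        simp only [mul_zero, add_zero, mul_eq_zero, hc₂, hn0', or_false, false_or] at hz
        exact hz
  have E0 : S.coeff r = c₂ * (V.coeff (r+1) * (r+1)) := by
    by_cases hr : r < s + 1
    · exact rec2 r hr
    · obtain ⟨j, rfl⟩ : ∃ j, r = j + (s+1) := ⟨r - (s+1), by omega⟩
      rw [rec1 j, low (j+1) 1 le_rfl (by ring)]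
      push_cast
      ring_nf
  rw [E0, E1]
  push_cast
  ring
end SecB

noncomputable section SecC
variable {K : Type*} [Field K]

/-- coefficientwise derivative -/
def dvFun (x : HahnSeries ℤ (RatFunc K)) : HahnSeries ℤ (RatFunc K) where
  coeff n := rd (x.coeff n)
  isPWO_support' := x.isPWO_support.mono (fun n hn hx => hn (by
    change rd (x.coeff n) = 0
    rw [hx]; exact map_zero _))

/-- Euler operator -/
def euFun (x : HahnSeries ℤ (RatFunc K)) : HahnSeries ℤ (RatFunc K) where
  coeff n := (n : RatFunc K) * x.coeff n
  isPWO_support' := x.isPWO_support.mono (fun n hn hx => hn (by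
    change (n : RatFunc K) * x.coeff n = 0
    rw [hx]; exact mul_zero _))

lemma dvFun_coeff (x : HahnSeries ℤ (RatFunc K)) (n : ℤ) : (dvFun x).coeff n = rd (x.coeff n) := rfl
lemma euFun_coeff (x : HahnSeries ℤ (RatFunc K)) (n : ℤ) :
    (euFun x).coeff n = (n : RatFunc K) * x.coeff n := rfl

lemma dvFun_supp (x : HahnSeries ℤ (RatFunc K)) : (dvFun x).support ⊆ x.support :=
  fun n hn hx => hn (by rw [dvFun_coeff, hx]; exact map_zero _)
lemma euFun_supp (x : HahnSeries ℤ (RatFunc K)) : (euFun x).support ⊆ x.support :=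
  fun n hn hx => hn (by rw [euFun_coeff, hx]; exact mul_zero _)

/-- coefficientwise derivative as an additive map -/
def dv : HahnSeries ℤ (RatFunc K) →+ HahnSeries ℤ (RatFunc K) where
  toFun := dvFun
  map_zero' := by ext n; simp [dvFun_coeff]
  map_add' := fun x y => by ext n; simp [dvFun_coeff]

/-- Euler operator as an additive map -/
def eu : HahnSeries ℤ (RatFunc K) →+ HahnSeries ℤ (RatFunc K) where
  toFun := euFun
  map_zero' := by ext n; simp [euFun_coeff]
  map_add' := fun x y => by ext n; simp [euFun_coeff, mul_add]

lemma dv_mul (x y : HahnSeries ℤ (RatFunc K)) : dv (x * y) = x * dv y + y * dv x := by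
  change dvFun (x * y) = x * dvFun y + y * dvFun x
  ext n
  simp only [HahnSeries.coeff_add, dvFun_coeff]
  rw [HahnSeries.coeff_mul, HahnSeries.coeff_mul_right' y.isPWO_support (dvFun_supp y),
    mul_comm y (dvFun x),
    HahnSeries.coeff_mul_left' x.isPWO_support (dvFun_supp x), map_sum, ← Finset.sum_add_distrib]
  refine Finset.sum_congr rfl fun ij _ => ?_
  rw [Derivation.leibniz, dvFun_coeff, dvFun_coeff, smul_eq_mul, smul_eq_mul,
    mul_comm (y.coeff _)]

lemma eu_mul (x y : HahnSeries ℤ (RatFunc K)) : eu (x * y) = x * eu y + y * eu x := by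
  change euFun (x * y) = x * euFun y + y * euFun x
  ext n
  simp only [HahnSeries.coeff_add, euFun_coeff]
  rw [HahnSeries.coeff_mul, HahnSeries.coeff_mul_right' y.isPWO_support (euFun_supp y),
    mul_comm y (euFun x),
    HahnSeries.coeff_mul_left' x.isPWO_support (euFun_supp x), Finset.mul_sum,
    ← Finset.sum_add_distrib]
  refine Finset.sum_congr rfl fun ij hij => ?_
  have : ij.1 + ij.2 = n := by simpa using (Finset.mem_antidiagonal.1 hij).2.2
  rw [euFun_coeff, euFun_coeff, ← this]
  push_cast
  ring

lemma dv_coeff (x : HahnSeries ℤ (RatFunc K)) (n : ℤ) : (dv x).coeff n = rd (x.coeff n) := rfl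
lemma eu_coeff (x : HahnSeries ℤ (RatFunc K)) (n : ℤ) :
    (eu x).coeff n = (n : RatFunc K) * x.coeff n := rfl

lemma dv_eu (x : HahnSeries ℤ (RatFunc K)) : dv (eu x) = eu (dv x) := by
  ext n
  rw [dv_coeff, eu_coeff, eu_coeff, dv_coeff, Derivation.leibniz]
  simp

lemma coeff_quot_zero (f A g : HahnSeries ℤ (RatFunc K)) (e : ℤ) (hf : f ≠ 0) (h : f * A = g)
    (hg : ∀ n < f.order + e, g.coeff n = 0) : ∀ n < e, A.coeff n = 0 := by
  intro n hn
  by_cases hA : A = 0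
  · simp [hA]
  have h1 : g.order = f.order + A.order := by rw [← h, HahnSeries.order_mul hf hA]
  have hg0 : g ≠ 0 := by rw [← h]; exact mul_ne_zero hf hA
  apply HahnSeries.coeff_eq_zero_of_lt_order
  by_contra hlt
  push Not at hlt
  have : g.coeff g.order ≠ 0 := HahnSeries.coeff_order_eq_zero.not.2 hg0
  exact this (hg _ (by omega))

/-- the monomial substitution `x ↦ ε^{-s}`, `y ↦ v ε^t` -/
def psi (s t : ℕ) : MvPolynomial (Fin 2) K →+* HahnSeries ℤ (RatFunc K) :=
  MvPolynomial.eval₂Hom ((HahnSeries.C).comp (algebraMap K (RatFunc K)))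
    ![HahnSeries.single (-(s : ℤ)) 1, HahnSeries.single (t : ℤ) RatFunc.X]

lemma psi_X0 (s t : ℕ) : psi (K := K) s t (X 0) = HahnSeries.single (-(s : ℤ)) 1 := by
  simp [psi]
lemma psi_X1 (s t : ℕ) : psi (K := K) s t (X 1) = HahnSeries.single (t : ℤ) RatFunc.X := by
  simp [psi]
lemma psi_C (s t : ℕ) (c : K) :
    psi (K := K) s t (C c) = HahnSeries.single 0 (algebraMap K (RatFunc K) c) := by
  simp [psi]

lemma rd_X : rd (RatFunc.X : RatFunc K) = 1 := by
  rw [← RatFunc.algebraMap_X, rd_alg]; simp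

lemma eu_single (n : ℤ) (a : RatFunc K) : eu (HahnSeries.single n a) = HahnSeries.single n (n * a) := by
  ext m
  rw [eu_coeff]
  by_cases h : m = n
  · subst h; simp
  · simp [HahnSeries.coeff_single_of_ne h]

lemma dv_single (n : ℤ) (a : RatFunc K) : dv (HahnSeries.single n a) = HahnSeries.single n (rd a) := by
  ext m
  rw [dv_coeff]
  by_cases h : m = n
  · subst h; simp
  · simp [HahnSeries.coeff_single_of_ne h]

/-- chain rule -/
lemma chain (s t : ℕ) (D : HahnSeries ℤ (RatFunc K) →+ HahnSeries ℤ (RatFunc K))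
    (hmul : ∀ x y, D (x * y) = x * D y + y * D x)
    (hC : ∀ a : K, D (HahnSeries.single 0 (algebraMap K (RatFunc K) a)) = 0)
    (F : MvPolynomial (Fin 2) K) :
    D (psi s t F) = psi s t (pderiv 0 F) * D (psi s t (X 0)) +
      psi s t (pderiv 1 F) * D (psi s t (X 1)) := by
  induction F using MvPolynomial.induction_on with
  | C a => rw [psi_C, hC]; simp
  | add p q hp hq => simp only [map_add, hp, hq]; ring
  | mul_X p i hp =>
    rw [map_mul, hmul, hp]
    simp only [Derivation.leibniz, smul_eq_mul, map_add, map_mul]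
    fin_cases i
    · simp; ring
    · simp; ring

lemma main_C [CharZero K] (r s t : ℕ) (hs : 1 ≤ s) (ht : 1 ≤ t) (c₁ c₂ : K)
    (F Λ : MvPolynomial (Fin 2) K) (hF : psi s t F ≠ 0)
    (hd : X 1 ^ r * pderiv 0 F + (C c₁ * X 0 ^ t * X 1 ^ s + C c₂) * pderiv 1 F = Λ * F) :
    ∃ w A0 : RatFunc K,
      (algebraMap K (RatFunc K) c₁ * RatFunc.X ^ s + algebraMap K (RatFunc K) c₂) * A0 =
        (psi s t Λ).coeff (-(t : ℤ)) ∧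
      (s : RatFunc K) * ((algebraMap K (RatFunc K) c₁ * RatFunc.X ^ s + algebraMap K (RatFunc K) c₂) * rd w) +
        RatFunc.X ^ r * ((t : RatFunc K) * RatFunc.X * A0 - ((psi s t F).order : RatFunc K)) =
        (s : RatFunc K) * (psi s t Λ).coeff ((s : ℤ) + t * r) := by
  set f := psi s t F with hf
  set fx := psi s t (pderiv 0 F) with hfx
  set fy := psi s t (pderiv 1 F) with hfy
  have hdv := chain s t dv dv_mul (fun a => by rw [dv_single, Derivation.map_algebraMap]; simp) F
  have heu := chain s t eu eu_mul (fun a => by rw [eu_single]; simp) F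
  rw [psi_X0, psi_X1, dv_single, dv_single, rd_X] at hdv
  rw [psi_X0, psi_X1, eu_single, eu_single] at heu
  rw [← hf, ← hfx, ← hfy] at hdv heu
  have hrd1 : rd (1 : RatFunc K) = 0 := Derivation.map_one_eq_zero _
  rw [hrd1, HahnSeries.single_eq_zero, mul_zero, zero_add] at hdv
  obtain ⟨A, hA⟩ : ∃ A, f * A = dv f := ⟨f⁻¹ * dv f, mul_inv_cancel_left₀ hF _⟩
  obtain ⟨B, hB⟩ : ∃ B, f * B = eu f := ⟨f⁻¹ * eu f, mul_inv_cancel_left₀ hF _⟩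
  have hA0 : ∀ n < 0, A.coeff n = 0 := coeff_quot_zero f A _ 0 hF hA (fun n hn => by
    rw [dv_coeff, HahnSeries.coeff_eq_zero_of_lt_order (by omega)]; exact map_zero _)
  have hB0 : ∀ n < 0, B.coeff n = 0 := coeff_quot_zero f B _ 0 hF hB (fun n hn => by
    rw [eu_coeff, HahnSeries.coeff_eq_zero_of_lt_order (by omega)]; exact mul_zero _)
  have hB1 : ∀ n < 1, (B - HahnSeries.single 0 (f.order : RatFunc K)).coeff n = 0 := by
    refine coeff_quot_zero f _ _ 1 hF rfl (fun n hn => ?_)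
    rw [mul_sub, hB, HahnSeries.coeff_sub, eu_coeff, HahnSeries.coeff_mul_single_zero]
    by_cases h : n < f.order
    · rw [HahnSeries.coeff_eq_zero_of_lt_order h]; simp
    · obtain rfl : n = f.order := by omega
      ring
  have hBc : B.coeff 0 = (f.order : RatFunc K) := by
    have := hB1 0 (by norm_num)
    rw [HahnSeries.coeff_sub, HahnSeries.coeff_single_same] at this
    exact sub_eq_zero.1 this
  have hclosed : eu A = dv B := by
    have h1 := congrArg eu hA
    have h2 := congrArg dv hB
    rw [eu_mul, ← dv_eu, ← h2, dv_mul, ← hA, ← hB] at h1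
    apply mul_left_cancel₀ hF
    linear_combination h1
  -- the main equation
  have hpsi := congrArg (psi s t) hd
  simp only [map_add, map_mul, map_pow, psi_X0, psi_X1, psi_C, HahnSeries.single_pow,
    HahnSeries.single_mul_single] at hpsi
  rw [← hf, ← hfx, ← hfy] at hpsi
  have hM : HahnSeries.single ((s : ℤ) + t + t * r) (RatFunc.X ^ r) *
        (HahnSeries.single 0 ((t : RatFunc K) * RatFunc.X) * A - B)
      + HahnSeries.single 0 ((s : RatFunc K) * (algebraMap K (RatFunc K) c₁ * RatFunc.X ^ s + algebraMap K (RatFunc K) c₂)) * A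
      = HahnSeries.single (t : ℤ) (s : RatFunc K) * psi s t Λ := by
    apply mul_left_cancel₀ hF
    have e1 : HahnSeries.single ((s : ℤ) + t + t * r) ((RatFunc.X : RatFunc K) ^ r) *
        HahnSeries.single (-(s : ℤ)) (((-(s : ℤ) : ℤ) : RatFunc K) * 1) =
        - (HahnSeries.single (t : ℤ) (s : RatFunc K) *
          HahnSeries.single ((r : ℤ) * t) ((RatFunc.X : RatFunc K) ^ r)) := by
      rw [HahnSeries.single_mul_single, HahnSeries.single_mul_single, ← HahnSeries.single_neg]
      congr 1
      · ring_nf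
      · push_cast; ring_nf
    have e2 : HahnSeries.single (0 : ℤ) ((t : RatFunc K) * RatFunc.X) *
        HahnSeries.single (t : ℤ) (1 : RatFunc K) =
        HahnSeries.single (t : ℤ) (((t : ℤ) : RatFunc K) * RatFunc.X) := by
      rw [HahnSeries.single_mul_single]
      congr 1
      · ring_nf
      · push_cast; ring_nf
    have e3 : HahnSeries.single (0 : ℤ) ((s : RatFunc K) *
        (algebraMap K (RatFunc K) c₁ * RatFunc.X ^ s + algebraMap K (RatFunc K) c₂)) *
        HahnSeries.single (t : ℤ) (1 : RatFunc K) =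
        HahnSeries.single (t : ℤ) (s : RatFunc K) *
        (HahnSeries.single (0 : ℤ) (algebraMap K (RatFunc K) c₁ * RatFunc.X ^ s)
          + HahnSeries.single (0 : ℤ) (algebraMap K (RatFunc K) c₂)) := by
      rw [← HahnSeries.single_add, HahnSeries.single_mul_single,
        HahnSeries.single_mul_single]
      congr 1
      · ring_nf
      · ring_nf
    have hA' := hA.trans hdv
    have hB' := hB.trans heu
    have e4 : (0 : ℤ) + t • (-(s : ℤ)) + s • (t : ℤ) = 0 := by
      simp only [smul_eq_mul, nsmul_eq_mul]; ring
    rw [e4, nsmul_eq_mul, one_pow, mul_one] at hpsi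
    linear_combination (HahnSeries.single ((s : ℤ) + t + t * r) (RatFunc.X ^ r) *
      HahnSeries.single 0 ((t : RatFunc K) * RatFunc.X) + HahnSeries.single 0 ((s : RatFunc K) *
        (algebraMap K (RatFunc K) c₁ * RatFunc.X ^ s + algebraMap K (RatFunc K) c₂))) * hA'
      - HahnSeries.single ((s : ℤ) + t + t * r) (RatFunc.X ^ r) * hB'
      + HahnSeries.single ((s : ℤ) + t + t * r) (RatFunc.X ^ r) * fy * e2
      - fx * e1 + fy * e3 + HahnSeries.single (t : ℤ) (s : RatFunc K) * hpsi
  have hs0 : (s : RatFunc K) ≠ 0 := by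
    have : CharZero (RatFunc K) := charZero_of_injective_algebraMap (algebraMap K (RatFunc K)).injective
    exact_mod_cast (by omega : s ≠ 0)
  have hN0 : (((s : ℤ) + t + t * r : ℤ) : RatFunc K) ≠ 0 := by
    have : CharZero (RatFunc K) := charZero_of_injective_algebraMap (algebraMap K (RatFunc K)).injective
    exact_mod_cast (by positivity : s + t + t * r ≠ 0)
  have hco : ∀ n : ℤ, RatFunc.X ^ r * ((t : RatFunc K) * RatFunc.X * A.coeff (n - ((s : ℤ) + t + t * r))
      - B.coeff (n - ((s : ℤ) + t + t * r))) + (s : RatFunc K) *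
        (algebraMap K (RatFunc K) c₁ * RatFunc.X ^ s + algebraMap K (RatFunc K) c₂) * A.coeff n
      = (s : RatFunc K) * (psi s t Λ).coeff (n - t) := by
    intro n
    have := congrArg (fun z => HahnSeries.coeff z n) hM
    simpa [HahnSeries.coeff_single_mul, HahnSeries.coeff_sub] using this
  refine ⟨(((s : ℤ) + t + t * r : ℤ) : RatFunc K)⁻¹ * B.coeff ((s : ℤ) + t + t * r), A.coeff 0, ?_, ?_⟩
  · have h0 := hco 0
    have hneg : (0 : ℤ) - ((s : ℤ) + t + t * r) < 0 := by
      have : 0 ≤ (t : ℤ) * r := by positivity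
      omega
    rw [hA0 _ hneg, hB0 _ hneg] at h0
    apply mul_left_cancel₀ hs0
    rw [zero_sub] at h0
    rw [← h0]; ring
  · have h0 := hco ((s : ℤ) + t + t * r)
    rw [sub_self, hBc] at h0
    have h1 := congrArg (fun z => HahnSeries.coeff z ((s : ℤ) + t + t * r)) hclosed
    simp only [eu_coeff, dv_coeff] at h1
    have h2 : rd ((((s : ℤ) + t + t * r : ℤ) : RatFunc K)⁻¹ * B.coeff ((s : ℤ) + t + t * r))
        = A.coeff ((s : ℤ) + t + t * r) := by
      rw [Derivation.leibniz, ← h1]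
      have : rd ((((s : ℤ) + t + t * r : ℤ) : RatFunc K)⁻¹) = 0 := by
        have : ((((s : ℤ) + t + t * r : ℤ) : RatFunc K)⁻¹) =
          algebraMap K (RatFunc K) ((((s : ℤ) + t + t * r : ℤ) : K)⁻¹) := by
          rw [map_inv₀, map_intCast]
        rw [this, Derivation.map_algebraMap]
      rw [this, smul_zero, add_zero, smul_eq_mul, inv_mul_cancel_left₀ hN0]
    rw [h2]
    have e : (s : ℤ) + t * r = (s : ℤ) + t + t * r - t := by ring
    rw [e, ← h0]
    ring

end SecC

noncomputable section SecD
variable {K : Type*} [Field K]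

/-- coefficient of `x^i y^j` -/
def cf (F : MvPolynomial (Fin 2) K) (i j : ℕ) : K :=
  coeff (Finsupp.single 0 i + Finsupp.single 1 j) F

lemma fin2_eq (m : Fin 2 →₀ ℕ) : m = Finsupp.single 0 (m 0) + Finsupp.single 1 (m 1) := by
  ext a; fin_cases a <;> simp

lemma cf_monomial (m : Fin 2 →₀ ℕ) (a : K) (i j : ℕ) :
    cf (monomial m a) i j = if m 0 = i ∧ m 1 = j then a else 0 := by
  rw [cf, coeff_monomial]
  congr 1
  apply propext
  constructor
  · rintro rfl; simp
  · rintro ⟨rfl, rfl⟩; exact fin2_eq m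

lemma cf_add (F G : MvPolynomial (Fin 2) K) (i j : ℕ) : cf (F + G) i j = cf F i j + cf G i j := by
  simp [cf]

/-- the coefficient of `ε^n` after substitution, a polynomial in `v` -/
def psiPoly (s t : ℕ) (F : MvPolynomial (Fin 2) K) (n : ℤ) : Polynomial K :=
  ∑ m ∈ F.support, if -(s : ℤ) * m 0 + t * m 1 = n then Polynomial.monomial (m 1) (coeff m F) else 0

lemma psi_monomial (s t : ℕ) (m : Fin 2 →₀ ℕ) (a : K) :
    psi s t (monomial m a) = HahnSeries.single (-(s : ℤ) * m 0 + t * m 1)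
      (algebraMap (Polynomial K) (RatFunc K) (Polynomial.monomial (m 1) a)) := by
  have h : (monomial m a : MvPolynomial (Fin 2) K) = C a * X 0 ^ (m 0) * X 1 ^ (m 1) := by
    rw [MvPolynomial.monomial_eq, Finsupp.prod_fintype _ _ (by simp), Fin.prod_univ_two, mul_assoc]
  rw [h]
  simp only [map_mul, map_pow, psi_X0, psi_X1, psi_C, HahnSeries.single_pow,
    HahnSeries.single_mul_single]
  congr 1
  · simp; ring_nf
  · rw [← Polynomial.C_mul_X_pow_eq_monomial, map_mul, map_pow, RatFunc.algebraMap_X]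
    simp

lemma psi_coeff (s t : ℕ) (F : MvPolynomial (Fin 2) K) (n : ℤ) :
    (psi s t F).coeff n = algebraMap (Polynomial K) (RatFunc K) (psiPoly s t F n) := by
  conv_lhs => rw [F.as_sum]
  rw [map_sum, HahnSeries.coeff_sum, psiPoly, map_sum]
  refine Finset.sum_congr rfl fun m _ => ?_
  rw [psi_monomial, HahnSeries.coeff_single]
  split_ifs with h1 h2 h2
  · rfl
  · exact absurd h1.symm h2
  · exact absurd h2.symm h1
  · simp

lemma psiPoly_coeff (s t : ℕ) (hs : 1 ≤ s) (F : MvPolynomial (Fin 2) K) (i j : ℕ) (n : ℤ)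
    (h : -(s : ℤ) * i + t * j = n) : (psiPoly s t F n).coeff j = cf F i j := by
  rw [psiPoly, Polynomial.finsetSum_coeff]
  rw [Finset.sum_eq_single (Finsupp.single 0 i + Finsupp.single 1 j)]
  · have e : -(s : ℤ) * ((Finsupp.single 0 i + Finsupp.single 1 j : Fin 2 →₀ ℕ) 0 : ℕ) + t * ((Finsupp.single 0 i + Finsupp.single 1 j : Fin 2 →₀ ℕ) 1 : ℕ) = n := by
      rw [← h]; simp
    rw [if_pos e]; simp [cf]
  · intro m _ hm
    split_ifs with h1
    · rw [Polynomial.coeff_monomial]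
      split_ifs with h2
      · exfalso
        apply hm
        have : m 0 = i := by
          subst h2
          have : (s : ℤ) * m 0 = s * i := by linarith
          have := mul_left_cancel₀ (by positivity) this
          exact_mod_cast this
        rw [← this, ← h2]; exact fin2_eq m
      · rfl
    · simp
  · intro hm
    rw [MvPolynomial.notMem_support_iff] at hm
    simp [hm]

lemma psiPoly_coeff_zero (s t : ℕ) (F : MvPolynomial (Fin 2) K) (j : ℕ) (n : ℤ)
    (h : ∀ i : ℕ, -(s : ℤ) * i + t * j = n → cf F i j = 0) : (psiPoly s t F n).coeff j = 0 := by
  rw [psiPoly, Polynomial.finsetSum_coeff]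
  refine Finset.sum_eq_zero fun m _ => ?_
  split_ifs with h1
  · rw [Polynomial.coeff_monomial]
    split_ifs with h2
    · subst h2
      have := h _ h1
      rw [cf, ← fin2_eq] at this
      exact this
    · rfl
  · simp

/-- view as polynomial in `x` over `K[y]` -/
def tox : MvPolynomial (Fin 2) K →ₐ[K] Polynomial (Polynomial K) :=
  MvPolynomial.aeval ![Polynomial.X, Polynomial.C Polynomial.X]

/-- view as polynomial in `y` over `K[x]` -/
def toy : MvPolynomial (Fin 2) K →ₐ[K] Polynomial (Polynomial K) :=
  MvPolynomial.aeval ![Polynomial.C Polynomial.X, Polynomial.X]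

lemma tox_monomial (m : Fin 2 →₀ ℕ) (a : K) :
    tox (monomial m a) = Polynomial.monomial (m 0) (Polynomial.monomial (m 1) a) := by
  rw [tox, MvPolynomial.aeval_monomial, Finsupp.prod_fintype _ _ (by simp), Fin.prod_univ_two,
    ← Polynomial.C_mul_X_pow_eq_monomial, ← Polynomial.C_mul_X_pow_eq_monomial]
  simp
  ring

lemma toy_monomial (m : Fin 2 →₀ ℕ) (a : K) :
    toy (monomial m a) = Polynomial.monomial (m 1) (Polynomial.monomial (m 0) a) := by
  rw [toy, MvPolynomial.aeval_monomial, Finsupp.prod_fintype _ _ (by simp), Fin.prod_univ_two,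
    ← Polynomial.C_mul_X_pow_eq_monomial, ← Polynomial.C_mul_X_pow_eq_monomial]
  simp
  ring

lemma tox_coeff (F : MvPolynomial (Fin 2) K) (i j : ℕ) : ((tox F).coeff i).coeff j = cf F i j := by
  induction F using MvPolynomial.induction_on' with
  | add p q hp hq => rw [map_add, cf_add, Polynomial.coeff_add, Polynomial.coeff_add, hp, hq]
  | monomial m a =>
    rw [tox_monomial, cf_monomial]
    simp only [Polynomial.coeff_monomial]
    split_ifs <;> simp_all [Polynomial.coeff_monomial]

lemma toy_coeff (F : MvPolynomial (Fin 2) K) (i j : ℕ) : ((toy F).coeff j).coeff i = cf F i j := by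
  induction F using MvPolynomial.induction_on' with
  | add p q hp hq => rw [map_add, cf_add, Polynomial.coeff_add, Polynomial.coeff_add, hp, hq]
  | monomial m a =>
    rw [toy_monomial, cf_monomial]
    simp only [Polynomial.coeff_monomial]
    split_ifs <;> simp_all [Polynomial.coeff_monomial]

lemma cf_ext (F G : MvPolynomial (Fin 2) K) (h : ∀ i j, cf F i j = cf G i j) : F = G := by
  ext m
  have := h (m 0) (m 1)
  rwa [cf, cf, ← fin2_eq] at this

lemma tox_inj : Function.Injective (tox (K := K)) := fun F G h =>
  cf_ext F G fun i j => by rw [← tox_coeff, h, tox_coeff]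

lemma toy_inj : Function.Injective (toy (K := K)) := fun F G h =>
  cf_ext F G fun i j => by rw [← toy_coeff, h, toy_coeff]

lemma cf_pderiv0 (F : MvPolynomial (Fin 2) K) (i j : ℕ) :
    cf (pderiv 0 F) i j = cf F (i + 1) j * (i + 1) := by
  induction F using MvPolynomial.induction_on' with
  | add p q hp hq => rw [map_add, cf_add, cf_add, hp, hq, add_mul]
  | monomial m a =>
    rw [pderiv_monomial, cf_monomial, cf_monomial]
    rcases Nat.eq_zero_or_pos (m 0) with h0 | h0
    · simp [h0]
    · have : (m 0 - 1 = i) ↔ m 0 = i + 1 := by omega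
      simp [this]
      split_ifs with h1
      · simp [h1.1]
      · rfl

lemma cf_pderiv1 (F : MvPolynomial (Fin 2) K) (i j : ℕ) :
    cf (pderiv 1 F) i j = cf F i (j + 1) * (j + 1) := by
  induction F using MvPolynomial.induction_on' with
  | add p q hp hq => rw [map_add, cf_add, cf_add, hp, hq, add_mul]
  | monomial m a =>
    rw [pderiv_monomial, cf_monomial, cf_monomial]
    rcases Nat.eq_zero_or_pos (m 1) with h0 | h0
    · simp [h0]
    · have : (m 1 - 1 = j) ↔ m 1 = j + 1 := by omega
      simp [this]
      split_ifs with h1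
      · simp [h1.2]
      · rfl

lemma tox_pderiv0 (F : MvPolynomial (Fin 2) K) : tox (pderiv 0 F) = (tox F).derivative := by
  ext i j
  rw [tox_coeff, cf_pderiv0, Polynomial.coeff_derivative, ← tox_coeff]
  have : ((i : Polynomial K) + 1) = Polynomial.C ((i : K) + 1) := by simp
  rw [this, Polynomial.coeff_mul_C]

lemma tox_pderiv1 (F : MvPolynomial (Fin 2) K) (i : ℕ) :
    (tox (pderiv 1 F)).coeff i = ((tox F).coeff i).derivative := by
  ext j
  rw [tox_coeff, cf_pderiv1, Polynomial.coeff_derivative, ← tox_coeff]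

lemma toy_pderiv1 (F : MvPolynomial (Fin 2) K) : toy (pderiv 1 F) = (toy F).derivative := by
  ext i j
  rw [toy_coeff, cf_pderiv1, Polynomial.coeff_derivative, ← toy_coeff]
  have : ((i : Polynomial K) + 1) = Polynomial.C ((i : K) + 1) := by simp
  rw [this, Polynomial.coeff_mul_C]

lemma toy_pderiv0 (F : MvPolynomial (Fin 2) K) (i : ℕ) :
    (toy (pderiv 0 F)).coeff i = ((toy F).coeff i).derivative := by
  ext j
  rw [toy_coeff, cf_pderiv0, Polynomial.coeff_derivative, ← toy_coeff]

end SecD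

noncomputable section SecE
variable {K : Type*} [Field K]

lemma tox_X0 : tox (X 0 : MvPolynomial (Fin 2) K) = Polynomial.X := by simp [tox]
lemma tox_X1 : tox (X 1 : MvPolynomial (Fin 2) K) = Polynomial.C Polynomial.X := by simp [tox]
lemma tox_C (c : K) : tox (C c : MvPolynomial (Fin 2) K) = Polynomial.C (Polynomial.C c) := by
  rw [← MvPolynomial.algebraMap_eq, AlgHom.commutes]; rfl
lemma toy_X1 : toy (X 1 : MvPolynomial (Fin 2) K) = Polynomial.X := by simp [toy]
lemma toy_X0 : toy (X 0 : MvPolynomial (Fin 2) K) = Polynomial.C Polynomial.X := by simp [toy]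
lemma toy_C (c : K) : toy (C c : MvPolynomial (Fin 2) K) = Polynomial.C (Polynomial.C c) := by
  rw [← MvPolynomial.algebraMap_eq, AlgHom.commutes]; rfl


lemma eqx (r s t : ℕ) (c₁ c₂ : K) (F Λ : MvPolynomial (Fin 2) K)
    (hd : X 1 ^ r * pderiv 0 F + (C c₁ * X 0 ^ t * X 1 ^ s + C c₂) * pderiv 1 F = Λ * F) :
    Polynomial.C (Polynomial.X ^ r) * (tox F).derivative +
      (Polynomial.C (Polynomial.C c₁ * Polynomial.X ^ s) * Polynomial.X ^ t +
        Polynomial.C (Polynomial.C c₂)) * tox (pderiv 1 F) = tox Λ * tox F := by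
  have h := congrArg tox hd
  simp only [map_add, map_mul, map_pow, tox_X0, tox_X1, tox_C, tox_pderiv0] at h
  rw [← h]
  simp only [map_mul, map_pow]
  ring

lemma eqy (r s t : ℕ) (c₁ c₂ : K) (F Λ : MvPolynomial (Fin 2) K)
    (hd : X 1 ^ r * pderiv 0 F + (C c₁ * X 0 ^ t * X 1 ^ s + C c₂) * pderiv 1 F = Λ * F) :
    Polynomial.X ^ r * toy (pderiv 0 F) +
      (Polynomial.C (Polynomial.C c₁ * Polynomial.X ^ t) * Polynomial.X ^ s +
        Polynomial.C (Polynomial.C c₂)) * (toy F).derivative = toy Λ * toy F := by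
  have h := congrArg toy hd
  simp only [map_add, map_mul, map_pow, toy_X0, toy_X1, toy_C, toy_pderiv1] at h
  rw [← h]
  simp only [map_mul, map_pow]

lemma natDegree_tox_pderiv1 (F : MvPolynomial (Fin 2) K) :
    (tox (pderiv 1 F)).natDegree ≤ (tox F).natDegree := by
  rw [Polynomial.natDegree_le_iff_coeff_eq_zero]
  intro n hn
  rw [tox_pderiv1, Polynomial.coeff_eq_zero_of_natDegree_lt hn, Polynomial.derivative_zero]

lemma natDegree_toy_pderiv0 (F : MvPolynomial (Fin 2) K) :
    (toy (pderiv 0 F)).natDegree ≤ (toy F).natDegree := by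
  rw [Polynomial.natDegree_le_iff_coeff_eq_zero]
  intro n hn
  rw [toy_pderiv0, Polynomial.coeff_eq_zero_of_natDegree_lt hn, Polynomial.derivative_zero]

lemma H1x (r s t : ℕ) (ht : 1 ≤ t) (c₁ c₂ : K) (F Λ : MvPolynomial (Fin 2) K)
    (hF : F ≠ 0)
    (hd : X 1 ^ r * pderiv 0 F + (C c₁ * X 0 ^ t * X 1 ^ s + C c₂) * pderiv 1 F = Λ * F)
    (i j : ℕ) (h : cf Λ i j ≠ 0) : i ≤ t := by
  have hL : tox Λ ≠ 0 := by
    intro h0; rw [← tox_coeff, h0] at h; simp at h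
  have hP : tox F ≠ 0 := fun h0 => hF (tox_inj (h0.trans (map_zero _).symm))
  have hi : i ≤ (tox Λ).natDegree := Polynomial.le_natDegree_of_ne_zero (fun h0 => by
    rw [← tox_coeff, h0] at h; simp at h)
  have h1 := congrArg Polynomial.natDegree (eqx r s t c₁ c₂ F Λ hd)
  rw [Polynomial.natDegree_mul hL hP] at h1
  have h2 := natDegree_tox_pderiv1 F
  have h3 : (Polynomial.C (Polynomial.X ^ r) * (tox F).derivative +
      (Polynomial.C (Polynomial.C c₁ * Polynomial.X ^ s) * Polynomial.X ^ t +
        Polynomial.C (Polynomial.C c₂)) * tox (pderiv 1 F)).natDegree ≤ t + (tox F).natDegree := by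
    refine Polynomial.natDegree_add_le_of_degree_le ?_ ?_
    · refine (Polynomial.natDegree_C_mul_le _ _).trans ?_
      have := Polynomial.natDegree_derivative_le (tox F)
      omega
    · refine Polynomial.natDegree_mul_le.trans ?_
      refine add_le_add ?_ h2
      refine Polynomial.natDegree_add_le_of_degree_le (Polynomial.natDegree_C_mul_X_pow_le _ _) ?_
      simp
  omega

lemma H1y (r s t : ℕ) (hs : 1 ≤ s) (c₁ c₂ : K) (F Λ : MvPolynomial (Fin 2) K)
    (hF : F ≠ 0)
    (hd : X 1 ^ r * pderiv 0 F + (C c₁ * X 0 ^ t * X 1 ^ s + C c₂) * pderiv 1 F = Λ * F)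
    (i j : ℕ) (h : cf Λ i j ≠ 0) : j ≤ max r (s - 1) := by
  have hL : toy Λ ≠ 0 := by
    intro h0; rw [← toy_coeff, h0] at h; simp at h
  have hP : toy F ≠ 0 := fun h0 => hF (toy_inj (h0.trans (map_zero _).symm))
  have hi : j ≤ (toy Λ).natDegree := Polynomial.le_natDegree_of_ne_zero (fun h0 => by
    rw [← toy_coeff, h0] at h; simp at h)
  have h1 := congrArg Polynomial.natDegree (eqy r s t c₁ c₂ F Λ hd)
  rw [Polynomial.natDegree_mul hL hP] at h1
  have h2 := natDegree_toy_pderiv0 F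
  have h3 : (Polynomial.X ^ r * toy (pderiv 0 F) +
      (Polynomial.C (Polynomial.C c₁ * Polynomial.X ^ t) * Polynomial.X ^ s +
        Polynomial.C (Polynomial.C c₂)) * (toy F).derivative).natDegree ≤
        max r (s - 1) + (toy F).natDegree := by
    refine Polynomial.natDegree_add_le_of_degree_le ?_ ?_
    · refine Polynomial.natDegree_mul_le.trans ?_
      exact add_le_add ((Polynomial.natDegree_X_pow_le _).trans (le_max_left _ _)) h2
    · rcases Nat.eq_zero_or_pos (toy F).natDegree with h0 | h0
      · rw [Polynomial.derivative_of_natDegree_zero h0]; simp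
      refine Polynomial.natDegree_mul_le.trans ?_
      have h4 : (Polynomial.C (Polynomial.C c₁ * Polynomial.X ^ t) * Polynomial.X ^ s +
        Polynomial.C (Polynomial.C c₂) : Polynomial (Polynomial K)).natDegree ≤ s := by
        refine Polynomial.natDegree_add_le_of_degree_le (Polynomial.natDegree_C_mul_X_pow_le _ _) ?_
        simp
      have := Polynomial.natDegree_derivative_le (toy F)
      have := le_max_right r (s - 1)
      omega
  omega

lemma H2 [CharZero K] (r s t : ℕ) (hs : 1 ≤ s) (ht : 1 ≤ t) (c₁ c₂ : K) (F Λ : MvPolynomial (Fin 2) K)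
    (hc₁ : c₁ ≠ 0) (hF : F ≠ 0)
    (hd : X 1 ^ r * pderiv 0 F + (C c₁ * X 0 ^ t * X 1 ^ s + C c₂) * pderiv 1 F = Λ * F) :
    cf Λ t (s - 1) = c₁ * (tox F).leadingCoeff.natDegree := by
  have hP : tox F ≠ 0 := fun h0 => hF (tox_inj (h0.trans (map_zero _).symm))
  set D := (tox F).natDegree with hD
  set f := (tox F).leadingCoeff with hf
  have hf0 : f ≠ 0 := Polynomial.leadingCoeff_ne_zero.2 hP
  have hLd : (tox Λ).natDegree ≤ t := by
    rw [Polynomial.natDegree_le_iff_coeff_eq_zero]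
    intro n hn
    ext j
    rw [tox_coeff]
    by_contra h
    have := H1x r s t ht c₁ c₂ F Λ hF hd n j h
    omega
  have h1 := congrArg (fun p => Polynomial.coeff p (t + D)) (eqx r s t c₁ c₂ F Λ hd)
  rw [Polynomial.coeff_mul_add_eq_of_natDegree_le hLd le_rfl] at h1
  rw [Polynomial.coeff_add, Polynomial.coeff_C_mul, add_mul, Polynomial.coeff_add,
    mul_assoc, Polynomial.coeff_C_mul, Polynomial.coeff_C_mul, add_comm t D,
    Polynomial.coeff_X_pow_mul, tox_pderiv1, tox_pderiv1,
    Polynomial.coeff_eq_zero_of_natDegree_lt (show (tox F).natDegree < D + t by omega),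
    Polynomial.coeff_eq_zero_of_natDegree_lt (show (tox F).derivative.natDegree < D + t by
      have := Polynomial.natDegree_derivative_le (tox F)
      omega)] at h1
  have h2 : Polynomial.C c₁ * Polynomial.X ^ s * f.derivative = (tox Λ).coeff t * f := by
    rw [hf, Polynomial.leadingCoeff, ← hD, ← h1]; simp
  rw [← tox_coeff]
  set β := f.natDegree with hβ
  rcases Nat.eq_zero_or_pos β with h0 | h0
  · rw [Polynomial.derivative_of_natDegree_zero (hβ ▸ h0), mul_zero] at h2
    have := (mul_eq_zero.1 h2.symm).resolve_right hf0
    rw [this, h0]; simp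
  · by_cases hl : (tox Λ).coeff t = 0
    · exfalso
      rw [hl, zero_mul] at h2
      have h3 : f.derivative = 0 := (mul_eq_zero.1 h2).resolve_left
        (mul_ne_zero (by simpa using hc₁) (by simp))
      have := Polynomial.natDegree_eq_zero_of_derivative_eq_zero h3
      omega
    have h4 : ((tox Λ).coeff t).natDegree ≤ s - 1 := by
      have h5 := congrArg Polynomial.natDegree h2
      rw [Polynomial.natDegree_mul hl hf0] at h5
      have h6 : (Polynomial.C c₁ * Polynomial.X ^ s * f.derivative).natDegree ≤ s + (β - 1) :=
        Polynomial.natDegree_mul_le.trans (add_le_add (Polynomial.natDegree_C_mul_X_pow_le _ _)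
          (Polynomial.natDegree_derivative_le _))
      omega
    have h7 := congrArg (fun p => Polynomial.coeff p ((s - 1) + β)) h2
    rw [Polynomial.coeff_mul_add_eq_of_natDegree_le h4 le_rfl, mul_assoc, Polynomial.coeff_C_mul,
      show s - 1 + β = (β - 1) + s by omega, Polynomial.coeff_X_pow_mul,
      Polynomial.coeff_derivative, show β - 1 + 1 = β by omega] at h7
    have h8 : f.coeff β ≠ 0 := by rw [hβ]; exact Polynomial.leadingCoeff_ne_zero.2 hf0
    have h9 : ((β - 1 : ℕ) : K) + 1 = β := by
      have : β - 1 + 1 = β := by omega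
      exact_mod_cast congrArg (Nat.cast (R := K)) this
    rw [h9] at h7
    apply mul_right_cancel₀ h8
    rw [← h7]; ring

lemma H3 [CharZero K] (r s t : ℕ) (hs : 1 ≤ s) (c₁ c₂ : K) (F Λ : MvPolynomial (Fin 2) K)
    (hc₂ : c₂ ≠ 0) (hF : F ≠ 0)
    (hd : X 1 ^ r * pderiv 0 F + (C c₁ * X 0 ^ t * X 1 ^ s + C c₂) * pderiv 1 F = Λ * F) :
    ∃ i, cf F i 0 ≠ 0 := by
  have hP : toy F ≠ 0 := fun h0 => hF (toy_inj (h0.trans (map_zero _).symm))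
  set e := (toy F).natTrailingDegree with he
  have hlow : ∀ n < e, (toy F).coeff n = 0 := fun n hn =>
    Polynomial.coeff_eq_zero_of_lt_natTrailingDegree hn
  have hne : (toy F).coeff e ≠ 0 := Polynomial.trailingCoeff_nonzero_iff_nonzero.2 hP
  rcases Nat.eq_zero_or_pos e with h0 | h0
  · rw [h0] at hne
    by_contra hcon
    push Not at hcon
    apply hne
    ext i
    rw [toy_coeff, hcon]; simp
  exfalso
  have d1 : Polynomial.X ^ e ∣ toy F := Polynomial.X_pow_dvd_iff.2 hlow
  have d2 : Polynomial.X ^ e ∣ toy (pderiv 0 F) := Polynomial.X_pow_dvd_iff.2 fun n hn => by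
    rw [toy_pderiv0, hlow n hn, Polynomial.derivative_zero]
  have d3 : Polynomial.X ^ (e - 1) ∣ (toy F).derivative := Polynomial.X_pow_dvd_iff.2 fun n hn => by
    rw [Polynomial.coeff_derivative, hlow (n + 1) (by omega), zero_mul]
  have d4 : Polynomial.X ^ e ∣ Polynomial.X ^ s * (toy F).derivative := by
    have : (Polynomial.X ^ e : Polynomial (Polynomial K)) = Polynomial.X * Polynomial.X ^ (e - 1) := by
      rw [← pow_succ', Nat.sub_add_cancel h0]
    rw [this]
    exact mul_dvd_mul (dvd_pow_self _ (by omega)) d3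
  have d5 : Polynomial.X ^ e ∣ Polynomial.C (Polynomial.C c₂) * (toy F).derivative := by
    have : Polynomial.C (Polynomial.C c₂) * (toy F).derivative = toy Λ * toy F -
      Polynomial.X ^ r * toy (pderiv 0 F) -
      Polynomial.C (Polynomial.C c₁ * Polynomial.X ^ t) * (Polynomial.X ^ s * (toy F).derivative) := by
      rw [← eqy r s t c₁ c₂ F Λ hd]; ring
    rw [this]
    exact dvd_sub (dvd_sub (d1.mul_left _) (d2.mul_left _)) (d4.mul_left _)
  have h6 := Polynomial.X_pow_dvd_iff.1 d5 (e - 1) (by omega)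
  rw [Polynomial.coeff_C_mul, Polynomial.coeff_derivative, Nat.sub_add_cancel h0] at h6
  have h7 : (((e - 1 : ℕ) : Polynomial K) + 1) ≠ 0 := by exact_mod_cast Nat.succ_ne_zero (e - 1)
  exact mul_ne_zero (by simpa using hc₂) (mul_ne_zero hne h7) h6

end SecE

noncomputable section SecG
variable {K : Type*} [Field K]

lemma theta_squarefree [CharZero K] (s : ℕ) (hs : 1 ≤ s) (c₁ c₂ : K) (hc₂ : c₂ ≠ 0) :
    Squarefree (Polynomial.C c₁ * Polynomial.X ^ s + Polynomial.C c₂ : Polynomial K) := by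
  apply Polynomial.Separable.squarefree
  have hs0 : (s : K) ≠ 0 := by exact_mod_cast (by omega : s ≠ 0)
  refine ⟨Polynomial.C c₂⁻¹, - (Polynomial.C (c₂⁻¹ * (s : K)⁻¹) * Polynomial.X), ?_⟩
  obtain ⟨n, rfl⟩ : ∃ n, s = n + 1 := ⟨s - 1, by omega⟩
  simp only [Polynomial.derivative_add, Polynomial.derivative_C, Polynomial.derivative_C_mul_X_pow,
    map_mul, Nat.add_sub_cancel]
  have h1 : Polynomial.C c₂⁻¹ * Polynomial.C c₂ = (1 : Polynomial K) := by
    rw [← Polynomial.C_mul, inv_mul_cancel₀ hc₂, Polynomial.C_1]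
  have h2 : Polynomial.C (((n + 1 : ℕ) : K)⁻¹) * Polynomial.C ((n + 1 : ℕ) : K) = (1 : Polynomial K) := by
    rw [← Polynomial.C_mul, inv_mul_cancel₀ hs0, Polynomial.C_1]
  rw [pow_succ]
  linear_combination h1 - Polynomial.C c₂⁻¹ * Polynomial.C c₁ * Polynomial.X ^ n * Polynomial.X * h2

lemma darboux [CharZero K] (r s t : ℕ) (hs : 1 ≤ s) (ht : 1 ≤ t) (c₁ c₂ : K)
    (hc₁ : c₁ ≠ 0) (hc₂ : c₂ ≠ 0)
    (F Λ : MvPolynomial (Fin 2) K) (hF : F ≠ 0)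
    (hd : X 1 ^ r * pderiv 0 F + (C c₁ * X 0 ^ t * X 1 ^ s + C c₂) * pderiv 1 F = Λ * F) :
    IsUnit F := by
  obtain ⟨i0, hi0⟩ := H3 r s t hs c₁ c₂ F Λ hc₂ hF hd
  have hlam := H2 r s t hs ht c₁ c₂ F Λ hc₁ hF hd
  set β := (tox F).leadingCoeff.natDegree with hβ
  have hcoef : ∀ i j : ℕ, cf F i j ≠ 0 → (psi s t F).coeff (-(s : ℤ) * i + t * j) ≠ 0 := by
    intro i j hij h
    rw [psi_coeff] at h
    have h' : psiPoly s t F (-(s : ℤ) * i + t * j) = 0 :=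
      (map_eq_zero_iff _ (FaithfulSMul.algebraMap_injective (Polynomial K) (RatFunc K))).1 h
    rw [← psiPoly_coeff s t hs F i j _ rfl, h'] at hij
    simp at hij
  have hpF : psi s t F ≠ 0 := by
    intro h
    apply hcoef i0 0 hi0
    rw [h]; simp
  have hord : ∀ i j : ℕ, cf F i j ≠ 0 → (psi s t F).order ≤ -(s : ℤ) * i + t * j := fun i j h =>
    HahnSeries.order_le_of_coeff_ne_zero (hcoef i j h)
  obtain ⟨w, A0, hA, hw⟩ := main_C r s t hs ht c₁ c₂ F Λ hpF hd
  set o := (psi s t F).order with ho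
  have ho0 : o ≤ 0 := by
    have := hord i0 0 hi0
    have h2 : (0 : ℤ) ≤ s * i0 := by positivity
    push_cast at this
    linarith
  rw [psi_coeff] at hA hw
  set M0 := psiPoly s t Λ (-(t : ℤ)) with hM0
  set MN := psiPoly s t Λ ((s : ℤ) + t * r) with hMN
  set Θ : Polynomial K := Polynomial.C c₁ * Polynomial.X ^ s + Polynomial.C c₂ with hΘ
  have hΘa : algebraMap K (RatFunc K) c₁ * RatFunc.X ^ s + algebraMap K (RatFunc K) c₂ =
      algebraMap (Polynomial K) (RatFunc K) Θ := by
    rw [hΘ, map_add, map_mul, map_pow, RatFunc.algebraMap_X, algC, algC]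
  rw [hΘa] at hA hw
  set S : Polynomial K := (s : Polynomial K) * (Θ * MN) -
    (t : Polynomial K) * (Polynomial.X ^ (r + 1) * M0) + (o : Polynomial K) * (Polynomial.X ^ r * Θ) with hS
  have heq : (algebraMap (Polynomial K) (RatFunc K) Θ) ^ 2 * rd (s • w) =
      algebraMap (Polynomial K) (RatFunc K) S := by
    rw [map_nsmul, nsmul_eq_mul, hS]
    simp only [map_add, map_sub, map_mul, map_pow, map_natCast, map_intCast, RatFunc.algebraMap_X]
    linear_combination algebraMap (Polynomial K) (RatFunc K) Θ * hw
      - (t : RatFunc K) * RatFunc.X ^ (r + 1) * hA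
  obtain ⟨V, -, hV⟩ := rat_lemma Θ S (theta_squarefree s hs c₁ c₂ hc₂) _ heq
  -- coefficients of MN
  have hMNa : ∀ q, MN.coeff (r + q * s) = 0 := by
    intro q
    apply psiPoly_coeff_zero
    intro i hi
    by_contra hne
    have h1 := H1y r s t hs c₁ c₂ F Λ hF hd i _ hne
    rcases Nat.eq_zero_or_pos q with h0 | h0
    · subst h0
      push_cast at hi
      have : (s : ℤ) * (i + 1) = 0 := by linear_combination -hi
      have : (0 : ℤ) < (s : ℤ) * (i + 1) := by positivity
      omega
    · have : s ≤ q * s := Nat.le_mul_of_pos_left s h0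
      omega
  have hMNb : ∀ q j, j + q * s = r → MN.coeff j = 0 := by
    intro q j hj
    apply psiPoly_coeff_zero
    intro i hi
    exfalso
    rw [← hj] at hi
    push_cast at hi
    have : (s : ℤ) * (i + 1) + t * (q * s) = 0 := by linear_combination -hi
    have : (0 : ℤ) < (s : ℤ) * (i + 1) + t * (q * s) := by positivity
    omega
  have hM0a : ∀ q, 2 ≤ q → M0.coeff (q * s - 1) = 0 := by
    intro q hq
    have hqs : 1 ≤ q * s := Nat.mul_pos (by omega) (by omega)
    apply psiPoly_coeff_zero
    intro i hi
    by_contra hne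
    have h1 := H1x r s t ht c₁ c₂ F Λ hF hd i _ hne
    push_cast [hqs] at hi
    have h2 : (s : ℤ) * i = s * (t * q) := by linear_combination -hi
    have h3 := mul_left_cancel₀ (by positivity) h2
    have h4 : i = t * q := by exact_mod_cast h3
    nlinarith
  have hM0b : M0.coeff (s - 1) = cf Λ t (s - 1) := by
    apply psiPoly_coeff s t hs
    push_cast [hs]
    ring
  have hΘc : ∀ (P : Polynomial K) (n : ℕ), (Θ * P).coeff (n + s) = c₁ * P.coeff n + c₂ * P.coeff (n + s) := by
    intro P n
    rw [hΘ, add_mul, Polynomial.coeff_add, mul_assoc, Polynomial.coeff_C_mul,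
      Polynomial.coeff_X_pow_mul, Polynomial.coeff_C_mul]
  have hΘl : ∀ (P : Polynomial K) (n : ℕ), n < s → (Θ * P).coeff n = c₂ * P.coeff n := by
    intro P n hn
    rw [hΘ, add_mul, Polynomial.coeff_add, mul_assoc, Polynomial.coeff_C_mul,
      Polynomial.coeff_X_pow_mul', Polynomial.coeff_C_mul, if_neg (by omega)]
    ring
  have hSc : ∀ n, S.coeff n = s * (Θ * MN).coeff n - t * (Polynomial.X ^ (r + 1) * M0).coeff n
      + o * (Polynomial.X ^ r * Θ).coeff n := by
    intro n
    rw [hS, ← Polynomial.C_eq_natCast, ← Polynomial.C_eq_natCast, ← Polynomial.C_eq_intCast]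
    simp only [Polynomial.coeff_add, Polynomial.coeff_sub, Polynomial.coeff_C_mul]
  have hΘMNb : ∀ q j, j + q * s = r → (Θ * MN).coeff j = 0 := by
    intro q j hj
    by_cases hjs : j < s
    · rw [hΘl _ _ hjs, hMNb q j hj, mul_zero]
    · obtain ⟨n, rfl⟩ : ∃ n, j = n + s := ⟨j - s, by omega⟩
      rw [hΘc, hMNb q _ hj, hMNb (q + 1) n (by rw [← hj]; ring)]
      ring
  have hΘMNa : ∀ q, (Θ * MN).coeff (r + q * s) = 0 := by
    intro q
    rcases Nat.eq_zero_or_pos q with h0 | h0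
    · exact hΘMNb 0 _ (by rw [h0]; ring)
    · obtain ⟨p, rfl⟩ : ∃ p, q = p + 1 := ⟨q - 1, by omega⟩
      have e : r + (p + 1) * s = (r + p * s) + s := by ring
      rw [e, hΘc, hMNa p, ← e, hMNa (p + 1)]
      ring
  have hXM : ∀ q, 1 ≤ q → (Polynomial.X ^ (r + 1) * M0).coeff (r + q * s) = M0.coeff (q * s - 1) := by
    intro q hq
    have hqs : 1 ≤ q * s := Nat.mul_pos (by omega) (by omega)
    have e : r + q * s = (q * s - 1) + (r + 1) := by omega
    rw [e, Polynomial.coeff_X_pow_mul]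
  have hXMl : ∀ j, j ≤ r → (Polynomial.X ^ (r + 1) * M0).coeff j = 0 := by
    intro j hj
    rw [Polynomial.coeff_X_pow_mul', if_neg (by omega)]
  have hXΘ : ∀ j, (Polynomial.X ^ r * Θ).coeff (r + j) = Θ.coeff j := by
    intro j
    rw [add_comm r j, Polynomial.coeff_X_pow_mul]
  have hΘco : ∀ j, Θ.coeff j = (if j = s then c₁ else 0) + (if j = 0 then c₂ else 0) := by
    intro j
    rw [hΘ, Polynomial.coeff_add, Polynomial.coeff_C_mul_X_pow, Polynomial.coeff_C]
  have hS1 : ∀ q, 2 ≤ q → S.coeff (r + q * s) = 0 := by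
    intro q hq
    have h2s : 2 * s ≤ q * s := Nat.mul_le_mul_right s hq
    rw [hSc, hΘMNa, hXM q (by omega), hM0a q hq, hXΘ, hΘco, if_neg (by omega), if_neg (by omega)]
    ring
  have hS2 : ∀ q j, 1 ≤ q → j + q * s = r → S.coeff j = 0 := by
    intro q j hq hj
    have hqs : 1 ≤ q * s := Nat.mul_pos (by omega) (by omega)
    rw [hSc, hΘMNb q j hj, hXMl j (by omega), Polynomial.coeff_X_pow_mul', if_neg (by omega)]
    ring
  have hS3 : S.coeff r = o * c₂ := by
    rw [hSc, hΘMNb 0 r (by ring), hXMl r le_rfl]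
    have := hXΘ 0
    rw [add_zero] at this
    rw [this, hΘco, if_neg (by omega), if_pos rfl]
    ring
  have hS4 : S.coeff (r + s) = o * c₁ - t * (c₁ * β) := by
    have h1 := hΘMNa 1
    have h2 := hXM 1 le_rfl
    rw [one_mul] at h1 h2
    rw [hSc, h1, h2, hM0b, hlam, hXΘ, hΘco, if_pos rfl, if_neg (by omega)]
    ring
  have hnum := num_lemma r s hs c₁ c₂ hc₁ hc₂ V S hV hS1 hS2
  rw [hS3, hS4] at hnum
  have hfin : (s : K) * o = (r + 1) * t * β := by
    apply mul_left_cancel₀ (mul_ne_zero hc₁ hc₂)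
    linear_combination -hnum
  have hfin' : (s : ℤ) * o = (r + 1) * t * β := by exact_mod_cast hfin
  have hβ0 : β = 0 := by
    by_contra hne
    have : 0 < β := Nat.pos_of_ne_zero hne
    have h1 : (0 : ℤ) < (r + 1) * t * β := by positivity
    have h2 : (s : ℤ) * o ≤ 0 := mul_nonpos_of_nonneg_of_nonpos (by positivity) ho0
    omega
  have ho1 : o = 0 := by
    rw [hβ0] at hfin'
    have : (s : ℤ) * o = 0 := by rw [hfin']; ring
    exact (mul_eq_zero.1 this).resolve_left (by positivity)
  have hP : tox F ≠ 0 := fun h0 => hF (tox_inj (h0.trans (map_zero _).symm))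
  have hlc : (tox F).leadingCoeff.coeff 0 ≠ 0 := by
    rw [← hβ0, hβ]
    exact Polynomial.leadingCoeff_ne_zero.2 (Polynomial.leadingCoeff_ne_zero.2 hP)
  have hD : (tox F).natDegree = 0 := by
    have h1 : cf F (tox F).natDegree 0 ≠ 0 := by
      rw [← tox_coeff]; exact hlc
    have h2 := hord _ _ h1
    rw [ho1] at h2
    by_contra hne
    have h3 : 0 < (tox F).natDegree := Nat.pos_of_ne_zero hne
    have h4 : (0 : ℤ) < s * (tox F).natDegree := by positivity
    push_cast at h2
    linarith
  have h1 : tox F = tox (C ((tox F).leadingCoeff.coeff 0)) := by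
    rw [tox_C]
    conv_lhs => rw [Polynomial.eq_C_of_natDegree_eq_zero hD]
    congr 1
    rw [← Polynomial.eq_C_of_natDegree_eq_zero hβ0, Polynomial.leadingCoeff, hD]
  rw [tox_inj h1]
  exact (isUnit_iff_ne_zero.2 hlc).map C

end SecG

section SecH

lemma iter_leibniz {k A : Type*} [Field k] [CommRing A] [Algebra k A] (d : Derivation k A A)
    (m : Ideal A) (n : ℕ) : ∀ (a b : A) (i j : ℕ), (∀ i' < i, d^[i'] a ∈ m) →
      (∀ j' < j, d^[j'] b ∈ m) → (n < i + j → d^[n] (a * b) ∈ m) ∧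
      (n = i + j → d^[n] (a * b) - (n.choose i : A) * (d^[i] a * d^[j] b) ∈ m) := by
  have hadd : ∀ (n : ℕ) (x y : A), d^[n] (x + y) = d^[n] x + d^[n] y := by
    intro n
    induction n with
    | zero => intro x y; rfl
    | succ n ih => intro x y; rw [Function.iterate_succ_apply, map_add, ih]; rfl
  induction n with
  | zero =>
    intro a b i j hi hj
    refine ⟨fun h => ?_, fun h => ?_⟩
    · rcases Nat.eq_zero_or_pos i with h0 | h0
      · exact m.mul_mem_left a (hj 0 (by omega))
      · exact m.mul_mem_right b (hi 0 h0)
    · obtain ⟨rfl, rfl⟩ : i = 0 ∧ j = 0 := by omega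
      simp
  | succ n ih =>
    intro a b i j hi hj
    have key : d^[n + 1] (a * b) = d^[n] (a * d b) + d^[n] (d a * b) := by
      rw [Function.iterate_succ_apply, Derivation.leibniz, hadd, smul_eq_mul, smul_eq_mul,
        mul_comm b]
    have hi' : ∀ i' < i - 1, d^[i'] (d a) ∈ m := fun i' h => by
      rw [← Function.iterate_succ_apply]; exact hi _ (by omega)
    have hj' : ∀ j' < j - 1, d^[j'] (d b) ∈ m := fun j' h => by
      rw [← Function.iterate_succ_apply]; exact hj _ (by omega)
    have h1 := ih a (d b) i (j - 1) hi hj'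
    have h2 := ih (d a) b (i - 1) j hi' hj
    rw [key]
    refine ⟨fun h => m.add_mem (h1.1 (by omega)) (h2.1 (by omega)), fun h => ?_⟩
    rcases Nat.eq_zero_or_pos i with hi0 | hi0
    · subst hi0
      obtain ⟨j, rfl⟩ : ∃ j', j = j' + 1 := ⟨j - 1, by omega⟩
      have e1 := h1.2 (by omega)
      have e2 := h2.1 (by omega)
      convert m.add_mem e1 e2 using 1
      simp
      ring
    · obtain ⟨i, rfl⟩ : ∃ i', i = i' + 1 := ⟨i - 1, by omega⟩
      have e2 := h2.2 (by omega)
      rcases Nat.eq_zero_or_pos j with hj0 | hj0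
      · subst hj0
        have e1 := h1.1 (by omega)
        obtain rfl : n = i := by omega
        convert m.add_mem e1 e2 using 1
        simp
        ring
      · obtain ⟨j, rfl⟩ : ∃ j', j = j' + 1 := ⟨j - 1, by omega⟩
        have e1 := h1.2 (by omega)
        convert m.add_mem e1 e2 using 1
        simp [Nat.choose_succ_succ]
        ring

lemma exists_prime_diff {k A : Type*} [Field k] [CharZero k] [CommRing A] [Algebra k A]
    (d : Derivation k A A) (I : Ideal A) (hI : I ≠ ⊤) (hd : ∀ f ∈ I, d f ∈ I) :
    ∃ P : Ideal A, P.IsPrime ∧ I ≤ P ∧ ∀ f ∈ P, d f ∈ P := by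
  obtain ⟨m, hm, hIm⟩ := Ideal.exists_le_maximal I hI
  have hadd : ∀ (n : ℕ) (x y : A), d^[n] (x + y) = d^[n] x + d^[n] y := by
    intro n
    induction n with
    | zero => intro x y; rfl
    | succ n ih => intro x y; rw [Function.iterate_succ_apply, map_add, ih]; rfl
  have hzero : ∀ n : ℕ, d^[n] (0 : A) = 0 := by
    intro n
    induction n with
    | zero => rfl
    | succ n ih => rw [Function.iterate_succ_apply, map_zero, ih]
  have hmul : ∀ (n : ℕ) (b a : A), (∀ l, d^[l] a ∈ m) → d^[n] (b * a) ∈ m := fun n b a h =>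
    (iter_leibniz d m n b a 0 (n + 1) (by simp) (fun l _ => h l)).1 (by omega)
  let P : Ideal A :=
    { carrier := {a | ∀ n, d^[n] a ∈ m}
      add_mem' := fun {a b} ha hb n => by
        rw [hadd]; exact m.add_mem (ha n) (hb n)
      zero_mem' := fun n => by rw [hzero]; exact m.zero_mem
      smul_mem' := fun b a ha n => hmul n b a ha }
  have hP : ∀ a, a ∈ P ↔ ∀ n, d^[n] a ∈ m := fun a => Iff.rfl
  refine ⟨P, ?_, ?_, ?_⟩
  · constructor
    · intro h
      have h1 : (1 : A) ∈ P := by rw [h]; trivial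
      exact hm.ne_top ((Ideal.eq_top_iff_one _).2 ((hP 1).1 h1 0))
    · intro a b hab
      by_contra hcon
      push Not at hcon
      obtain ⟨ha, hb⟩ := hcon
      classical
      rw [hP] at ha hb
      push Not at ha hb
      have h1 := (iter_leibniz d m (Nat.find ha + Nat.find hb) a b (Nat.find ha) (Nat.find hb)
        (fun i hi => not_not.1 (Nat.find_min ha hi)) (fun i hi => not_not.1 (Nat.find_min hb hi))).2 rfl
      have h2 := (hP _).1 hab (Nat.find ha + Nat.find hb)
      have h3 := m.sub_mem h2 h1
      rw [sub_sub_cancel] at h3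
      rcases hm.isPrime.mem_or_mem h3 with h4 | h4
      · apply hm.ne_top
        refine Ideal.eq_top_of_isUnit_mem _ h4 ?_
        rw [← map_natCast (algebraMap k A)]
        refine (isUnit_iff_ne_zero.2 ?_).map _
        exact_mod_cast (Nat.choose_pos (Nat.le_add_right _ _)).ne'
      · rcases hm.isPrime.mem_or_mem h4 with h5 | h5
        · exact Nat.find_spec ha h5
        · exact Nat.find_spec hb h5
  · intro a ha n
    have : ∀ n, ∀ a ∈ I, d^[n] a ∈ I := by
      intro n
      induction n with
      | zero => intro a ha; exact ha
      | succ n ih => intro a ha; rw [Function.iterate_succ_apply]; exact ih _ (hd a ha)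
    exact hIm (this n a ha)
  · intro a ha n
    rw [← Function.iterate_succ_apply]; exact ha _

lemma pseudo {R : Type*} [CommRing R] [IsDomain R] (P : Ideal (Polynomial R))
    (f : Polynomial R) (hf : Prime f) (hfP : f ∈ P)
    (hno : ∀ p : R, Polynomial.C p ∈ P → p = 0) (g : Polynomial R) (hg : g ∈ P) : f ∣ g := by
  classical
  have hex : ∃ n, ∃ h ∈ P, h ≠ 0 ∧ h.natDegree = n := ⟨_, f, hfP, hf.ne_zero, rfl⟩
  obtain ⟨h, hhP, hh0, hhn⟩ := Nat.find_spec hex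
  have hmin : ∀ q ∈ P, q.natDegree < h.natDegree → q = 0 := by
    intro q hq hlt
    by_contra hq0
    exact Nat.find_min hex (hhn ▸ hlt) ⟨q, hq, hq0, rfl⟩
  have hdeg0 : ∀ q ∈ P, q ≠ 0 → 0 < q.natDegree := by
    intro q hq hq0
    by_contra hlt
    have e := Polynomial.eq_C_of_natDegree_eq_zero (p := q) (by omega)
    rw [e] at hq
    rw [hno _ hq] at e
    exact hq0 (by simpa using e)
  have hlc : h.leadingCoeff ≠ 0 := Polynomial.leadingCoeff_ne_zero.2 hh0
  have key : ∀ n, ∀ q ∈ P, q.natDegree = n → ∃ l : ℕ, h ∣ Polynomial.C h.leadingCoeff ^ l * q := by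
    intro n
    induction n using Nat.strong_induction_on with
    | _ n ih =>
      intro q hq hqn
      by_cases hlt : q.natDegree < h.natDegree
      · rw [hmin q hq hlt]; exact ⟨0, by simp⟩
      · push Not at hlt
        have hpos : 0 < q.natDegree := lt_of_lt_of_le (hdeg0 h hhP hh0) hlt
        have h1 := Polynomial.natDegree_cancelLeads_lt_of_natDegree_le_natDegree hlt hpos
        have e : h.cancelLeads q = Polynomial.C h.leadingCoeff * q -
            Polynomial.C q.leadingCoeff * Polynomial.X ^ (q.natDegree - h.natDegree) * h := by
          rw [Polynomial.cancelLeads, Nat.sub_eq_zero_of_le hlt]; simp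
        obtain ⟨l, hl⟩ := ih _ (hqn ▸ h1) (h.cancelLeads q) (by
          rw [e]; exact P.sub_mem (P.mul_mem_left _ hq) (P.mul_mem_left _ hhP)) rfl
        refine ⟨l + 1, ?_⟩
        have e2 : Polynomial.C h.leadingCoeff ^ (l + 1) * q =
          Polynomial.C h.leadingCoeff ^ l * h.cancelLeads q + (Polynomial.C h.leadingCoeff ^ l *
            (Polynomial.C q.leadingCoeff * Polynomial.X ^ (q.natDegree - h.natDegree))) * h := by
          rw [e]; ring
        rw [e2]
        exact dvd_add hl (dvd_mul_left _ _)
  have hndvd : ∀ l : ℕ, ∀ q : Polynomial R, 0 < q.natDegree → ¬ q ∣ Polynomial.C h.leadingCoeff ^ l := by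
    intro l q hq hdvd
    rw [← map_pow] at hdvd
    have h0 : (Polynomial.C (h.leadingCoeff ^ l) : Polynomial R) ≠ 0 := by
      simpa using fun h' => absurd h' hh0
    have := Polynomial.natDegree_le_of_dvd hdvd h0
    rw [Polynomial.natDegree_C] at this
    omega
  have hfd := hdeg0 f hfP hf.ne_zero
  have hfh : f ∣ h := by
    obtain ⟨l, q, hq⟩ := key _ f hfP rfl
    have : f ∣ h * q := ⟨_, hq.symm.trans (mul_comm _ _)⟩
    rcases hf.dvd_or_dvd this with h1 | ⟨q', rfl⟩
    · exact h1
    · exfalso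
      apply hndvd l h (hdeg0 h hhP hh0)
      refine ⟨q', mul_right_cancel₀ hf.ne_zero ?_⟩
      rw [hq]; ring
  obtain ⟨l, hl⟩ := key _ g hg rfl
  rcases hf.dvd_or_dvd (hfh.trans hl) with h1 | h1
  · exact absurd h1 (hndvd l f hfd)
  · exact h1

end SecH

theorem simple_derivation_yr_dx_c1xtys_c2
    (k : Type*) [Field k] [CharZero k]
    (r s t : ℕ) (hs : 1 ≤ s) (ht : 1 ≤ t)
    (c₁ c₂ : k) (hc₁ : c₁ ≠ 0) (hc₂ : c₂ ≠ 0) :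
    IsSimpleDerivation
      (MvPolynomial.mkDerivation k
        ![X 1 ^ r, C c₁ * X 0 ^ t * X 1 ^ s + C c₂]) := by
  intro I hI
  by_contra hcon
  push Not at hcon
  obtain ⟨hbot, htop⟩ := hcon
  obtain ⟨P, hP, hIP, hdP⟩ := exists_prime_diff _ I htop hI
  set d := MvPolynomial.mkDerivation k
        ![(X 1 ^ r : MvPolynomial (Fin 2) k), C c₁ * X 0 ^ t * X 1 ^ s + C c₂] with hd
  have hd0 : d (X 0) = X 1 ^ r := by rw [hd, MvPolynomial.mkDerivation_X]; rfl
  have hd1 : d (X 1) = C c₁ * X 0 ^ t * X 1 ^ s + C c₂ := by rw [hd, MvPolynomial.mkDerivation_X]; rfl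
  have hdF : ∀ F, d F = X 1 ^ r * pderiv 0 F + (C c₁ * X 0 ^ t * X 1 ^ s + C c₂) * pderiv 1 F := by
    intro F
    have : d = (X 1 ^ r : MvPolynomial (Fin 2) k) • pderiv 0 +
        (C c₁ * X 0 ^ t * X 1 ^ s + C c₂ : MvPolynomial (Fin 2) k) • pderiv 1 := by
      apply MvPolynomial.derivation_ext
      intro i
      fin_cases i
      · change d (X 0) = _
        rw [hd0]; simp
      · change d (X 1) = _
        rw [hd1]; simp
    rw [this]; simp
  have hPbot : P ≠ ⊥ := fun h => hbot (le_bot_iff.1 (h ▸ hIP))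
  have hunit : ∀ c : k, c ≠ 0 → C c ∉ P := fun c hc h =>
    hP.ne_top (Ideal.eq_top_of_isUnit_mem _ h ((isUnit_iff_ne_zero.2 hc).map C))
  have hy : X 1 ∉ P := by
    intro h
    have h1 := hdP _ h
    rw [hd1] at h1
    have h2 : C c₁ * X 0 ^ t * X 1 ^ s ∈ P := P.mul_mem_left _ (P.pow_mem_of_mem h s (by omega))
    have h3 := P.sub_mem h1 h2
    rw [add_sub_cancel_left] at h3
    exact hunit c₂ hc₂ h3
  have hx : ∀ n, ∀ p : Polynomial k, p.natDegree = n → Polynomial.aeval (X 0) p ∈ P → p = 0 := by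
    intro n
    induction n with
    | zero =>
      intro p hp hpP
      rw [Polynomial.eq_C_of_natDegree_eq_zero hp] at hpP ⊢
      rw [Polynomial.aeval_C, MvPolynomial.algebraMap_eq] at hpP
      by_contra hne
      exact hunit (p.coeff 0) (fun h => hne (by rw [h]; simp)) hpP
    | succ n ih =>
      intro p hp hpP
      exfalso
      have h1 := hdP _ hpP
      rw [Derivation.map_aeval, hd0, smul_eq_mul] at h1
      rcases hP.mem_or_mem h1 with h2 | h2
      · have h3 := ih p.derivative (by rw [Polynomial.natDegree_derivative, hp]; omega) h2
        have := Polynomial.derivative_eq_zero.1 h3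
        omega
      · exact hy (hP.mem_of_pow_mem r h2)
  obtain ⟨f, hfP, hf⟩ := hP.exists_mem_prime_of_ne_bot hPbot
  let e := Polynomial.Bivariate.equivMvPolynomial k
  have he : ∀ p : Polynomial k, e (Polynomial.C p) = Polynomial.aeval (X 0) p := by
    intro p
    induction p using Polynomial.induction_on' with
    | add p q hp hq => rw [map_add, map_add, hp, hq, map_add]
    | monomial n a => 
      rw [← Polynomial.C_mul_X_pow_eq_monomial]
      simp [e]
  have hdvd : f ∣ d f := by
    have h1 := pseudo (P.comap e) (e.symm f) ((MulEquiv.prime_iff e.symm).2 hf)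
      (by simpa [Ideal.mem_comap] using hfP)
      (fun p hp => hx _ p rfl (by rw [← he]; exact hp)) (e.symm (d f))
      (by simpa [Ideal.mem_comap] using hdP _ hfP)
    have h2 := map_dvd e h1
    simpa using h2
  obtain ⟨Λ, hΛ⟩ := hdvd
  refine hf.not_isUnit (darboux r s t hs ht c₁ c₂ hc₁ hc₂ f Λ hf.ne_zero ?_)
  rw [← hdF, hΛ, mul_comm]
end
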